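/- Let (A,B) ∈ ℝ² satisfy (A-1)–(A-2) and (B-1)–(B-3). Assume there exists β > 0 with limsup_{h→0⁺} sup_{a∈ℝ} h^{-β} P(a < log A ≤ a + h) < ∞, that E[A^γ] < ∞ for some γ > max{α, α²/β}, and that the law of Z defined by P(Z ∈ ·) = E[A^α 1{log A ∈ ·}] is strongly non-lattice. Let R solve R =_d AR + B with R independent of (A,B). Then, as x → ∞, x^α P(R > x) = L̃(x)/ρ + E[(AR+B)_+^α − (AR)_+^α − B_+^α]/(αρ) + O(L(x)) + o(1), where the expectation is finite and on the right-hand side R is independent of (A,B). -/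

import Mathlib

open MeasureTheory ProbabilityTheory Filter Set

noncomputable section

/-- A measurable function `L : (0,∞) → (0,∞)` is slowly varying:
`L(λx)/L(x) → 1` as `x → ∞` for every `λ > 0`. -/
def SlowlyVarying (L : ℝ → ℝ) : Prop :=
  (∀ x > 0, 0 < L x) ∧ ∀ l : ℝ, 0 < l →
    Filter.Tendsto (fun x => L (l * x) / L x) Filter.atTop (nhds 1)

/-- A finite measure `ζ` on `ℝ` is strongly non-lattice: `limsup_{|t|→∞} |∫ e^{itz} dζ(z)| < 1`. -/
def MeasureStronglyNonLattice (ζ : Measure ℝ) : Prop :=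
  Filter.limsup (fun t : ℝ => ‖∫ z, Complex.exp (Complex.I * (↑(t * z) : ℂ)) ∂ζ‖)
    (Filter.atBot ⊔ Filter.atTop) < 1

lemma integrable_inv_vertical_quadratic (κ : ℝ) :
    Integrable (fun τ : ℝ => ((min (κ ^ 2) 1) * (1 + τ ^ 2))⁻¹) := by
  have h := integrable_inv_one_add_sq
  have := h.const_mul ((min (κ ^ 2) 1)⁻¹)
  refine this.congr (Eventually.of_forall fun τ => ?_)
  simp [mul_comm]

lemma norm_inv_mul_add_one_le {κ : ℝ} (hκ : 0 < κ) {s : ℂ} (hs : κ ≤ s.re) :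
    ‖(s * (s + 1))⁻¹‖ ≤ ((min (κ ^ 2) 1) * (1 + s.im ^ 2))⁻¹ := by
  have hk : 0 < min (κ ^ 2) 1 := lt_min (by positivity) one_pos
  rw [norm_inv]
  apply inv_anti₀ (by positivity)
  have h1 : ‖s‖ ≤ ‖s + 1‖ := by
    rw [Complex.norm_eq_sqrt_sq_add_sq, Complex.norm_eq_sqrt_sq_add_sq]
    apply Real.sqrt_le_sqrt
    simp
    nlinarith
  have h2 : ‖s‖ ^ 2 = s.re ^ 2 + s.im ^ 2 := by
    rw [Complex.sq_norm, Complex.normSq_apply]; ring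
  rw [norm_mul]
  have h3 : κ ^ 2 ≤ s.re ^ 2 := by nlinarith
  have h4 : min (κ ^ 2) 1 ≤ κ ^ 2 := min_le_left _ _
  have h5 : min (κ ^ 2) 1 ≤ 1 := min_le_right _ _
  nlinarith [norm_nonneg s, sq_nonneg s.im]

lemma hasMellin_one_sub_pos_part {s : ℂ} (hs : 0 < s.re) :
    HasMellin (fun t : ℝ => ((max (1 - t) 0 : ℝ) : ℂ)) s (s * (s + 1))⁻¹ := by
  have h1 := hasMellin_one_Ioc hs
  have h2 := hasMellin_cpow_Ioc 1 (s := s) (by simp; linarith)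
  have h := hasMellin_sub h1.1 h2.1
  have hs0 : s ≠ 0 := by rintro rfl; simp at hs
  have hs1 : s + 1 ≠ 0 := by
    intro h
    have := congrArg Complex.re h
    simp at this; linarith
  have hval : mellin (indicator (Ioc 0 1) (fun _ => 1 : ℝ → ℂ)) s -
      mellin (indicator (Ioc 0 1) (fun t => (t : ℂ) ^ (1 : ℂ) : ℝ → ℂ)) s = (s * (s + 1))⁻¹ := by
    rw [h1.2, h2.2]; field_simp; ring
  rw [hval] at h
  have heq : EqOn (fun t : ℝ => indicator (Ioc 0 1) (fun _ => 1 : ℝ → ℂ) t -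
      indicator (Ioc 0 1) (fun t => (t : ℂ) ^ (1 : ℂ) : ℝ → ℂ) t)
      (fun t : ℝ => ((max (1 - t) 0 : ℝ) : ℂ)) (Ioi 0) := by
    intro t ht
    by_cases h1 : t ≤ 1
    · have : t ∈ Ioc (0 : ℝ) 1 := ⟨ht, h1⟩
      simp [this, h1]
    · have h3 : t ∉ Ioc (0 : ℝ) 1 := fun h => h1 h.2
      simp only [indicator_of_notMem h3]
      rw [max_eq_right (by linarith)]; simp
  refine ⟨?_, ?_⟩
  · refine (integrableOn_congr_fun (fun t ht => ?_) measurableSet_Ioi).mp h.1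
    exact congrArg (fun z => (t : ℂ) ^ (s - 1) • z) (heq ht)
  · rw [← h.2]
    refine setIntegral_congr_fun measurableSet_Ioi (fun t ht => ?_)
    exact congrArg (fun z => (t : ℂ) ^ (s - 1) • z) (heq ht).symm

lemma integrable_kernel_transform {κ : ℝ} (hκ : 0 < κ) :
    Integrable (fun τ : ℝ => (((κ : ℂ) + τ * Complex.I) * ((κ : ℂ) + τ * Complex.I + 1))⁻¹) := by
  refine (integrable_inv_vertical_quadratic κ).mono' ?_ (Eventually.of_forall fun τ => ?_)
  · exact Measurable.aestronglyMeasurable (by fun_prop)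
  · have := norm_inv_mul_add_one_le hκ (s := (κ : ℂ) + τ * Complex.I) (by simp)
    simpa using this

lemma one_sub_exp_pos_part_eq_integral {κ : ℝ} (hκ : 0 < κ) (x : ℝ) :
    ((max (1 - Real.exp x) 0 : ℝ) : ℂ) = (1 / (2 * Real.pi) : ℝ) *
      ∫ τ : ℝ, Complex.exp (-((κ : ℂ) + τ * Complex.I) * x) *
        (((κ : ℂ) + τ * Complex.I) * ((κ : ℂ) + τ * Complex.I + 1))⁻¹ := by
  have hM : ∀ τ : ℝ, mellin (fun t : ℝ => ((max (1 - t) 0 : ℝ) : ℂ)) ((κ : ℂ) + τ * Complex.I) =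
      (((κ : ℂ) + τ * Complex.I) * ((κ : ℂ) + τ * Complex.I + 1))⁻¹ := fun τ =>
    (hasMellin_one_sub_pos_part (by simpa using hκ)).2
  have h := mellinInv_mellin_eq κ (fun t : ℝ => ((max (1 - t) 0 : ℝ) : ℂ)) (Real.exp_pos x)
    (hasMellin_one_sub_pos_part (by simpa using hκ)).1
    (by
      refine (integrable_kernel_transform hκ).congr (Eventually.of_forall fun τ => ?_)
      exact (hM τ).symm)
    (by apply Continuous.continuousAt; fun_prop)
  rw [← h, mellinInv]
  simp only [smul_eq_mul]
  rw [Complex.real_smul]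
  congr 1
  refine integral_congr_ae (Eventually.of_forall fun τ => ?_)
  simp only
  rw [hM τ, Complex.cpow_def_of_ne_zero (by exact_mod_cast (Real.exp_pos x).ne'),
    ← Complex.ofReal_log (Real.exp_pos x).le, Real.log_exp]
  congr 2
  ring

lemma integral_one_sub_exp_pos_part_eq (M : Measure ℝ) [SFinite M] {κ : ℝ} (hκ : 0 < κ)
    (hM : Integrable (fun v => Real.exp (κ * v)) M) (y : ℝ) :
    ((∫ v, max (1 - Real.exp (y - v)) 0 ∂M : ℝ) : ℂ) = (1 / (2 * Real.pi) : ℝ) *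
      ∫ τ : ℝ, Complex.exp (-((κ : ℂ) + τ * Complex.I) * y) *
        (((κ : ℂ) + τ * Complex.I) * ((κ : ℂ) + τ * Complex.I + 1))⁻¹ *
        ∫ v, Complex.exp (((κ : ℂ) + τ * Complex.I) * v) ∂M := by
  rw [← integral_complex_ofReal]
  simp_rw [one_sub_exp_pos_part_eq_integral hκ, integral_const_mul]
  congr 1
  have hint : Integrable (Function.uncurry fun (v τ : ℝ) =>
      Complex.exp (-((κ : ℂ) + τ * Complex.I) * ((y - v : ℝ) : ℂ)) *
        (((κ : ℂ) + τ * Complex.I) * ((κ : ℂ) + τ * Complex.I + 1))⁻¹) (M.prod volume) := by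
    have h1 := (hM.const_mul (Real.exp (-κ * y))).mul_prod (integrable_kernel_transform hκ).norm
    refine h1.mono' ?_ (Eventually.of_forall ?_)
    · exact Measurable.aestronglyMeasurable (by fun_prop)
    · rintro ⟨v, τ⟩
      simp only [Function.uncurry, norm_mul, Complex.norm_exp]
      apply le_of_eq
      congr 1
      rw [← Real.exp_add]
      congr 1
      simp
      ring
  rw [integral_integral_swap hint]
  refine integral_congr_ae (Eventually.of_forall fun τ => ?_)
  simp only
  rw [← integral_const_mul]
  refine integral_congr_ae (Eventually.of_forall fun v => ?_)
  simp only
  rw [mul_right_comm, ← Complex.exp_add]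
  congr 2
  push_cast
  ring

lemma integral_vertical_eq_of_differentiableOn_strip {F : ℂ → ℂ} {a b C : ℝ} (hab : a ≤ b)
    (hF : DifferentiableOn ℂ F {s | s.re ∈ Icc a b})
    (hb : ∀ s : ℂ, s.re ∈ Icc a b → ‖F s‖ ≤ C * (1 + s.im ^ 2)⁻¹) :
    ∫ τ : ℝ, F (a + τ * Complex.I) = ∫ τ : ℝ, F (b + τ * Complex.I) := by
  have hint : ∀ c ∈ Icc a b, Integrable fun τ : ℝ => F (c + τ * Complex.I) := by
    intro c hc
    refine (integrable_inv_one_add_sq.const_mul C).mono' ?_ (Eventually.of_forall fun τ => ?_)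
    · refine Continuous.aestronglyMeasurable ?_
      refine hF.continuousOn.comp_continuous (by fun_prop) (fun τ => ?_)
      simpa using hc
    · simpa using hb (c + τ * Complex.I) (by simpa using hc)
  have hT : ∀ c ∈ Icc a b, Tendsto (fun T : ℝ => ∫ τ in (-T)..T, F (c + τ * Complex.I)) atTop
      (nhds (∫ τ : ℝ, F (c + τ * Complex.I))) := fun c hc =>
    intervalIntegral_tendsto_integral (hint c hc) tendsto_neg_atTop_atBot tendsto_id
  have hlim : Tendsto (fun T : ℝ => (∫ τ in (-T)..T, F (b + τ * Complex.I)) -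
      ∫ τ in (-T)..T, F (a + τ * Complex.I)) atTop (nhds 0) := by
    have hbd : ∀ T : ℝ, ‖(∫ τ in (-T)..T, F (b + τ * Complex.I)) -
        ∫ τ in (-T)..T, F (a + τ * Complex.I)‖ ≤ 2 * (C * (1 + T ^ 2)⁻¹ * |b - a|) := by
      intro T
      have h := Complex.integral_boundary_rect_eq_zero_of_differentiableOn F
        (a - T * Complex.I) (b + T * Complex.I) (hF.mono (by
          intro s hs
          rw [Complex.mem_reProdIm] at hs
          have := hs.1
          simp [uIcc_of_le hab] at this
          simpa using this))
      simp only [smul_eq_mul] at h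
      simp at h
      have h1 : ‖∫ x in a..b, F (x + -(T * Complex.I))‖ ≤ C * (1 + T ^ 2)⁻¹ * |b - a| := by
        refine intervalIntegral.norm_integral_le_of_norm_le_const (fun x hx => ?_)
        rw [uIoc_of_le hab] at hx
        simpa using hb (x + -(T * Complex.I)) (by simpa using ⟨hx.1.le, hx.2⟩)
      have h2 : ‖∫ x in a..b, F (x + T * Complex.I)‖ ≤ C * (1 + T ^ 2)⁻¹ * |b - a| := by
        refine intervalIntegral.norm_integral_le_of_norm_le_const (fun x hx => ?_)
        rw [uIoc_of_le hab] at hx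
        simpa using hb (x + T * Complex.I) (by simpa using ⟨hx.1.le, hx.2⟩)
      have h3 : Complex.I * ((∫ τ in (-T)..T, F (b + τ * Complex.I)) -
        ∫ τ in (-T)..T, F (a + τ * Complex.I)) = (∫ x in a..b, F (x + T * Complex.I)) -
          ∫ x in a..b, F (x + -(T * Complex.I)) := by
        linear_combination h
      have h4 := congrArg norm h3
      rw [norm_mul, Complex.norm_I, one_mul] at h4
      rw [h4]
      exact (norm_sub_le _ _).trans (by linarith)
    refine squeeze_zero_norm hbd ?_
    have h0 : Tendsto (fun T : ℝ => (1 + T ^ 2)⁻¹) atTop (nhds 0) :=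
      tendsto_inv_atTop_zero.comp (tendsto_atTop_add_const_left _ _
        (tendsto_pow_atTop (by norm_num)))
    have := ((h0.const_mul C).mul_const |b - a|).const_mul 2
    simpa using this
  have h := tendsto_nhds_unique hlim ((hT b ⟨hab, le_rfl⟩).sub (hT a ⟨le_rfl, hab⟩))
  exact (sub_eq_zero.mp h.symm).symm

lemma integrable_exp_mul_of_mem_Icc {ν : Measure ℝ} [IsProbabilityMeasure ν] {γ σ : ℝ}
    (hγ : Integrable (fun x => Real.exp (γ * x)) ν) (hσ : σ ∈ Icc 0 γ) :
    Integrable (fun x => Real.exp (σ * x)) ν := by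
  refine ((integrable_const 1).add hγ).mono' (by fun_prop) (Eventually.of_forall fun x => ?_)
  simp only [Pi.add_apply, Real.norm_eq_abs, Real.abs_exp]
  rcases le_total x 0 with hx | hx
  · have : Real.exp (σ * x) ≤ 1 := Real.exp_le_one_iff.mpr (mul_nonpos_of_nonneg_of_nonpos hσ.1 hx)
    linarith [Real.exp_pos (γ * x)]
  · have : Real.exp (σ * x) ≤ Real.exp (γ * x) :=
      Real.exp_le_exp.mpr (mul_le_mul_of_nonneg_right hσ.2 hx)
    linarith

lemma Ioo_subset_interior_integrableExpSet {ν : Measure ℝ} [IsProbabilityMeasure ν] {γ : ℝ}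
    (hγ : Integrable (fun x => Real.exp (γ * x)) ν) :
    Ioo 0 γ ⊆ interior (integrableExpSet id ν) :=
  interior_maximal (fun _ hσ => integrable_exp_mul_of_mem_Icc hγ ⟨hσ.1.le, hσ.2.le⟩) isOpen_Ioo

lemma tendsto_integral_abs_exp_sub {ν : Measure ℝ} [IsProbabilityMeasure ν] {γ α : ℝ}
    (hγ : Integrable (fun x => Real.exp (γ * x)) ν) (hα : α ∈ Ioo 0 γ) :
    Tendsto (fun σ : ℝ => ∫ x, |Real.exp (σ * x) - Real.exp (α * x)| ∂ν) (nhds α) (nhds 0) := by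
  have h0 : (∫ x, |Real.exp (α * x) - Real.exp (α * x)| ∂ν) = 0 := by simp
  rw [← h0]
  refine tendsto_integral_filter_of_dominated_convergence
    (fun x => 2 * (1 + Real.exp (γ * x))) (Eventually.of_forall fun σ => by fun_prop) ?_
    (((integrable_const 1).add hγ).const_mul 2) (Eventually.of_forall fun x => ?_)
  · have hbd : ∀ σ ∈ Ioo 0 γ, ∀ x : ℝ, Real.exp (σ * x) ≤ 1 + Real.exp (γ * x) := by
      intro σ hσ x
      rcases le_total x 0 with hx | hx
      · have : Real.exp (σ * x) ≤ 1 :=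
          Real.exp_le_one_iff.mpr (mul_nonpos_of_nonneg_of_nonpos hσ.1.le hx)
        linarith [Real.exp_pos (γ * x)]
      · have : Real.exp (σ * x) ≤ Real.exp (γ * x) :=
          Real.exp_le_exp.mpr (mul_le_mul_of_nonneg_right hσ.2.le hx)
        linarith
    filter_upwards [isOpen_Ioo.mem_nhds hα] with σ hσ
    refine Eventually.of_forall fun x => ?_
    have h1 := hbd σ hσ x
    have h2 := hbd α hα x
    rw [Real.norm_eq_abs, abs_abs, abs_le]
    constructor <;> linarith [Real.exp_pos (σ * x), Real.exp_pos (α * x)]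
  · have : Continuous fun σ : ℝ => |Real.exp (σ * x) - Real.exp (α * x)| := by fun_prop
    exact this.tendsto α

lemma norm_complexMGF_sub_le {ν : Measure ℝ} [IsProbabilityMeasure ν] {γ α σ : ℝ}
    (hγ : Integrable (fun x => Real.exp (γ * x)) ν) (hα : α ∈ Icc 0 γ) (hσ : σ ∈ Icc 0 γ) (y : ℝ) :
    ‖complexMGF id ν (σ + y * Complex.I) - complexMGF id ν (α + y * Complex.I)‖ ≤
      ∫ x, |Real.exp (σ * x) - Real.exp (α * x)| ∂ν := by
  have hI : ∀ σ ∈ Icc 0 γ, Integrable (fun x : ℝ => Complex.exp ((σ + y * Complex.I) * x)) ν := by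
    intro σ hσ
    refine (integrable_exp_mul_of_mem_Icc hγ hσ).mono' (by fun_prop)
      (Eventually.of_forall fun x => ?_)
    rw [Complex.norm_exp]; simp
  simp only [complexMGF, id]
  rw [← integral_sub (hI σ hσ) (hI α hα)]
  refine (norm_integral_le_integral_norm _).trans (le_of_eq ?_)
  refine integral_congr_ae (Eventually.of_forall fun x => ?_)
  simp only
  rw [add_mul, add_mul, Complex.exp_add, Complex.exp_add, ← sub_mul, norm_mul]
  have h1 : ‖Complex.exp (y * Complex.I * x)‖ = 1 := by rw [Complex.norm_exp]; simp
  rw [h1, mul_one]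
  have : Complex.exp (σ * x) - Complex.exp (α * x) =
    ((Real.exp (σ * x) - Real.exp (α * x) : ℝ) : ℂ) := by push_cast; rfl
  rw [this, Complex.norm_real, Real.norm_eq_abs]

lemma complexMGF_vertical_ne_one {ν : Measure ℝ} {α δ Y₀ : ℝ}
    (hint : Integrable (fun x => Real.exp (α * x)) ν)
    (h1 : ∫ x, Real.exp (α * x) ∂ν = 1) (hδ : 0 < δ)
    (hsnl : ∀ y : ℝ, Y₀ ≤ |y| → ‖complexMGF id ν (α + y * Complex.I)‖ ≤ 1 - δ)
    {y : ℝ} (hy : y ≠ 0) : complexMGF id ν (α + y * Complex.I) ≠ 1 := by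
  intro hm
  have hI : ∀ y : ℝ, Integrable (fun x : ℝ => Complex.exp ((α + y * Complex.I) * x)) ν := by
    intro y
    refine hint.mono' (by fun_prop) (Eventually.of_forall fun x => ?_)
    rw [Complex.norm_exp]; simp
  have hre : ∀ x : ℝ, (Complex.exp ((α + y * Complex.I) * x)).re =
      Real.exp (α * x) * Real.cos (y * x) := by
    intro x
    rw [Complex.exp_re]; simp
  have h2 : ∫ x, Real.exp (α * x) * Real.cos (y * x) ∂ν = 1 := by
    have := congrArg Complex.re hm
    simp only [complexMGF, id, Complex.one_re] at this
    rw [← Complex.reCLM_apply, ← ContinuousLinearMap.integral_comp_comm _ (hI y)] at this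
    simpa only [Complex.reCLM_apply, hre] using this
  have hI2 : Integrable (fun x => Real.exp (α * x) * Real.cos (y * x)) ν := by
    have := (hI y).re
    refine this.congr (Eventually.of_forall fun x => ?_)
    simpa using hre x
  have h3 : ∫ x, (Real.exp (α * x) - Real.exp (α * x) * Real.cos (y * x)) ∂ν = 0 := by
    rw [integral_sub hint hI2, h1, h2, sub_self]
  have h3' := (integral_eq_zero_iff_of_nonneg (fun x => by
    have := Real.cos_le_one (y * x)
    have := Real.exp_pos (α * x)
    simp only [Pi.zero_apply, Pi.sub_apply]
    nlinarith) (hint.sub hI2)).mp h3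
  have h4 : ∀ᵐ x ∂ν, Complex.exp ((y * x : ℝ) * Complex.I) = 1 := by
    filter_upwards [h3'] with x hx
    have hc : Real.cos (y * x) = 1 := by
      have := Real.exp_pos (α * x)
      simp only [Pi.zero_apply, Pi.sub_apply] at hx
      have h5 : Real.exp (α * x) * (1 - Real.cos (y * x)) = 0 := by linarith
      rcases mul_eq_zero.mp h5 with h | h <;> linarith
    have hs : Real.sin (y * x) = 0 := by
      have := Real.sin_sq_add_cos_sq (y * x)
      rw [hc] at this
      nlinarith
    rw [Complex.exp_mul_I, ← Complex.ofReal_cos, ← Complex.ofReal_sin, hc, hs]; simp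
  obtain ⟨k, hk⟩ := exists_nat_ge (Y₀ / |y|)
  have hk' : Y₀ ≤ |(k : ℝ) * y| := by
    rw [div_le_iff₀ (abs_pos.mpr hy)] at hk
    rwa [abs_mul, Nat.abs_cast]
  have h5 := hsnl _ hk'
  have h6 : complexMGF id ν (α + ((k : ℝ) * y : ℝ) * Complex.I) = 1 := by
    simp only [complexMGF, id]
    have : ∫ x : ℝ, Complex.exp ((α + ((k : ℝ) * y : ℝ) * Complex.I) * x) ∂ν =
        ∫ x : ℝ, ((Real.exp (α * x) : ℝ) : ℂ) ∂ν := by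
      refine integral_congr_ae ?_
      filter_upwards [h4] with x hx
      have : ((α : ℂ) + ((k : ℝ) * y : ℝ) * Complex.I) * x = α * x + k * ((y * x : ℝ) * Complex.I) := by
        push_cast; ring
      rw [this, Complex.exp_add, Complex.exp_nat_mul, hx]
      simp
    rw [this, integral_complex_ofReal, h1]; simp
  rw [h6] at h5
  simp at h5
  linarith

lemma exists_bounded_extension_inv_one_sub_complexMGF {ν : Measure ℝ} [IsProbabilityMeasure ν]
    {α γ δ Y₀ ρ : ℝ} (hα : 0 < α) (hαγ : α < γ)
    (hγ : Integrable (fun x => Real.exp (γ * x)) ν) (h1 : ∫ x, Real.exp (α * x) ∂ν = 1)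
    (hρ : ∫ x, x * Real.exp (α * x) ∂ν = ρ) (hρ0 : 0 < ρ) (hδ : 0 < δ)
    (hsnl : ∀ y : ℝ, Y₀ ≤ |y| → ‖complexMGF id ν (α + y * Complex.I)‖ ≤ 1 - δ) :
    ∃ r > 0, r < α ∧ ∃ H : ℂ → ℂ, ∃ C : ℝ,
      DifferentiableOn ℂ H {s | s.re ∈ Icc (α - r) (α + r)} ∧
      (∀ s : ℂ, s.re ∈ Icc (α - r) (α + r) → ‖H s‖ ≤ C) ∧
      ∀ s : ℂ, s.re ∈ Icc (α - r) (α + r) → s ≠ α →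
        H s = (1 - complexMGF id ν s)⁻¹ - (ρ * (α - s))⁻¹ := by
  set m := complexMGF id ν with hm
  wlog hY : 0 < Y₀ generalizing Y₀
  · exact this (Y₀ := max Y₀ 1) (fun y hy => hsnl y ((le_max_left _ _).trans hy)) (by positivity)
  set S : Set ℂ := {s | s.re ∈ Ioo 0 γ} with hS
  have hSo : IsOpen S := isOpen_Ioo.preimage Complex.continuous_re
  have hmd : DifferentiableOn ℂ m S := differentiableOn_complexMGF.mono
    (fun s hs => Ioo_subset_interior_integrableExpSet hγ hs)
  have hαS : (α : ℂ) ∈ S := by simp [hS, hα, hαγ]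
  have hmα : m α = 1 := by
    rw [hm, complexMGF_ofReal, mgf]; simpa using h1
  set n := dslope m α with hn
  have hnd : DifferentiableOn ℂ n S :=
    (Complex.differentiableOn_dslope (hSo.mem_nhds hαS)).mpr hmd
  have hnα : n α = ρ := by
    rw [hn, dslope_same]
    have := (hasDerivAt_complexMGF (X := id) (μ := ν) (z := (α : ℂ))
      (Ioo_subset_interior_integrableExpSet hγ (by simpa using ⟨hα, hαγ⟩))).deriv
    rw [hm, this, ← hρ, ← integral_complex_ofReal]
    simp
  have hns : ∀ s, s ≠ (α : ℂ) → n s * (α - s) = 1 - m s := by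
    intro s hs
    have h2 : s - α ≠ 0 := sub_ne_zero.mpr hs
    rw [hn, dslope_of_ne _ hs, slope_def_field, hmα]
    field_simp
    ring
  have hr1 : ∃ ε > 0, ∀ σ, |σ - α| < ε → ∫ x, |Real.exp (σ * x) - Real.exp (α * x)| ∂ν < δ / 2 := by
    have h2 := (tendsto_integral_abs_exp_sub hγ ⟨hα, hαγ⟩).eventually (gt_mem_nhds (half_pos hδ))
    rw [Metric.eventually_nhds_iff] at h2
    obtain ⟨ε, hε, h⟩ := h2
    exact ⟨ε, hε, fun σ hσ => h (by rwa [Real.dist_eq])⟩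
  obtain ⟨ε₁, hε₁, hr1⟩ := hr1
  have hK : IsCompact (Icc α α ×ℂ Icc (-Y₀) Y₀) := isCompact_Icc.reProdIm isCompact_Icc
  have hO : IsOpen (S ∩ n ⁻¹' {0}ᶜ) := hnd.continuousOn.isOpen_inter_preimage hSo isOpen_compl_singleton
  have hKO : (Icc α α ×ℂ Icc (-Y₀) Y₀) ⊆ S ∩ n ⁻¹' {0}ᶜ := by
    intro s hs
    rw [Complex.mem_reProdIm] at hs
    have hsre : s.re = α := le_antisymm hs.1.2 hs.1.1
    refine ⟨by simp [hS, hsre, hα, hαγ], ?_⟩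
    simp only [mem_preimage, mem_compl_iff, mem_singleton_iff]
    by_cases hsα : s = α
    · rw [hsα, hnα]; exact_mod_cast hρ0.ne'
    · intro h0
      have := hns s hsα
      rw [h0, zero_mul] at this
      have him : s.im ≠ 0 := fun him => hsα (Complex.ext (by simpa using hsre) (by simpa using him))
      refine complexMGF_vertical_ne_one (integrable_exp_mul_of_mem_Icc hγ ⟨hα.le, hαγ.le⟩) h1 hδ
        hsnl him ?_
      have hs' : (α : ℂ) + s.im * Complex.I = s := by rw [← hsre]; exact Complex.re_add_im s
      rw [hs']
      exact (sub_eq_zero.mp this.symm).symm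
  obtain ⟨ε₂, hε₂, hthick⟩ := hK.exists_thickening_subset_open hO hKO
  obtain ⟨r, hr0, hr⟩ : ∃ r > 0, r < α ∧ r < γ - α ∧ r < ε₁ ∧ r < ε₂ := by
    refine ⟨min (min α (γ - α)) (min ε₁ ε₂) / 2, ?_, ?_⟩
    · have : 0 < γ - α := by linarith
      positivity
    · have hp : 0 < min (min α (γ - α)) (min ε₁ ε₂) := by
        have : 0 < γ - α := by linarith
        positivity
      have h2 : min (min α (γ - α)) (min ε₁ ε₂) ≤ α := (min_le_left _ _).trans (min_le_left _ _)
      have h3 : min (min α (γ - α)) (min ε₁ ε₂) ≤ γ - α := (min_le_left _ _).trans (min_le_right _ _)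
      have h4 : min (min α (γ - α)) (min ε₁ ε₂) ≤ ε₁ := (min_le_right _ _).trans (min_le_left _ _)
      have h5 : min (min α (γ - α)) (min ε₁ ε₂) ≤ ε₂ := (min_le_right _ _).trans (min_le_right _ _)
      refine ⟨by linarith, by linarith, by linarith, by linarith⟩
  obtain ⟨hrα, hrγ, hrε₁, hrε₂⟩ := hr
  set D : Set ℂ := {s | s.re ∈ Icc (α - r) (α + r)} with hD
  have hDS : D ⊆ S := fun s hs => ⟨by linarith [hs.1], by linarith [hs.2]⟩
  have hfar : ∀ s ∈ D, Y₀ ≤ |s.im| → ‖m s‖ ≤ 1 - δ / 2 := by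
    intro s hs him
    have h2 := norm_complexMGF_sub_le hγ (α := α) (σ := s.re) ⟨hα.le, hαγ.le⟩
      ⟨(hDS hs).1.le, (hDS hs).2.le⟩ s.im
    rw [Complex.re_add_im] at h2
    have h3 := hr1 s.re (by rw [abs_lt]; constructor <;> linarith [hs.1, hs.2])
    have h4 := hsnl s.im him
    have h5 := norm_sub_norm_le (complexMGF id ν s) (complexMGF id ν (α + s.im * Complex.I))
    rw [hm]
    linarith
  have hfar1 : ∀ s ∈ D, Y₀ ≤ |s.im| → δ / 2 ≤ ‖1 - m s‖ := by
    intro s hs him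
    have h2 := hfar s hs him
    have h3 := norm_sub_norm_le 1 (m s)
    rw [norm_one] at h3
    linarith
  have hne : ∀ s ∈ D, n s ≠ 0 := by
    intro s hs h0
    rcases le_total Y₀ |s.im| with him | him
    · have hsα : s ≠ α := by
        rintro rfl
        simp at him
        linarith
      have h2 := hns s hsα
      have h3 := hfar1 s hs him
      rw [← h2, h0] at h3
      simp at h3
      linarith
    · have hmem : s ∈ Metric.thickening ε₂ (Icc α α ×ℂ Icc (-Y₀) Y₀) := by
        rw [Metric.mem_thickening_iff]
        refine ⟨α + s.im * Complex.I, ?_, ?_⟩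
        · rw [Complex.mem_reProdIm]
          simpa using abs_le.mp him
        · have : s - (α + s.im * Complex.I) = ((s.re - α : ℝ) : ℂ) := by
            apply Complex.ext <;> simp
          rw [dist_eq_norm, this, Complex.norm_real, Real.norm_eq_abs, abs_lt]
          constructor <;> linarith [hs.1, hs.2]
      exact (hthick hmem).2 h0
  set N : ℂ → ℂ := fun s => (n s)⁻¹ - (ρ : ℂ)⁻¹ with hN
  have hNd : DifferentiableOn ℂ N D :=
    ((hnd.mono hDS).inv hne).sub (differentiableOn_const _)
  have hDnhds : D ∈ nhds (α : ℂ) := by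
    refine Complex.continuous_re.continuousAt.preimage_mem_nhds ?_
    exact Icc_mem_nhds (by simp [hr0]) (by simp [hr0])
  have hHd : DifferentiableOn ℂ (fun s => -dslope N α s) D :=
    ((Complex.differentiableOn_dslope hDnhds).mpr hNd).neg
  have hρc : (ρ : ℂ) ≠ 0 := by exact_mod_cast hρ0.ne'
  have hHeq : ∀ s ∈ D, s ≠ α → -dslope N α s = (1 - m s)⁻¹ - (ρ * (α - s))⁻¹ := by
    intro s hs hsα
    have h2 : (α : ℂ) - s ≠ 0 := sub_ne_zero.mpr (Ne.symm hsα)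
    have h4 : s - (α : ℂ) ≠ 0 := sub_ne_zero.mpr hsα
    have h3 := hne s hs
    rw [dslope_of_ne _ hsα, slope_def_field, ← hns s hsα, hN]
    simp only [hnα]
    rw [← neg_sub (α : ℂ) s, sub_self, sub_zero]
    field_simp
  obtain ⟨C, hC⟩ : ∃ C, ∀ s ∈ Icc (α - r) (α + r) ×ℂ Icc (-Y₀) Y₀, ‖-dslope N α s‖ ≤ C := by
    refine (isCompact_Icc.reProdIm isCompact_Icc).exists_bound_of_continuousOn
      (hHd.continuousOn.mono fun s hs => ?_)
    rw [Complex.mem_reProdIm] at hs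
    exact hs.1
  refine ⟨r, hr0, hrα, fun s => -dslope N α s, max C (2 / δ + (ρ * Y₀)⁻¹), hHd, ?_, hHeq⟩
  intro s hs
  beta_reduce
  rcases le_total Y₀ |s.im| with him | him
  · refine le_trans ?_ (le_max_right _ _)
    have hsα : s ≠ α := by
      rintro rfl
      simp at him
      linarith
    rw [hHeq s hs hsα]
    refine (norm_sub_le _ _).trans (add_le_add ?_ ?_)
    · rw [norm_inv, ← inv_div]
      exact inv_anti₀ (by positivity) (hfar1 s hs him)
    · rw [norm_inv, norm_mul, Complex.norm_real, Real.norm_eq_abs, abs_of_pos hρ0]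
      refine inv_anti₀ (by positivity) (mul_le_mul_of_nonneg_left ?_ hρ0.le)
      refine him.trans ?_
      have := Complex.abs_im_le_norm ((α : ℂ) - s)
      simpa using this
  · refine le_trans (hC s ?_) (le_max_left _ _)
    rw [Complex.mem_reProdIm]
    exact ⟨hs, abs_le.mp him⟩

/-- The law of the `n`-th step of the random walk on `ℝ` with increment law `ν` started at `0`. -/
def walkLaw (ν : Measure ℝ) : ℕ → Measure ℝ
  | 0 => Measure.dirac 0
  | n + 1 => Measure.conv ν (walkLaw ν n)

/-- The renewal measure of the random walk with increment law `ν`. -/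
def renewalMeasure (ν : Measure ℝ) : Measure ℝ := Measure.sum (walkLaw ν)

instance walkLaw.isProbabilityMeasure (ν : Measure ℝ) [IsProbabilityMeasure ν] (n : ℕ) :
    IsProbabilityMeasure (walkLaw ν n) := by
  induction n with
  | zero => unfold walkLaw; infer_instance
  | succ n ih => unfold walkLaw; infer_instance

instance renewalMeasure.sFinite (ν : Measure ℝ) [IsProbabilityMeasure ν] :
    SFinite (renewalMeasure ν) := by
  unfold renewalMeasure; infer_instance

lemma lintegral_renewalMeasure (ν : Measure ℝ) [IsProbabilityMeasure ν] {f : ℝ → ENNReal}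
    (hf : Measurable f) :
    ∫⁻ v, f v ∂renewalMeasure ν = f 0 + ∫⁻ x, ∫⁻ v, f (x + v) ∂renewalMeasure ν ∂ν := by
  simp only [renewalMeasure, lintegral_sum_measure]
  rw [tsum_eq_zero_add' ENNReal.summable]
  congr 1
  · simp [walkLaw, lintegral_dirac' _ hf]
  · rw [lintegral_tsum]
    · refine tsum_congr fun n => ?_
      rw [walkLaw, Measure.lintegral_conv hf]
    · intro n
      exact (Measurable.lintegral_prod_right' (f := fun p : ℝ × ℝ => f (p.1 + p.2))
        (by fun_prop)).aemeasurable

lemma lintegral_exp_walkLaw (ν : Measure ℝ) [IsProbabilityMeasure ν] {κ : ℝ}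
    (hκ : Integrable (fun x => Real.exp (κ * x)) ν) (n : ℕ) :
    ∫⁻ v, ENNReal.ofReal (Real.exp (κ * v)) ∂walkLaw ν n =
      ENNReal.ofReal (∫ x, Real.exp (κ * x) ∂ν) ^ n := by
  induction n with
  | zero => simp [walkLaw, lintegral_dirac]
  | succ n ih =>
    rw [walkLaw, Measure.lintegral_conv (by fun_prop), pow_succ']
    simp_rw [mul_add, Real.exp_add, ENNReal.ofReal_mul (Real.exp_nonneg _)]
    have : ∀ x : ℝ, ∫⁻ v, ENNReal.ofReal (Real.exp (κ * x)) * ENNReal.ofReal (Real.exp (κ * v))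
        ∂walkLaw ν n = ENNReal.ofReal (Real.exp (κ * x)) *
          ENNReal.ofReal (∫ x, Real.exp (κ * x) ∂ν) ^ n := by
      intro x
      rw [lintegral_const_mul _ (by fun_prop), ih]
    simp_rw [this]
    rw [lintegral_mul_const _ (by fun_prop),
      ofReal_integral_eq_lintegral_ofReal hκ (Eventually.of_forall fun x => Real.exp_nonneg _)]

lemma lintegral_exp_renewalMeasure (ν : Measure ℝ) [IsProbabilityMeasure ν] {κ : ℝ}
    (hκ : Integrable (fun x => Real.exp (κ * x)) ν) :
    ∫⁻ v, ENNReal.ofReal (Real.exp (κ * v)) ∂renewalMeasure ν =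
      (1 - ENNReal.ofReal (∫ x, Real.exp (κ * x) ∂ν))⁻¹ := by
  simp only [renewalMeasure, lintegral_sum_measure, lintegral_exp_walkLaw ν hκ]
  exact ENNReal.tsum_geometric _

lemma integrable_exp_renewalMeasure (ν : Measure ℝ) [IsProbabilityMeasure ν] {κ : ℝ}
    (hκ : Integrable (fun x => Real.exp (κ * x)) ν) (h1 : ∫ x, Real.exp (κ * x) ∂ν < 1) :
    Integrable (fun x => Real.exp (κ * x)) (renewalMeasure ν) := by
  refine ⟨by fun_prop, ?_⟩
  rw [hasFiniteIntegral_iff_ofReal (Eventually.of_forall fun x => Real.exp_nonneg _),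
    lintegral_exp_renewalMeasure ν hκ]
  simpa using h1

lemma integrable_cexp_of_re {M : Measure ℝ} {s : ℂ}
    (hs : Integrable (fun x => Real.exp (s.re * x)) M) :
    Integrable (fun x : ℝ => Complex.exp (s * x)) M := by
  refine hs.mono' (by fun_prop) (Eventually.of_forall fun x => ?_)
  rw [Complex.norm_exp]; simp

lemma integral_cexp_walkLaw (ν : Measure ℝ) [IsProbabilityMeasure ν] {s : ℂ}
    (hs : Integrable (fun x => Real.exp (s.re * x)) ν) (n : ℕ) :
    ∫ v : ℝ, Complex.exp (s * v) ∂walkLaw ν n = complexMGF id ν s ^ n := by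
  have hi : ∀ n, Integrable (fun x => Real.exp (s.re * x)) (walkLaw ν n) := fun n => by
    refine ⟨by fun_prop, ?_⟩
    rw [hasFiniteIntegral_iff_ofReal (Eventually.of_forall fun x => Real.exp_nonneg _),
      lintegral_exp_walkLaw ν hs]
    exact ENNReal.pow_lt_top ENNReal.ofReal_lt_top
  induction n with
  | zero => simp [walkLaw]
  | succ n ih =>
    have := integrable_cexp_of_re (hi (n + 1))
    rw [walkLaw] at this ⊢
    rw [integral_conv this, pow_succ']
    simp_rw [Complex.ofReal_add, mul_add, Complex.exp_add, integral_const_mul, ih,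
      integral_mul_const]
    rfl

lemma integral_cexp_renewalMeasure (ν : Measure ℝ) [IsProbabilityMeasure ν] {s : ℂ}
    (hs : Integrable (fun x => Real.exp (s.re * x)) ν)
    (h1 : ∫ x, Real.exp (s.re * x) ∂ν < 1) :
    ∫ v : ℝ, Complex.exp (s * v) ∂renewalMeasure ν = (1 - complexMGF id ν s)⁻¹ := by
  have hi := integrable_cexp_of_re (integrable_exp_renewalMeasure ν hs h1)
  rw [renewalMeasure] at hi ⊢
  rw [integral_sum_measure hi]
  simp_rw [integral_cexp_walkLaw ν hs]
  refine tsum_geometric_of_norm_lt_one (lt_of_le_of_lt ?_ h1)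
  exact norm_complexMGF_le_mgf

/-- The measure on `(0,∞)` with density `exp (-α v)`. -/
def expDecayMeasure (α : ℝ) : Measure ℝ :=
  (volume.restrict (Ioi 0)).withDensity fun v => ENNReal.ofReal (Real.exp (-α * v))

instance expDecayMeasure.sFinite (α : ℝ) : SFinite (expDecayMeasure α) := by
  unfold expDecayMeasure; infer_instance

lemma integral_expDecayMeasure {E : Type*} [NormedAddCommGroup E] [NormedSpace ℝ E]
    (α : ℝ) (g : ℝ → E) :
    ∫ v, g v ∂expDecayMeasure α = ∫ v in Ioi (0:ℝ), Real.exp (-α * v) • g v := by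
  rw [expDecayMeasure, integral_withDensity_eq_integral_toReal_smul (by fun_prop) (by simp)]
  simp_rw [ENNReal.toReal_ofReal (Real.exp_nonneg _)]

lemma integrable_exp_expDecayMeasure {α κ : ℝ} (h : κ < α) :
    Integrable (fun v => Real.exp (κ * v)) (expDecayMeasure α) := by
  rw [expDecayMeasure, integrable_withDensity_iff_integrable_smul₀' (by fun_prop) (by simp)]
  simp_rw [ENNReal.toReal_ofReal (Real.exp_nonneg _), smul_eq_mul, ← Real.exp_add]
  have := integrableOn_exp_mul_Ioi (a := κ - α) (by linarith) 0
  refine this.congr (Eventually.of_forall fun v => ?_)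
  ring_nf

lemma integral_cexp_expDecayMeasure {α : ℝ} {s : ℂ} (h : s.re < α) :
    ∫ v : ℝ, Complex.exp (s * v) ∂expDecayMeasure α = (α - s)⁻¹ := by
  rw [integral_expDecayMeasure]
  have h0 : (s - α : ℂ).re < 0 := by simp; linarith
  have := integral_exp_mul_complex_Ioi h0 0
  have h1 : ∀ v : ℝ, Real.exp (-α * v) • Complex.exp (s * v) = Complex.exp ((s - α) * v) := by
    intro v
    rw [Complex.real_smul, Complex.ofReal_exp, ← Complex.exp_add]
    push_cast; ring_nf
  simp_rw [h1, this]
  simp only [Complex.ofReal_zero, mul_zero, Complex.exp_zero]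
  rw [← neg_sub, neg_div_neg_eq, one_div]

lemma integral_one_sub_exp_expDecayMeasure {α y : ℝ} (hα : 0 < α) (hy : 0 ≤ y) :
    ∫ v, max (1 - Real.exp (y - v)) 0 ∂expDecayMeasure α =
      Real.exp (-α * y) / (α * (α + 1)) := by
  rw [integral_expDecayMeasure]
  have h1 : ∫ v in Ioi (0:ℝ), Real.exp (-α * v) • max (1 - Real.exp (y - v)) 0 =
      ∫ v in Ioi y, (Real.exp (-α * v) - Real.exp y * Real.exp ((-α - 1) * v)) := by
    rw [← integral_indicator measurableSet_Ioi, ← integral_indicator measurableSet_Ioi]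
    congr 1
    ext v
    by_cases hv : v ∈ Ioi y
    · have hv0 : v ∈ Ioi (0:ℝ) := lt_of_le_of_lt hy hv
      rw [indicator_of_mem hv, indicator_of_mem hv0, max_eq_left, smul_eq_mul, mul_sub, mul_one,
        ← Real.exp_add, ← Real.exp_add]
      · ring_nf
      · have : Real.exp (y - v) ≤ 1 := Real.exp_le_one_iff.2 (by simp at hv; linarith)
        linarith
    · rw [indicator_of_notMem hv]
      have hv' : max (1 - Real.exp (y - v)) 0 = 0 := by
        apply max_eq_right
        have : 1 ≤ Real.exp (y - v) := Real.one_le_exp (by simp at hv; linarith)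
        linarith
      simp [indicator, hv']
  rw [h1, integral_sub, integral_const_mul, integral_exp_mul_Ioi (by linarith),
    integral_exp_mul_Ioi (by linarith)]
  · have : Real.exp y * (-Real.exp ((-α - 1) * y) / (-α - 1)) =
      Real.exp (-α * y) / (α + 1) := by
      have : Real.exp (-α * y) = Real.exp y * Real.exp ((-α - 1) * y) := by
        rw [← Real.exp_add]; ring_nf
      rw [this]
      have h3 : -α - 1 ≠ 0 := by linarith
      have h4 : α + 1 ≠ 0 := by linarith
      field_simp
      ring
    rw [this]
    have h4 : α + 1 ≠ 0 := by linarith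
    field_simp
    ring
  · exact integrableOn_exp_mul_Ioi (by linarith) _
  · exact (integrableOn_exp_mul_Ioi (by linarith) _).const_mul _

lemma continuous_vertical_of_differentiableOn {F : ℂ → ℂ} {a b c : ℝ} (hc : c ∈ Icc a b)
    (hF : DifferentiableOn ℂ F {s | s.re ∈ Icc a b}) :
    Continuous fun τ : ℝ => F (c + τ * Complex.I) := by
  have := hF.continuousOn
  exact this.comp_continuous (by fun_prop) (by intro τ; simpa using hc)

lemma integrable_of_continuous_of_le_inv_one_add_sq {f : ℝ → ℂ} (hf : Continuous f) {C : ℝ}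
    (h : ∀ τ, ‖f τ‖ ≤ C * (1 + τ ^ 2)⁻¹) : Integrable f :=
  (integrable_inv_one_add_sq.const_mul C).mono' hf.aestronglyMeasurable (Eventually.of_forall h)

lemma norm_integral_le_of_le_inv_one_add_sq {f : ℝ → ℂ} {C : ℝ}
    (h : ∀ τ, ‖f τ‖ ≤ C * (1 + τ ^ 2)⁻¹) : ‖∫ τ, f τ‖ ≤ C * Real.pi := by
  refine (norm_integral_le_of_norm_le (integrable_inv_one_add_sq.const_mul C)
    (Eventually.of_forall h)).trans ?_
  rw [integral_const_mul, integral_univ_inv_one_add_sq]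

/-- Asymptotics, with exponential rate, of the smoothed tail of the renewal measure. -/
lemma exists_abs_smoothed_renewal_sub_le {ν : Measure ℝ} [IsProbabilityMeasure ν] {α γ δ Y₀ ρ : ℝ}
    (hα : 0 < α) (hαγ : α < γ) (hγ : Integrable (fun x => Real.exp (γ * x)) ν)
    (h1 : ∫ x, Real.exp (α * x) ∂ν = 1) (hρ : ∫ x, x * Real.exp (α * x) ∂ν = ρ) (hρ0 : 0 < ρ)
    (hlt : ∀ κ ∈ Ioo 0 α, ∫ x, Real.exp (κ * x) ∂ν < 1)
    (hδ : 0 < δ)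
    (hsnl : ∀ y : ℝ, Y₀ ≤ |y| → ‖complexMGF id ν (α + y * Complex.I)‖ ≤ 1 - δ) :
    ∃ r > 0, r < α ∧ ∃ C, ∀ y ≥ 0,
      |∫ v, max (1 - Real.exp (y - v)) 0 ∂renewalMeasure ν -
        ρ⁻¹ * (Real.exp (-α * y) / (α * (α + 1)))| ≤ C * Real.exp (-(α + r) * y) := by
  obtain ⟨r, hr, hrα, H, C, hHd, hHb, hHeq⟩ :=
    exists_bounded_extension_inv_one_sub_complexMGF hα hαγ hγ h1 hρ hρ0 hδ hsnl
  have hC0 : 0 ≤ C := (norm_nonneg _).trans (hHb α (by simp; linarith))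
  set κ := α - r with hκdef
  have hκ : 0 < κ := by linarith
  set m := (min (κ ^ 2) 1)⁻¹ with hm
  have hm0 : 0 < m := by rw [hm]; positivity
  have hker : ∀ s : ℂ, κ ≤ s.re → ‖(s * (s + 1))⁻¹‖ ≤ m * (1 + s.im ^ 2)⁻¹ := by
    intro s hs
    refine (norm_inv_mul_add_one_le hκ hs).trans ?_
    rw [mul_inv]
  have hne : ∀ s : ℂ, κ ≤ s.re → s * (s + 1) ≠ 0 := by
    intro s hs h
    rcases mul_eq_zero.1 h with h | h
    · rw [h] at hs; simp at hs; linarith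
    · have := congrArg Complex.re h
      simp at this; linarith
  refine ⟨r, hr, hrα, (1 / (2 * Real.pi)) * (m * C * Real.pi), fun y hy => ?_⟩
  set F : ℂ → ℂ := fun s => Complex.exp (-s * y) * (s * (s + 1))⁻¹ * H s with hFdef
  have hFd : DifferentiableOn ℂ F {s | s.re ∈ Icc κ (α + r)} := by
    refine DifferentiableOn.mul (DifferentiableOn.mul ?_ ?_) hHd
    · fun_prop
    · exact DifferentiableOn.inv (by fun_prop) fun s hs => hne s hs.1
  have hexp : ∀ s : ℂ, ‖Complex.exp (-s * y)‖ = Real.exp (-s.re * y) := by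
    intro s; rw [Complex.norm_exp]; simp
  have hFb' : ∀ s : ℂ, s.re ∈ Icc κ (α + r) →
      ‖F s‖ ≤ (m * C * Real.exp (-s.re * y)) * (1 + s.im ^ 2)⁻¹ := by
    intro s hs
    rw [hFdef]; simp only [norm_mul, hexp]
    have := mul_le_mul (hker s hs.1) (hHb s hs) (norm_nonneg _) (by positivity)
    calc _ = Real.exp (-s.re * y) * (‖(s * (s + 1))⁻¹‖ * ‖H s‖) := by ring
      _ ≤ Real.exp (-s.re * y) * (m * (1 + s.im ^ 2)⁻¹ * C) := by gcongr
      _ = _ := by ring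
  have hFb : ∀ s : ℂ, s.re ∈ Icc κ (α + r) → ‖F s‖ ≤ (m * C) * (1 + s.im ^ 2)⁻¹ := by
    intro s hs
    refine (hFb' s hs).trans ?_
    have : Real.exp (-s.re * y) ≤ 1 := Real.exp_le_one_iff.2 (by
      have : 0 ≤ s.re := hκ.le.trans hs.1
      nlinarith)
    have h2 : m * C * Real.exp (-s.re * y) ≤ m * C :=
      mul_le_of_le_one_right (by positivity) this
    gcongr
  have hshift := integral_vertical_eq_of_differentiableOn_strip (by linarith) hFd hFb
  have hκint : Integrable (fun x => Real.exp (κ * x)) ν := by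
    exact _root_.integrable_exp_mul_of_mem_Icc hγ ⟨hκ.le, by linarith⟩
  have hκlt : ∫ x, Real.exp (κ * x) ∂ν < 1 := hlt κ ⟨hκ, by linarith⟩
  have hre : ∀ τ : ℝ, ((κ : ℂ) + τ * Complex.I).re = κ := by intro τ; simp
  have hU := integral_one_sub_exp_pos_part_eq (renewalMeasure ν) hκ
    (integrable_exp_renewalMeasure ν hκint hκlt) y
  have hM := integral_one_sub_exp_pos_part_eq (expDecayMeasure α) hκ
    (integrable_exp_expDecayMeasure (by linarith)) y
  have hUmgf : ∀ τ : ℝ, ∫ v : ℝ, Complex.exp (((κ:ℂ) + τ * Complex.I) * v) ∂renewalMeasure ν =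
      H (κ + τ * Complex.I) + ρ⁻¹ * ∫ v : ℝ, Complex.exp (((κ:ℂ) + τ * Complex.I) * v)
        ∂expDecayMeasure α := by
    intro τ
    rw [integral_cexp_renewalMeasure ν (by rwa [hre]) (by rwa [hre]),
      integral_cexp_expDecayMeasure (by rw [hre]; linarith), hHeq]
    · rw [mul_inv, Complex.ofReal_inv]; ring
    · rw [hre]; constructor <;> linarith
    · intro h
      have := congrArg Complex.re h
      simp at this; linarith
  have hMc : Integrable fun τ : ℝ => Complex.exp (-((κ:ℂ) + τ * Complex.I) * y) *
      (((κ:ℂ) + τ * Complex.I) * ((κ:ℂ) + τ * Complex.I + 1))⁻¹ *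
      ∫ v : ℝ, Complex.exp (((κ:ℂ) + τ * Complex.I) * v) ∂expDecayMeasure α := by
    have e : ∀ τ : ℝ, ∫ v : ℝ, Complex.exp (((κ:ℂ) + τ * Complex.I) * v) ∂expDecayMeasure α =
        (α - ((κ:ℂ) + τ * Complex.I))⁻¹ := fun τ =>
      integral_cexp_expDecayMeasure (by rw [hre]; linarith)
    simp_rw [e]
    have hre2 : ∀ τ : ℝ, ((α:ℂ) - ((κ:ℂ) + τ * Complex.I)).re = r := by
      intro τ; simp; linarith
    refine integrable_of_continuous_of_le_inv_one_add_sq (C := m * r⁻¹) ?_ ?_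
    · refine Continuous.mul (Continuous.mul (by fun_prop) ?_) ?_
      · exact Continuous.inv₀ (by fun_prop) fun τ => hne _ (hre τ).ge
      · refine Continuous.inv₀ (by fun_prop) fun τ h => ?_
        have := hre2 τ
        rw [h] at this; simp at this; linarith
    · intro τ
      rw [norm_mul, norm_mul, hexp, hre]
      have a1 : Real.exp (-κ * y) ≤ 1 := Real.exp_le_one_iff.2 (by nlinarith)
      have a2 := hker (κ + τ * Complex.I) (hre τ).ge
      have a3 : ‖((α:ℂ) - ((κ:ℂ) + τ * Complex.I))⁻¹‖ ≤ r⁻¹ := by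
        rw [norm_inv]
        gcongr
        calc r = |((α:ℂ) - ((κ:ℂ) + τ * Complex.I)).re| := by rw [hre2, abs_of_pos hr]
          _ ≤ _ := Complex.abs_re_le_norm _
      have him : ((κ : ℂ) + τ * Complex.I).im = τ := by simp
      rw [him] at a2
      calc _ ≤ 1 * (m * (1 + τ ^ 2)⁻¹) * r⁻¹ := by gcongr
        _ = _ := by ring
  have hFint : Integrable fun τ : ℝ => F (κ + τ * Complex.I) := by
    refine integrable_of_continuous_of_le_inv_one_add_sq (C := m * C)
      (continuous_vertical_of_differentiableOn ⟨le_rfl, by linarith⟩ hFd) fun τ => ?_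
    have := hFb (κ + τ * Complex.I) (by rw [hre]; constructor <;> linarith)
    simpa using this
  have key : ((∫ v, max (1 - Real.exp (y - v)) 0 ∂renewalMeasure ν : ℝ) : ℂ) -
      ρ⁻¹ * ((∫ v, max (1 - Real.exp (y - v)) 0 ∂expDecayMeasure α : ℝ) : ℂ) =
      (1 / (2 * Real.pi) : ℝ) * ∫ τ : ℝ, F ((α + r : ℝ) + τ * Complex.I) := by
    rw [hU, hM, ← hshift]
    have : ∀ τ : ℝ, Complex.exp (-((κ:ℂ) + τ * Complex.I) * y) *
      (((κ:ℂ) + τ * Complex.I) * ((κ:ℂ) + τ * Complex.I + 1))⁻¹ *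
      ∫ v : ℝ, Complex.exp (((κ:ℂ) + τ * Complex.I) * v) ∂renewalMeasure ν =
      F (κ + τ * Complex.I) + ρ⁻¹ * (Complex.exp (-((κ:ℂ) + τ * Complex.I) * y) *
      (((κ:ℂ) + τ * Complex.I) * ((κ:ℂ) + τ * Complex.I + 1))⁻¹ *
      ∫ v : ℝ, Complex.exp (((κ:ℂ) + τ * Complex.I) * v) ∂expDecayMeasure α) := by
      intro τ
      rw [hUmgf, hFdef]
      ring
    simp_rw [this]
    rw [integral_add hFint (hMc.const_mul _), integral_const_mul]
    ring
  rw [integral_one_sub_exp_expDecayMeasure hα hy] at key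
  have hn := congrArg norm key
  rw [← Complex.ofReal_mul, ← Complex.ofReal_sub, Complex.norm_real,
    Real.norm_eq_abs] at hn
  rw [hn, norm_mul, Complex.norm_real, Real.norm_eq_abs, abs_of_pos (by positivity)]
  have hlast : ‖∫ τ : ℝ, F ((α + r : ℝ) + τ * Complex.I)‖ ≤
      (m * C * Real.exp (-(α + r) * y)) * Real.pi := by
    refine norm_integral_le_of_le_inv_one_add_sq fun τ => ?_
    have := hFb' ((α + r : ℝ) + τ * Complex.I) (by simp; linarith)
    simpa using this
  calc _ ≤ 1 / (2 * Real.pi) * ((m * C * Real.exp (-(α + r) * y)) * Real.pi) := by gcongr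
    _ = _ := by ring

lemma measure_Ioi_le_of_integrable_exp {M : Measure ℝ} {κ : ℝ} (hκ : 0 < κ)
    (h : Integrable (fun v => Real.exp (κ * v)) M) (y : ℝ) :
    M (Ioi y) < ⊤ ∧ M.real (Ioi y) ≤ (∫ v, Real.exp (κ * v) ∂M) * Real.exp (-κ * y) := by
  have hsub : Ioi y ⊆ {v | Real.exp (κ * y) ≤ Real.exp (κ * v)} := by
    intro v hv
    have : y < v := hv
    simp only [mem_ofPred_eq, Real.exp_le_exp]
    nlinarith
  have hm := mul_meas_ge_le_integral_of_nonneg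
    (Eventually.of_forall fun v => Real.exp_nonneg (κ * v)) h (Real.exp (κ * y))
  have hfin : M {v | Real.exp (κ * y) ≤ Real.exp (κ * v)} < ⊤ :=
    h.measure_ge_lt_top (Real.exp_pos _)
  refine ⟨(measure_mono hsub).trans_lt hfin, ?_⟩
  have h2 : M.real (Ioi y) ≤ M.real {v | Real.exp (κ * y) ≤ Real.exp (κ * v)} :=
    measureReal_mono hsub hfin.ne
  have h3 : Real.exp (κ * y) * Real.exp (-κ * y) = 1 := by
    rw [← Real.exp_add]; simp
  have h4 := Real.exp_pos (-κ * y)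
  calc M.real (Ioi y) ≤ M.real {v | Real.exp (κ * y) ≤ Real.exp (κ * v)} := h2
    _ = (Real.exp (κ * y) * M.real {v | Real.exp (κ * y) ≤ Real.exp (κ * v)}) *
        Real.exp (-κ * y) := by rw [mul_right_comm, h3, one_mul]
    _ ≤ _ := by gcongr

lemma integrable_one_sub_exp_pos_part {M : Measure ℝ} {y : ℝ} (h : M (Ioi y) < ⊤) :
    Integrable (fun v => max (1 - Real.exp (y - v)) 0) M := by
  have : Integrable ((Ioi y).indicator fun _ => (1:ℝ)) M :=
    (integrable_indicator_iff measurableSet_Ioi).2 (integrableOn_const h.ne)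
  refine this.mono' (by fun_prop) (Eventually.of_forall fun v => ?_)
  rw [Real.norm_eq_abs, abs_of_nonneg (le_max_right _ _)]
  by_cases hv : v ∈ Ioi y
  · rw [indicator_of_mem hv]
    exact max_le (by linarith [Real.exp_pos (y - v)]) zero_le_one
  · rw [indicator_of_notMem hv]
    have : 1 ≤ Real.exp (y - v) := Real.one_le_exp (by simp at hv; linarith)
    exact max_le (by linarith) le_rfl

lemma tail_mul_le_smoothed_difference {M : Measure ℝ} {y z : ℝ} (hyz : y ≤ z)
    (h : M (Ioi y) < ⊤) :
    (Real.exp (-y) - Real.exp (-z)) * M.real (Ioi z) ≤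
      Real.exp (-y) * (∫ v, max (1 - Real.exp (y - v)) 0 ∂M) -
        Real.exp (-z) * (∫ v, max (1 - Real.exp (z - v)) 0 ∂M) ∧
    Real.exp (-y) * (∫ v, max (1 - Real.exp (y - v)) 0 ∂M) -
        Real.exp (-z) * (∫ v, max (1 - Real.exp (z - v)) 0 ∂M) ≤
      (Real.exp (-y) - Real.exp (-z)) * M.real (Ioi y) := by
  have hz : M (Ioi z) < ⊤ := (measure_mono (Ioi_subset_Ioi hyz)).trans_lt h
  have e : ∀ y v : ℝ, Real.exp (-y) * max (1 - Real.exp (y - v)) 0 =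
      max (Real.exp (-y) - Real.exp (-v)) 0 := by
    intro y v
    rw [mul_max_of_nonneg _ _ (Real.exp_nonneg _), mul_sub, ← Real.exp_add]
    ring_nf
  have hle : ∀ {a b : ℝ}, a ≤ b → Real.exp (-b) ≤ Real.exp (-a) := fun h =>
    Real.exp_le_exp.2 (by linarith)
  have hi : ∀ y, M (Ioi y) < ⊤ → Integrable ((Ioi y).indicator fun _ => (1:ℝ)) M := fun y h =>
    (integrable_indicator_iff measurableSet_Ioi).2 (integrableOn_const h.ne)
  have hI : ∀ y : ℝ, ∫ v, (Ioi y).indicator (fun _ => (1:ℝ)) v ∂M = M.real (Ioi y) := by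
    intro y; exact integral_indicator_one measurableSet_Ioi
  rw [← hI, ← hI, ← integral_const_mul, ← integral_const_mul, ← integral_const_mul,
    ← integral_const_mul, ← integral_sub ((integrable_one_sub_exp_pos_part h).const_mul _)
      ((integrable_one_sub_exp_pos_part hz).const_mul _)]
  have hint := ((integrable_one_sub_exp_pos_part h).const_mul (Real.exp (-y))).sub
      ((integrable_one_sub_exp_pos_part hz).const_mul (Real.exp (-z)))
  constructor
  · refine integral_mono ((hi z hz).const_mul _) hint fun v => ?_
    simp only [e, indicator, mem_Ioi]
    split_ifs with hv
    · have h1 := hle hv.le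
      have h2 := hle hyz
      rw [max_eq_left (by linarith), max_eq_left (by linarith)]; linarith
    · have := hle hyz
      have : max (Real.exp (-z) - Real.exp (-v)) 0 ≤ max (Real.exp (-y) - Real.exp (-v)) 0 := by
        gcongr
      linarith
  · refine integral_mono hint ((hi y h).const_mul _) fun v => ?_
    simp only [e, indicator, mem_Ioi]
    have h2 := hle hyz
    split_ifs with hv
    · have h1 := hle hv.le
      rw [max_eq_left (by linarith : 0 ≤ Real.exp (-y) - Real.exp (-v))]
      linarith [le_max_left (Real.exp (-z) - Real.exp (-v)) 0]
    · have h1 := hle (not_lt.1 hv)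
      have h3 := hle ((not_lt.1 hv).trans hyz)
      rw [max_eq_right (by linarith), max_eq_right (by linarith)]; simp

lemma abs_one_sub_exp_neg_sub_le {x : ℝ} (hx : 0 ≤ x) :
    |1 - Real.exp (-x) - x| ≤ x ^ 2 / 2 := by
  have h1 : 1 - x ≤ Real.exp (-x) := by linarith [Real.add_one_le_exp (-x)]
  have h2 := Real.quadratic_le_exp_of_nonneg hx
  have h3 : Real.exp (-x) ≤ 1 - x + x ^ 2 / 2 := by
    rw [Real.exp_neg]
    rw [inv_le_comm₀ (Real.exp_pos _) (by nlinarith [sq_nonneg (x - 1)])]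
    refine le_trans ?_ h2
    rw [inv_le_iff_one_le_mul₀ (by nlinarith [sq_nonneg (x - 1)])]
    nlinarith [sq_nonneg (x ^ 2)]
  rw [abs_le]; constructor <;> linarith

set_option maxHeartbeats 1000000 in
/-- The elementary Tauberian step: a rate for the smoothed tail gives a rate for the tail. -/
lemma exists_abs_tail_sub_le_of_smoothed {M : Measure ℝ} {α r c C : ℝ} (hα : 0 < α)
    (hr : 0 < r) (hc : 0 ≤ c) (hfin : ∀ y, M (Ioi y) < ⊤)
    (h : ∀ y ≥ 0, |∫ v, max (1 - Real.exp (y - v)) 0 ∂M - c * Real.exp (-α * y)| ≤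
      C * Real.exp (-(α + r) * y)) :
    ∃ C', ∀ y ≥ 0, |Real.exp (α * y) * M.real (Ioi y) - c * (α + 1)| ≤
      C' * Real.exp (-(r / 2) * y) := by
  have hC : 0 ≤ C := by
    have := (abs_nonneg _).trans (h 0 le_rfl)
    simpa using this
  -- the two sided bound on differences
  have hdiff : ∀ y ≥ 0, ∀ η ∈ Ioc (0:ℝ) 1,
      |(Real.exp (-y) * (∫ v, max (1 - Real.exp (y - v)) 0 ∂M) -
        Real.exp (-(y + η)) * (∫ v, max (1 - Real.exp (y + η - v)) 0 ∂M)) -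
        c * (α + 1) * (Real.exp (-α * y) * (Real.exp (-y) * (1 - Real.exp (-η))))| ≤
        Real.exp (-α * y) * (Real.exp (-y) * (1 - Real.exp (-η))) *
          (c * ((α + 1) ^ 2 + (α + 1)) * η + 4 * C * Real.exp (-r * y) * η⁻¹) := by
    intro y hy η hη
    have e1 : 1 - Real.exp (-η) ≥ η / 2 := by
      have := (abs_le.1 (abs_one_sub_exp_neg_sub_le hη.1.le)).1
      nlinarith [hη.1, hη.2]
    have h1 := h y hy
    have h2 := h (y + η) (by linarith [hη.1])
    set D₁ := ∫ v, max (1 - Real.exp (y - v)) 0 ∂M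
    set D₂ := ∫ v, max (1 - Real.exp (y + η - v)) 0 ∂M
    have hη1 := abs_le.1 (abs_one_sub_exp_neg_sub_le hη.1.le)
    have hη2 := abs_le.1 (abs_one_sub_exp_neg_sub_le (x := (α + 1) * η)
      (by have := hη.1; positivity))
    set P := Real.exp (-y) with hP
    set Q := Real.exp (-α * y) with hQ
    have hP0 : 0 < P := Real.exp_pos _
    have hQ0 : 0 < Q := Real.exp_pos _
    set E := Real.exp (-r * y) with hE
    have hE0 : 0 < E := Real.exp_pos _
    set u := Real.exp (-η) with hu
    have hu0 : 0 < u := Real.exp_pos _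
    have hu1 : u ≤ 1 := by linarith [hη.1]
    have a1 : Real.exp (-(α + r) * y) = Q * E := by rw [hQ, hE, ← Real.exp_add]; ring_nf
    have a2 : Real.exp (-(y + η)) = P * u := by rw [hP, hu, ← Real.exp_add]; ring_nf
    have a3 : u * Real.exp (-α * (y + η)) = Q * Real.exp (-((α + 1) * η)) := by
      rw [hQ, hu, ← Real.exp_add, ← Real.exp_add]; ring_nf
    have a4 : Real.exp (-(α + r) * (y + η)) ≤ Q * E := by
      rw [← a1]; apply Real.exp_le_exp.2; nlinarith [hη.1]
    rw [a1] at h1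
    replace h2 := h2.trans (mul_le_mul_of_nonneg_left a4 hC)
    rw [a2]
    set w := Real.exp (-((α + 1) * η))
    have b1 : |w - 1 + (α + 1) * (1 - u)| ≤ ((α + 1) ^ 2 + (α + 1)) * η ^ 2 / 2 := by
      rw [abs_le]; constructor <;> nlinarith
    have b2 : |P * D₁ - P * u * D₂ - c * (α + 1) * (Q * (P * (1 - u)))| ≤
        P * Q * (2 * C * E + c * (((α + 1) ^ 2 + (α + 1)) * η ^ 2 / 2)) := by
      have : P * D₁ - P * u * D₂ - c * (α + 1) * (Q * (P * (1 - u))) =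
        P * (D₁ - c * Q) - P * u * (D₂ - c * Real.exp (-α * (y + η))) -
          P * Q * c * (w - 1 + (α + 1) * (1 - u)) := by
        have : P * u * (c * Real.exp (-α * (y + η))) = P * c * (Q * w) := by rw [← a3]; ring
        linear_combination -this
      rw [this]
      refine (abs_sub _ _).trans ((add_le_add_left (abs_sub _ _) _).trans ?_)
      rw [abs_mul, abs_mul, abs_mul (P * Q * c), abs_of_pos hP0, abs_of_pos (mul_pos hP0 hu0),
        abs_of_nonneg (by positivity : 0 ≤ P * Q * c)]
      have c1 : P * u ≤ P := mul_le_of_le_one_right hP0.le hu1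
      calc _ ≤ P * (C * (Q * E)) + P * (C * (Q * E)) +
            P * Q * c * (((α + 1) ^ 2 + (α + 1)) * η ^ 2 / 2) := by gcongr
        _ = _ := by ring
    refine b2.trans ?_
    have hη0 := hη.1
    have e2 : 1 ≤ 2 * (1 - u) * η⁻¹ := by
      rw [← div_eq_mul_inv, le_div_iff₀ hη0]; linarith
    have e3 : η ^ 2 / 2 ≤ (1 - u) * η := by nlinarith
    have e4 : E ≤ 2 * E * (1 - u) * η⁻¹ := by nlinarith
    calc _ ≤ P * Q * (2 * C * (2 * E * (1 - u) * η⁻¹) +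
          c * (((α + 1) ^ 2 + (α + 1)) * ((1 - u) * η))) := by
            have : ((α + 1) ^ 2 + (α + 1)) * η ^ 2 / 2 ≤
              ((α + 1) ^ 2 + (α + 1)) * ((1 - u) * η) := by
                rw [mul_div_assoc]; gcongr
            gcongr
      _ = _ := by ring
  set K := c * ((α + 1) ^ 2 + (α + 1)) + 4 * C with hK
  have hK0 : 0 ≤ K := by positivity
  set b := c * (α + 1)
  have hb : 0 ≤ b := by positivity
  -- lower bound
  have hlow : ∀ y ≥ 0, b - K * Real.exp (-(r / 2) * y) ≤ Real.exp (α * y) * M.real (Ioi y) := by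
    intro y hy
    set η := Real.exp (-(r / 2) * y) with hη
    have hη0 : 0 < η := Real.exp_pos _
    have hη1 : η ≤ 1 := Real.exp_le_one_iff.2 (by nlinarith)
    have e1 : 0 < 1 - Real.exp (-η) := by
      have : Real.exp (-η) < 1 := Real.exp_lt_one_iff.2 (by linarith)
      linarith
    have h1 := (abs_le.1 (hdiff y hy η ⟨hη0, hη1⟩)).1
    have h2 := (tail_mul_le_smoothed_difference (by linarith : y ≤ y + η) (hfin y)).2
    have e2 : Real.exp (-r * y) * η⁻¹ = η := by
      rw [hη, ← Real.exp_neg, ← Real.exp_add]; ring_nf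
    have e3 : Real.exp (-y) - Real.exp (-(y + η)) = Real.exp (-y) * (1 - Real.exp (-η)) := by
      rw [mul_sub, ← Real.exp_add]; ring_nf
    have e4 : Real.exp (α * y) * Real.exp (-α * y) = 1 := by rw [← Real.exp_add]; simp
    rw [e3] at h2
    rw [mul_assoc (4 * C), e2] at h1
    set V := Real.exp (-y) * (1 - Real.exp (-η))
    have hV : 0 < V := by positivity
    have h3 : V * (Real.exp (-α * y) * (b - K * η)) ≤ V * M.real (Ioi y) := by
      refine le_trans ?_ h2
      linarith
    have h4 := le_of_mul_le_mul_left h3 hV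
    calc b - K * η = Real.exp (α * y) * (Real.exp (-α * y) * (b - K * η)) := by
          rw [← mul_assoc, e4, one_mul]
      _ ≤ _ := by gcongr
  have hupp : ∀ y ≥ 1, Real.exp (α * y) * M.real (Ioi y) ≤
      b + Real.exp α * (b * α + K * Real.exp r) * Real.exp (-(r / 2) * y) := by
    intro y hy
    set η := Real.exp (-(r / 2) * y) with hη
    have hη0 : 0 < η := Real.exp_pos _
    have hη1 : η ≤ 1 := Real.exp_le_one_iff.2 (by nlinarith)
    have e1 : 0 < 1 - Real.exp (-η) := by
      have : Real.exp (-η) < 1 := Real.exp_lt_one_iff.2 (by linarith)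
      linarith
    have h1 := (abs_le.1 (hdiff (y - η) (by linarith) η ⟨hη0, hη1⟩)).2
    have h2 := (tail_mul_le_smoothed_difference (by linarith : y - η ≤ y) (hfin _)).1
    rw [sub_add_cancel] at h1
    have e2 : Real.exp (-r * (y - η)) * η⁻¹ ≤ Real.exp r * η := by
      rw [hη, ← Real.exp_neg, ← Real.exp_add, ← Real.exp_add, ← hη]
      apply Real.exp_le_exp.2; nlinarith
    have er : 1 ≤ Real.exp r := Real.one_le_exp hr.le
    have e3 : Real.exp (-(y - η)) - Real.exp (-y) =
        Real.exp (-(y - η)) * (1 - Real.exp (-η)) := by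
      rw [mul_sub, ← Real.exp_add]; ring_nf
    have e4 : Real.exp (α * y) * Real.exp (-α * (y - η)) = Real.exp (α * η) := by
      rw [← Real.exp_add]; ring_nf
    have e5 : c * ((α + 1) ^ 2 + (α + 1)) * η + 4 * C * Real.exp (-r * (y - η)) * η⁻¹ ≤
        K * Real.exp r * η := by
      rw [hK, mul_assoc (4 * C)]
      calc _ ≤ c * ((α + 1) ^ 2 + (α + 1)) * (Real.exp r * η) + 4 * C * (Real.exp r * η) := by
            gcongr
            exact le_mul_of_one_le_left hη0.le er
        _ = _ := by ring
    rw [e3] at h2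
    set V := Real.exp (-(y - η)) * (1 - Real.exp (-η))
    have hV : 0 < V := by positivity
    have h3 : V * M.real (Ioi y) ≤ V * (Real.exp (-α * (y - η)) * (b + K * Real.exp r * η)) := by
      refine h2.trans ?_
      have : Real.exp (-α * (y - η)) * V * (c * ((α + 1) ^ 2 + (α + 1)) * η +
          4 * C * Real.exp (-r * (y - η)) * η⁻¹) ≤ Real.exp (-α * (y - η)) * V *
          (K * Real.exp r * η) := by gcongr
      linarith
    have h4 := le_of_mul_le_mul_left h3 hV
    have e6 : Real.exp (α * η) ≤ Real.exp α :=
      Real.exp_le_exp.2 (mul_le_of_le_one_right hα.le hη1)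
    have e7 : Real.exp (α * η) - 1 ≤ Real.exp α * (α * η) := by
      have h5 : 1 - α * η ≤ Real.exp (-(α * η)) := by
        linarith [Real.add_one_le_exp (-(α * η))]
      have h6 : Real.exp (α * η) * Real.exp (-(α * η)) = 1 := by rw [← Real.exp_add]; simp
      have h7 : Real.exp (α * η) * (1 - α * η) ≤ 1 := by
        exact (mul_le_mul_of_nonneg_left h5 (Real.exp_nonneg _)).trans_eq h6
      have h8 : Real.exp (α * η) * (α * η) ≤ Real.exp α * (α * η) := by gcongr
      linarith
    calc Real.exp (α * y) * M.real (Ioi y)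
        ≤ Real.exp (α * y) * (Real.exp (-α * (y - η)) * (b + K * Real.exp r * η)) := by gcongr
      _ = b + b * (Real.exp (α * η) - 1) + Real.exp (α * η) * (K * Real.exp r * η) := by
          rw [← mul_assoc, e4]; ring
      _ ≤ b + b * (Real.exp α * (α * η)) + Real.exp α * (K * Real.exp r * η) := by gcongr
      _ = _ := by ring
  set K' := Real.exp α * (b * α + K * Real.exp r)
  have hK' : 0 ≤ K' := by positivity
  set W := Real.exp α * M.real (Ioi 0) * Real.exp (r / 2)
  have hW : 0 ≤ W := by positivity
  refine ⟨K + K' + W, fun y hy => ?_⟩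
  have hE := Real.exp_pos (-(r / 2) * y)
  rw [abs_le]
  constructor
  · have := hlow y hy
    nlinarith [mul_nonneg hK' hE.le, mul_nonneg hW hE.le]
  · rcases le_total 1 y with h1 | h1
    · have := hupp y h1
      nlinarith [mul_nonneg hK0 hE.le, mul_nonneg hW hE.le]
    · have h2 : Real.exp (α * y) * M.real (Ioi y) ≤ Real.exp α * M.real (Ioi 0) := by
        have : M.real (Ioi y) ≤ M.real (Ioi 0) :=
          measureReal_mono (Ioi_subset_Ioi hy) (hfin 0).ne
        have : Real.exp (α * y) ≤ Real.exp α := Real.exp_le_exp.2 (by nlinarith)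
        gcongr
      have h3 : 1 ≤ Real.exp (r / 2) * Real.exp (-(r / 2) * y) := by
        rw [← Real.exp_add]; apply Real.one_le_exp; nlinarith
      have h4 : Real.exp α * M.real (Ioi 0) ≤ W * Real.exp (-(r / 2) * y) := by
        rw [mul_assoc]
        exact le_mul_of_one_le_right (by positivity) h3
      nlinarith [mul_nonneg hK0 hE.le, mul_nonneg hK' hE.le]

/-- The renewal theorem with exponential rate for a transient walk tilted by `α`. -/
lemma exists_abs_renewal_tail_sub_le {ν : Measure ℝ} [IsProbabilityMeasure ν] {α γ δ Y₀ ρ : ℝ}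
    (hα : 0 < α) (hαγ : α < γ) (hγ : Integrable (fun x => Real.exp (γ * x)) ν)
    (h1 : ∫ x, Real.exp (α * x) ∂ν = 1) (hρ : ∫ x, x * Real.exp (α * x) ∂ν = ρ) (hρ0 : 0 < ρ)
    (hlt : ∀ κ ∈ Ioo 0 α, ∫ x, Real.exp (κ * x) ∂ν < 1)
    (hδ : 0 < δ)
    (hsnl : ∀ y : ℝ, Y₀ ≤ |y| → ‖complexMGF id ν (α + y * Complex.I)‖ ≤ 1 - δ) :
    ∃ r > 0, r < α ∧ ∃ C, ∀ y ≥ 0,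
      |Real.exp (α * y) * (renewalMeasure ν).real (Ioi y) - (α * ρ)⁻¹| ≤ C * Real.exp (-r * y) := by
  obtain ⟨r, hr, hrα, C, hC⟩ :=
    exists_abs_smoothed_renewal_sub_le hα hαγ hγ h1 hρ hρ0 hlt hδ hsnl
  have hfin : ∀ y, renewalMeasure ν (Ioi y) < ⊤ := fun y =>
    (measure_Ioi_le_of_integrable_exp (half_pos hα) (integrable_exp_renewalMeasure ν
      (_root_.integrable_exp_mul_of_mem_Icc hγ ⟨(half_pos hα).le, by linarith⟩)
      (hlt _ ⟨half_pos hα, by linarith⟩)) y).1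
  obtain ⟨C', hC'⟩ := exists_abs_tail_sub_le_of_smoothed (c := ρ⁻¹ / (α * (α + 1))) (C := C)
    hα hr (by positivity) hfin (by
      intro y hy
      convert hC y hy using 3
      ring)
  refine ⟨r / 2, half_pos hr, by linarith, C', fun y hy => ?_⟩
  convert hC' y hy using 3
  have : α + 1 ≠ 0 := by linarith
  field_simp

/-- The tail of the renewal measure in multiplicative coordinates: the mass of
`{v | exp (-v) < w}`. -/
def renewalTail (ν : Measure ℝ) (w : ℝ) : ℝ := (renewalMeasure ν).real {v | 1 < Real.exp v * w}

lemma setOf_one_lt_exp_mul_of_pos {w : ℝ} (hw : 0 < w) :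
    {v | 1 < Real.exp v * w} = Ioi (-Real.log w) := by
  ext v
  simp only [mem_ofPred_eq, mem_Ioi]
  rw [← Real.exp_lt_exp (x := -Real.log w), Real.exp_neg, Real.exp_log hw, inv_lt_iff_one_lt_mul₀ hw]

lemma setOf_one_lt_exp_mul_of_nonpos {w : ℝ} (hw : w ≤ 0) :
    {v | 1 < Real.exp v * w} = ∅ := by
  ext v
  simp only [mem_ofPred_eq, mem_empty_iff_false, iff_false, not_lt]
  nlinarith [Real.exp_pos v]

lemma measurableSet_one_lt_exp_mul (w : ℝ) : MeasurableSet {v | 1 < Real.exp v * w} :=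
  measurableSet_lt measurable_const (by fun_prop)

lemma renewalTail_of_pos (ν : Measure ℝ) {w : ℝ} (hw : 0 < w) :
    renewalTail ν w = (renewalMeasure ν).real (Ioi (-Real.log w)) := by
  rw [renewalTail, setOf_one_lt_exp_mul_of_pos hw]

lemma renewalTail_of_nonpos (ν : Measure ℝ) {w : ℝ} (hw : w ≤ 0) : renewalTail ν w = 0 := by
  rw [renewalTail, setOf_one_lt_exp_mul_of_nonpos hw]; simp

lemma renewalTail_nonneg (ν : Measure ℝ) (w : ℝ) : 0 ≤ renewalTail ν w := measureReal_nonneg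

lemma renewalMeasure_one_lt_exp_mul_lt_top {ν : Measure ℝ}
    (hfin : ∀ y, renewalMeasure ν (Ioi y) < ⊤) (w : ℝ) :
    renewalMeasure ν {v | 1 < Real.exp v * w} < ⊤ := by
  rcases le_or_gt w 0 with hw | hw
  · rw [setOf_one_lt_exp_mul_of_nonpos hw]; simp
  · rw [setOf_one_lt_exp_mul_of_pos hw]; exact hfin _

lemma monotone_renewalTail {ν : Measure ℝ} (hfin : ∀ y, renewalMeasure ν (Ioi y) < ⊤) :
    Monotone (renewalTail ν) := by
  intro w z hwz
  refine measureReal_mono (fun v hv => ?_) (renewalMeasure_one_lt_exp_mul_lt_top hfin z).ne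
  exact lt_of_lt_of_le hv (mul_le_mul_of_nonneg_left hwz (Real.exp_nonneg v))

/-- Deviation of the renewal tail from its leading power behaviour. -/
lemma exists_renewalTail_bounds {ν : Measure ℝ} {α r c C₀ C₁ : ℝ} (hα : 0 < α)
    (hc : 0 ≤ c)
    (h0 : ∀ y, (renewalMeasure ν).real (Ioi y) ≤ C₀ * Real.exp (-(α / 2) * y))
    (h1 : ∀ y ≥ 0, |Real.exp (α * y) * (renewalMeasure ν).real (Ioi y) - c| ≤
      C₁ * Real.exp (-r * y)) (hr : 0 < r) :
    ∃ C ≥ 0, ∀ w > 0, renewalTail ν w ≤ C * w ^ (α / 2) ∧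
      |renewalTail ν w - c * (min w 1) ^ α| ≤ C * min (w ^ (α / 2)) (w ^ (α + r)) := by
  have hC0 : 0 ≤ C₀ := by
    have := measureReal_nonneg.trans (h0 0); simpa using this
  have hC1 : 0 ≤ C₁ := by
    have := (abs_nonneg _).trans (h1 0 le_rfl); simpa using this
  refine ⟨C₀ + C₁ + c, by positivity, fun w hw => ?_⟩
  have hpow : ∀ s : ℝ, Real.exp (s * Real.log w) = w ^ s := by
    intro s; rw [Real.rpow_def_of_pos hw]; ring_nf
  have hQ : renewalTail ν w ≤ C₀ * w ^ (α / 2) := by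
    rw [renewalTail_of_pos ν hw]
    refine (h0 _).trans_eq ?_
    rw [← hpow]; ring_nf
  have hw2 : 0 < w ^ (α / 2) := Real.rpow_pos_of_pos hw _
  have hw3 : 0 < w ^ (α + r) := Real.rpow_pos_of_pos hw _
  refine ⟨hQ.trans ?_, ?_⟩
  · gcongr; linarith
  rcases le_total w 1 with h | h
  · have hy : 0 ≤ -Real.log w := by linarith [Real.log_nonpos hw.le h]
    rw [min_eq_left h, min_eq_right (Real.rpow_le_rpow_of_exponent_ge hw h (by linarith))]
    have := h1 _ hy
    rw [← renewalTail_of_pos ν hw] at this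
    have e1 : Real.exp (α * -Real.log w) = (w ^ α)⁻¹ := by
      rw [← Real.rpow_neg hw.le, ← hpow]; ring_nf
    have e2 : Real.exp (-r * -Real.log w) = w ^ r := by rw [← hpow]; ring_nf
    rw [e1, e2] at this
    have hwa : 0 < w ^ α := Real.rpow_pos_of_pos hw _
    have e3 : renewalTail ν w - c * w ^ α = w ^ α * ((w ^ α)⁻¹ * renewalTail ν w - c) := by
      field_simp
    rw [e3, abs_mul, abs_of_pos hwa]
    calc _ ≤ w ^ α * (C₁ * w ^ r) := by gcongr
      _ = C₁ * w ^ (α + r) := by rw [Real.rpow_add hw]; ring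
      _ ≤ _ := by gcongr; linarith
  · rw [min_eq_right h, min_eq_left (Real.rpow_le_rpow_of_exponent_le h (by linarith)),
      Real.one_rpow, mul_one]
    have h3 : 1 ≤ w ^ (α / 2) := Real.one_le_rpow h (by linarith)
    have h4 := renewalTail_nonneg ν w
    rw [abs_le]
    constructor <;> nlinarith [mul_nonneg hC0 hw2.le, mul_nonneg hC1 hw2.le]

/-- Exponential moments of a measure below `y`, given an exponential bound on its tail. -/
lemma exists_setLIntegral_exp_Iic_le {M : Measure ℝ} {α s C : ℝ} (hs : α < s) (hα : 0 < α)
    (hfin : ∀ y, M (Ioi y) < ⊤)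
    (h : ∀ y, M.real (Ioi y) ≤ C * Real.exp (-α * y)) :
    ∃ K : ℝ, 0 ≤ K ∧ ∀ y, ∫⁻ v in Iic y, ENNReal.ofReal (Real.exp (s * v)) ∂M ≤
      ENNReal.ofReal (K * Real.exp ((s - α) * y)) := by
  have hC : 0 ≤ C := by
    have := measureReal_nonneg.trans (h 0); simpa using this
  set a : ℕ → ℝ := fun n => C * Real.exp α * Real.exp (-(s - α)) ^ n with ha
  have hsum : Summable a := by
    refine (summable_geometric_of_lt_one (Real.exp_nonneg _) ?_).mul_left _
    exact Real.exp_lt_one_iff.2 (by linarith)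
  have ha0 : ∀ n, 0 ≤ a n := fun n => by positivity
  refine ⟨∑' n, a n, tsum_nonneg ha0, fun y => ?_⟩
  have hcover : Iic y ⊆ ⋃ n : ℕ, Ioc (y - n - 1) (y - n) := by
    intro v hv
    have hv' : 0 ≤ y - v := by simpa using hv
    refine mem_iUnion.2 ⟨⌊y - v⌋₊, ?_, ?_⟩
    · linarith [Nat.lt_floor_add_one (y - v)]
    · linarith [Nat.floor_le hv']
  calc ∫⁻ v in Iic y, ENNReal.ofReal (Real.exp (s * v)) ∂M
      ≤ ∫⁻ v in ⋃ n : ℕ, Ioc (y - n - 1) (y - n), ENNReal.ofReal (Real.exp (s * v)) ∂M :=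
        lintegral_mono_set hcover
    _ ≤ ∑' n : ℕ, ∫⁻ v in Ioc (y - n - 1) (y - n), ENNReal.ofReal (Real.exp (s * v)) ∂M :=
        lintegral_iUnion_le _ _
    _ ≤ ∑' n : ℕ, ENNReal.ofReal (Real.exp ((s - α) * y)) * ENNReal.ofReal (a n) := by
        refine ENNReal.tsum_le_tsum fun n => ?_
        calc ∫⁻ v in Ioc (y - n - 1) (y - n), ENNReal.ofReal (Real.exp (s * v)) ∂M
            ≤ ∫⁻ v in Ioc (y - n - 1) (y - n), ENNReal.ofReal (Real.exp (s * (y - n))) ∂M := by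
              refine setLIntegral_mono measurable_const fun v hv => ?_
              apply ENNReal.ofReal_le_ofReal
              apply Real.exp_le_exp.2
              have := hv.2
              nlinarith
          _ = ENNReal.ofReal (Real.exp (s * (y - n))) * M (Ioc (y - n - 1) (y - n)) := by
              rw [setLIntegral_const]
          _ ≤ ENNReal.ofReal (Real.exp (s * (y - n))) *
                ENNReal.ofReal (C * Real.exp (-α * (y - n - 1))) := by
              gcongr
              refine (measure_mono Ioc_subset_Ioi_self).trans ?_
              rw [← ENNReal.ofReal_toReal (hfin _).ne]
              exact ENNReal.ofReal_le_ofReal (h _)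
          _ = _ := by
              rw [← ENNReal.ofReal_mul (Real.exp_nonneg _), ← ENNReal.ofReal_mul (Real.exp_nonneg _)]
              congr 1
              rw [ha]
              simp only
              rw [← Real.exp_nat_mul]
              have : Real.exp (s * (y - n)) * Real.exp (-α * (y - n - 1)) =
                Real.exp ((s - α) * y) * (Real.exp α * Real.exp (n * -(s - α))) := by
                rw [← Real.exp_add, ← Real.exp_add, ← Real.exp_add]; ring_nf
              linear_combination C * this
    _ = _ := by
        rw [ENNReal.tsum_mul_left, ← ENNReal.ofReal_tsum_of_nonneg ha0 hsum, mul_comm,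
          ← ENNReal.ofReal_mul (tsum_nonneg ha0)]

lemma ofReal_renewalTail {ν : Measure ℝ} (hfin : ∀ y, renewalMeasure ν (Ioi y) < ⊤) (w : ℝ) :
    ENNReal.ofReal (renewalTail ν w) = renewalMeasure ν {v | 1 < Real.exp v * w} :=
  ENNReal.ofReal_toReal (renewalMeasure_one_lt_exp_mul_lt_top hfin w).ne

lemma ofReal_renewalTail_eq {ν : Measure ℝ} [IsProbabilityMeasure ν]
    (hfin : ∀ y, renewalMeasure ν (Ioi y) < ⊤) (w : ℝ) :
    ENNReal.ofReal (renewalTail ν w) = indicator (Ioi 1) (fun _ => 1) w +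
      ∫⁻ z, ENNReal.ofReal (renewalTail ν (Real.exp z * w)) ∂ν := by
  have hm := measurableSet_one_lt_exp_mul w
  rw [ofReal_renewalTail hfin, ← lintegral_indicator_one hm, lintegral_renewalMeasure ν
    (measurable_one.indicator hm)]
  congr 1
  · simp [indicator]
  · refine lintegral_congr fun z => ?_
    rw [ofReal_renewalTail hfin, ← lintegral_indicator_one (measurableSet_one_lt_exp_mul _)]
    refine lintegral_congr fun v => ?_
    have : Real.exp (z + v) * w = Real.exp v * (Real.exp z * w) := by rw [Real.exp_add]; ring
    simp [indicator, this]

/-- The tail of a fixed point of `R ↦ S` in terms of the renewal tail of the walk `log A`. -/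
lemma measureReal_gt_eq_integral_renewalTail_sub {Ω : Type*} [MeasurableSpace Ω] {μ : Measure Ω}
    [IsProbabilityMeasure μ] {A R S : Ω → ℝ} (hA : Measurable A) (hR : Measurable R)
    (hS : Measurable S) (hAR : IndepFun A R μ) (hA0 : ∀ᵐ ω ∂μ, 0 < A ω)
    (hid : Measure.map R μ = Measure.map S μ)
    (hfin : ∀ y, renewalMeasure (μ.map fun ω => Real.log (A ω)) (Ioi y) < ⊤) {x : ℝ} (hx : 0 < x)
    (hint : Integrable (fun ω => renewalTail (μ.map fun ω => Real.log (A ω)) (R ω / x)) μ) :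
    Integrable (fun ω => renewalTail (μ.map fun ω => Real.log (A ω)) (S ω / x)) μ ∧
    Integrable (fun ω => renewalTail (μ.map fun ω => Real.log (A ω)) (A ω * R ω / x)) μ ∧
    μ.real {ω | x < R ω} = (∫ ω, renewalTail (μ.map fun ω => Real.log (A ω)) (S ω / x) ∂μ) -
      ∫ ω, renewalTail (μ.map fun ω => Real.log (A ω)) (A ω * R ω / x) ∂μ := by
  have hlog : Measurable fun ω => Real.log (A ω) := Real.measurable_log.comp hA
  set ν := μ.map fun ω => Real.log (A ω) with hν
  have : IsProbabilityMeasure ν := Measure.isProbabilityMeasure_map hlog.aemeasurable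
  set Q := renewalTail ν with hQ
  have hQm : Measurable Q := (monotone_renewalTail hfin).measurable
  have hQ0 : ∀ w, 0 ≤ Q w := renewalTail_nonneg ν
  have hid' : IdentDistrib R S μ μ := ⟨hR.aemeasurable, hS.aemeasurable, hid⟩
  have hidQ : IdentDistrib (fun ω => Q (R ω / x)) (fun ω => Q (S ω / x)) μ μ :=
    hid'.comp (u := fun r => Q (r / x)) (by fun_prop)
  have key : ∫⁻ ω, ENNReal.ofReal (Q (R ω / x)) ∂μ = μ {ω | x < R ω} +
      ∫⁻ ω, ENNReal.ofReal (Q (A ω * R ω / x)) ∂μ := by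
    have h1 : ∀ ω, ENNReal.ofReal (Q (R ω / x)) = indicator {ω | x < R ω} (fun _ => 1) ω +
        ∫⁻ z, ENNReal.ofReal (Q (Real.exp z * (R ω / x))) ∂ν := by
      intro ω
      rw [hQ, ofReal_renewalTail_eq hfin]
      congr 1
      simp [indicator, one_lt_div hx]
    have hset : MeasurableSet {ω | x < R ω} := measurableSet_lt measurable_const hR
    simp_rw [h1]
    rw [lintegral_add_left (measurable_const.indicator hset)]
    congr 1
    · exact lintegral_indicator_one hset
    · have h2 : ∫⁻ ω, ENNReal.ofReal (Q (A ω * R ω / x)) ∂μ =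
          ∫⁻ ω, ENNReal.ofReal (Q (Real.exp (Real.log (A ω)) * (R ω / x))) ∂μ := by
        refine lintegral_congr_ae ?_
        filter_upwards [hA0] with ω hω
        rw [Real.exp_log hω, mul_div_assoc]
      have hind : IndepFun R (fun ω => Real.log (A ω)) μ :=
        (hAR.comp Real.measurable_log measurable_id).symm
      have h3 := (indepFun_iff_map_prod_eq_prod_map_map hR.aemeasurable hlog.aemeasurable).1 hind
      have hg : Measurable fun p : ℝ × ℝ => ENNReal.ofReal (Q (Real.exp p.2 * (p.1 / x))) := by
        fun_prop
      rw [h2, ← lintegral_map (f := fun p : ℝ × ℝ => ENNReal.ofReal (Q (Real.exp p.2 * (p.1 / x))))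
        hg (hR.prodMk hlog), h3, lintegral_prod _ hg.aemeasurable,
        lintegral_map hg.lintegral_prod_right' hR]
  have hi1 : ∫⁻ ω, ENNReal.ofReal (Q (R ω / x)) ∂μ < ⊤ := hint.lintegral_lt_top
  have hi2 : Integrable (fun ω => Q (A ω * R ω / x)) μ := by
    refine ⟨(by fun_prop : Measurable fun ω => Q (A ω * R ω / x)).aestronglyMeasurable, ?_⟩
    rw [hasFiniteIntegral_iff_ofReal (Eventually.of_forall fun ω => hQ0 _)]
    exact lt_of_le_of_lt (key ▸ le_add_self) hi1
  refine ⟨hidQ.integrable_iff.1 hint, hi2, ?_⟩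
  rw [← hidQ.integral_eq]
  have h4 := ofReal_integral_eq_lintegral_ofReal hint (Eventually.of_forall fun ω => hQ0 _)
  have h5 := ofReal_integral_eq_lintegral_ofReal hi2 (Eventually.of_forall fun ω => hQ0 _)
  rw [← h4, ← h5] at key
  have h6 := congrArg ENNReal.toReal key
  rw [ENNReal.toReal_add (measure_ne_top _ _) ENNReal.ofReal_ne_top,
    ENNReal.toReal_ofReal (integral_nonneg fun ω => hQ0 _),
    ENNReal.toReal_ofReal (integral_nonneg fun ω => hQ0 _)] at h6
  rw [measureReal_def]
  linarith

lemma ae_ne_of_measure_Ioc_le {Ω : Type*} [MeasurableSpace Ω] {μ : Measure Ω}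
    [IsFiniteMeasure μ] {X : Ω → ℝ} {β C h₀ : ℝ} (hβ : 0 < β) (hh₀ : 0 < h₀)
    (h : ∀ h ∈ Ioc (0:ℝ) h₀, ∀ a : ℝ, (μ {ω | a < X ω ∧ X ω ≤ a + h}).toReal ≤ C * h ^ β) (b : ℝ) :
    ∀ᵐ ω ∂μ, X ω ≠ b := by
  have hle : ∀ t ∈ Ioc (0:ℝ) h₀, μ.real {ω | X ω = b} ≤ C * t ^ β := by
    intro t ht
    refine le_trans ?_ (h t ht (b - t / 2))
    refine measureReal_mono (fun ω hω => ?_)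
    simp only [mem_ofPred_eq] at hω ⊢
    constructor <;> linarith [ht.1]
  have hlim : Tendsto (fun t : ℝ => C * t ^ β) (nhdsWithin 0 (Ioi 0)) (nhds 0) := by
    have : Tendsto (fun t : ℝ => C * t ^ β) (nhds 0) (nhds (C * 0 ^ β)) :=
      ((Real.continuousAt_rpow_const 0 β (Or.inr hβ.le)).tendsto).const_mul C
    rw [Real.zero_rpow hβ.ne', mul_zero] at this
    exact this.mono_left nhdsWithin_le_nhds
  have h0 : μ.real {ω | X ω = b} ≤ 0 := by
    refine ge_of_tendsto hlim ?_
    filter_upwards [Ioc_mem_nhdsGT hh₀] with t ht using hle t ht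
  have : μ.real {ω | X ω = b} = 0 := le_antisymm h0 measureReal_nonneg
  rw [measureReal_eq_zero_iff] at this
  rw [ae_iff]
  simpa using this

lemma integral_lt_integral_of_ae_lt {Ω : Type*} [MeasurableSpace Ω] {μ : Measure Ω} [NeZero μ]
    {f g : Ω → ℝ} (hf : Integrable f μ) (hg : Integrable g μ) (h : ∀ᵐ ω ∂μ, f ω < g ω) :
    ∫ ω, f ω ∂μ < ∫ ω, g ω ∂μ := by
  have h1 : 0 < ∫ ω, (g ω - f ω) ∂μ := by
    rw [integral_pos_iff_support_of_nonneg_ae (h.mono fun ω hω => (sub_pos.2 hω).le) (hg.sub hf)]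
    rw [pos_iff_ne_zero]
    intro h0
    have : ∀ᵐ ω ∂μ, ω ∉ Function.support fun ω => g ω - f ω := measure_eq_zero_iff_ae_notMem.1 h0
    have hF : ∀ᵐ ω ∂μ, False := by
      filter_upwards [this, h] with ω h1 h2
      simp only [Function.mem_support, not_not] at h1
      linarith
    rw [eventually_false_iff_eq_bot, ae_eq_bot] at hF
    exact NeZero.ne μ hF
  rw [integral_sub hg hf] at h1
  linarith

lemma integral_exp_mul_lt_one {ν : Measure ℝ} [IsProbabilityMeasure ν] {α κ : ℝ}
    (h0 : ∀ᵐ x ∂ν, x ≠ 0) (hint : Integrable (fun x => Real.exp (α * x)) ν)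
    (h1 : ∫ x, Real.exp (α * x) ∂ν = 1) (hκ : κ ∈ Ioo 0 α) :
    ∫ x, Real.exp (κ * x) ∂ν < 1 := by
  have hα : 0 < α := hκ.1.trans hκ.2
  have hq : κ / α < 1 := (div_lt_one hα).2 hκ.2
  have hq0 : 0 < κ / α := div_pos hκ.1 hα
  have : ∫ x, ((1 - κ / α) + κ / α * Real.exp (α * x)) ∂ν = 1 := by
    rw [integral_add (integrable_const _) (hint.const_mul _), integral_const_mul, h1]
    simp
  rw [← this]
  refine integral_lt_integral_of_ae_lt
    (_root_.integrable_exp_mul_of_mem_Icc hint ⟨hκ.1.le, hκ.2.le⟩)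
    ((integrable_const _).add (hint.const_mul _)) ?_
  filter_upwards [h0] with x hx
  have := strictConvexOn_exp.2 (mem_univ (0:ℝ)) (mem_univ (α * x))
    (by simpa [hα.ne'] using hx) (sub_pos.2 hq) hq0 (by ring)
  simp only [smul_eq_mul, mul_zero, zero_add, Real.exp_zero, mul_one] at this
  have e : κ / α * (α * x) = κ * x := by field_simp
  rwa [e] at this

lemma integral_mul_exp_pos {ν : Measure ℝ} [IsProbabilityMeasure ν] {α : ℝ} (hα : 0 < α)
    (h0 : ∀ᵐ x ∂ν, x ≠ 0) (hint : Integrable (fun x => Real.exp (α * x)) ν)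
    (h1 : ∫ x, Real.exp (α * x) ∂ν = 1) (hρ : Integrable (fun x => x * Real.exp (α * x)) ν) :
    0 < ∫ x, x * Real.exp (α * x) ∂ν := by
  have h2 : ∫ x, (Real.exp (α * x) - α * (x * Real.exp (α * x))) ∂ν < ∫ _x, (1:ℝ) ∂ν := by
    refine integral_lt_integral_of_ae_lt (hint.sub (hρ.const_mul _)) (integrable_const _) ?_
    filter_upwards [h0] with x hx
    have h3 := Real.add_one_lt_exp (x := -(α * x)) (by simpa [hα.ne'] using hx)
    have h4 : Real.exp (-(α * x)) * Real.exp (α * x) = 1 := by rw [← Real.exp_add]; simp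
    nlinarith [Real.exp_pos (α * x)]
  rw [integral_sub hint (hρ.const_mul _), integral_const_mul, h1] at h2
  simp at h2
  nlinarith

lemma exists_norm_complexMGF_le_of_stronglyNonLattice {Ω : Type*} [MeasurableSpace Ω]
    {μ : Measure Ω} [IsProbabilityMeasure μ] {A : Ω → ℝ} (hA : Measurable A)
    (hA0 : ∀ᵐ ω ∂μ, 0 < A ω) {α : ℝ} (hAα : (∫ ω, A ω ^ α ∂μ) = 1)
    (hsnl : MeasureStronglyNonLattice
      (Measure.map (fun ω => Real.log (A ω))
        (μ.withDensity fun ω => ENNReal.ofReal (A ω ^ α)))) :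
    ∃ δ > 0, ∃ Y₀ : ℝ, ∀ y : ℝ, Y₀ ≤ |y| →
      ‖complexMGF id (μ.map fun ω => Real.log (A ω)) (α + y * Complex.I)‖ ≤ 1 - δ := by
  have hlog : Measurable fun ω => Real.log (A ω) := Real.measurable_log.comp hA
  have e : ∀ y : ℝ, complexMGF id (μ.map fun ω => Real.log (A ω)) (α + y * Complex.I) =
      ∫ z, Complex.exp (Complex.I * (↑(y * z) : ℂ)) ∂(Measure.map (fun ω => Real.log (A ω))
        (μ.withDensity fun ω => ENNReal.ofReal (A ω ^ α))) := by
    intro y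
    rw [complexMGF, integral_map hlog.aemeasurable (by fun_prop),
      integral_map hlog.aemeasurable (by fun_prop),
      integral_withDensity_eq_integral_toReal_smul (by fun_prop) (by simp)]
    refine integral_congr_ae ?_
    filter_upwards [hA0] with ω hω
    rw [ENNReal.toReal_ofReal (Real.rpow_nonneg hω.le _), Real.rpow_def_of_pos hω,
      Complex.real_smul, Complex.ofReal_exp, ← Complex.exp_add]
    simp only [id]
    push_cast
    ring_nf
  have hint : Integrable (fun ω => A ω ^ α) μ := by
    by_contra h
    rw [integral_undef h] at hAα
    norm_num at hAα
  have hb : ∀ y : ℝ, ‖complexMGF id (μ.map fun ω => Real.log (A ω)) (α + y * Complex.I)‖ ≤ 1 := by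
    intro y
    rw [complexMGF, integral_map hlog.aemeasurable (by fun_prop), ← hAα]
    refine norm_integral_le_of_norm_le hint ?_
    filter_upwards [hA0] with ω hω
    rw [Complex.norm_exp, Real.rpow_def_of_pos hω]
    simp [mul_comm]
  unfold MeasureStronglyNonLattice at hsnl
  simp_rw [← e] at hsnl
  obtain ⟨b, hb1, hb2⟩ := exists_between hsnl
  have hev := eventually_lt_of_limsup_lt hb1
    (isBoundedUnder_of ⟨1, hb⟩)
  rw [eventually_sup] at hev
  obtain ⟨y₁, h₁⟩ := eventually_atBot.1 hev.1
  obtain ⟨y₂, h₂⟩ := eventually_atTop.1 hev.2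
  refine ⟨1 - b, by linarith, max (-y₁) y₂, fun y hy => ?_⟩
  rcases le_total 0 y with h | h
  · rw [abs_of_nonneg h] at hy
    linarith [h₂ y ((le_max_right _ _).trans hy)]
  · rw [abs_of_nonpos h] at hy
    linarith [h₁ y (by linarith [(le_max_left (-y₁) y₂).trans hy])]

/-- Karamata-type bound for the upper truncated moment of order below the tail index. -/
lemma exists_lintegral_rpow_gt_le {Ω : Type*} [MeasurableSpace Ω] {μ : Measure Ω}
    [IsProbabilityMeasure μ] {B : Ω → ℝ} {κ q x₀ : ℝ} (hκ : 0 < κ) (hx₀ : 0 < x₀)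
    (hq0 : 0 < q) (hq : 2 ^ κ * q < 1)
    (h : ∀ x ≥ x₀, μ.real {ω | 2 * x < B ω} ≤ q * μ.real {ω | x < B ω}) :
    ∃ C ≥ 0, ∀ x ≥ x₀, ∫⁻ ω in {ω | x < B ω}, ENNReal.ofReal (B ω ^ κ) ∂μ ≤
      ENNReal.ofReal (C * x ^ κ * μ.real {ω | x < B ω}) := by
  have hpow : ∀ n : ℕ, ∀ x ≥ x₀, μ.real {ω | 2 ^ n * x < B ω} ≤ q ^ n * μ.real {ω | x < B ω} := by
    intro n
    induction n with
    | zero => intro x _; simp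
    | succ n ih =>
      intro x hx
      have h1 : x₀ ≤ 2 ^ n * x := by
        have : (1:ℝ) ≤ 2 ^ n := one_le_pow₀ (by norm_num)
        nlinarith
      calc μ.real {ω | 2 ^ (n + 1) * x < B ω} = μ.real {ω | 2 * (2 ^ n * x) < B ω} := by
            rw [pow_succ]; ring_nf
        _ ≤ q * μ.real {ω | 2 ^ n * x < B ω} := h _ h1
        _ ≤ q * (q ^ n * μ.real {ω | x < B ω}) := by gcongr; exact ih x hx
        _ = _ := by ring
  have hs : Summable fun n : ℕ => (2 ^ κ * q : ℝ) ^ n :=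
    summable_geometric_of_lt_one (by positivity) hq
  refine ⟨2 ^ κ * ∑' n : ℕ, (2 ^ κ * q : ℝ) ^ n,
    mul_nonneg (by positivity) (tsum_nonneg fun n => by positivity), fun x hx => ?_⟩
  have hx0 : 0 < x := hx₀.trans_le hx
  have hcover : {ω | x < B ω} ⊆ ⋃ n : ℕ, {ω | 2 ^ n * x < B ω ∧ B ω ≤ 2 ^ (n + 1) * x} := by
    intro ω hω
    have h1 : 1 < B ω / x := (one_lt_div hx0).2 hω
    obtain ⟨n, hn1, hn2⟩ := exists_mem_Ioc_zpow (show 0 < B ω / x by linarith)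
      (one_lt_two : (1:ℝ) < 2)
    have hn0 : 0 ≤ n := by
      by_contra hneg
      have : (2:ℝ) ^ (n + 1) ≤ 1 := zpow_le_one_of_nonpos₀ (by norm_num) (by omega)
      linarith
    obtain ⟨m, rfl⟩ := Int.eq_ofNat_of_zero_le hn0
    refine mem_iUnion.2 ⟨m, ?_, ?_⟩
    · rw [lt_div_iff₀ hx0] at hn1; exact_mod_cast hn1
    · rw [div_le_iff₀ hx0] at hn2; exact_mod_cast hn2
  set p := μ.real {ω | x < B ω}
  calc ∫⁻ ω in {ω | x < B ω}, ENNReal.ofReal (B ω ^ κ) ∂μ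
      ≤ ∫⁻ ω in ⋃ n : ℕ, {ω | 2 ^ n * x < B ω ∧ B ω ≤ 2 ^ (n + 1) * x},
          ENNReal.ofReal (B ω ^ κ) ∂μ := lintegral_mono_set hcover
    _ ≤ ∑' n : ℕ, ∫⁻ ω in {ω | 2 ^ n * x < B ω ∧ B ω ≤ 2 ^ (n + 1) * x},
          ENNReal.ofReal (B ω ^ κ) ∂μ := lintegral_iUnion_le _ _
    _ ≤ ∑' n : ℕ, ENNReal.ofReal (2 ^ κ * x ^ κ * p * (2 ^ κ * q) ^ n) := by
        refine ENNReal.tsum_le_tsum fun n => ?_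
        calc ∫⁻ ω in {ω | 2 ^ n * x < B ω ∧ B ω ≤ 2 ^ (n + 1) * x}, ENNReal.ofReal (B ω ^ κ) ∂μ
            ≤ ∫⁻ ω in {ω | 2 ^ n * x < B ω ∧ B ω ≤ 2 ^ (n + 1) * x},
                ENNReal.ofReal ((2 ^ (n + 1) * x) ^ κ) ∂μ := by
              refine setLIntegral_mono measurable_const fun ω hω => ?_
              apply ENNReal.ofReal_le_ofReal
              have : 0 < 2 ^ n * x := by positivity
              exact Real.rpow_le_rpow (by linarith [hω.1]) hω.2 hκ.le
          _ = ENNReal.ofReal ((2 ^ (n + 1) * x) ^ κ) *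
                μ {ω | 2 ^ n * x < B ω ∧ B ω ≤ 2 ^ (n + 1) * x} := by rw [setLIntegral_const]
          _ ≤ ENNReal.ofReal ((2 ^ (n + 1) * x) ^ κ) * ENNReal.ofReal (q ^ n * p) := by
              gcongr
              refine (measure_mono (t := {ω | 2 ^ n * x < B ω}) fun ω hω => hω.1).trans ?_
              rw [← ENNReal.ofReal_toReal (measure_ne_top μ {ω | 2 ^ n * x < B ω})]
              exact ENNReal.ofReal_le_ofReal (hpow n x hx)
          _ = _ := by
              rw [← ENNReal.ofReal_mul (by positivity)]
              congr 1
              rw [Real.mul_rpow (by positivity) hx0.le, ← Real.rpow_natCast, ← Real.rpow_mul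
                (by norm_num), mul_pow, ← Real.rpow_natCast (2 ^ κ) n, ← Real.rpow_mul (by norm_num)]
              have : (2:ℝ) ^ (((n + 1 : ℕ) : ℝ) * κ) = 2 ^ κ * 2 ^ (κ * (n : ℝ)) := by
                rw [← Real.rpow_add (by norm_num)]; push_cast; ring_nf
              rw [this]; ring
    _ = _ := by
        rw [← ENNReal.ofReal_tsum_of_nonneg (fun n => by positivity) (hs.mul_left _),
          tsum_mul_left]
        congr 1; ring

/-- Karamata-type bound for the lower truncated moment of order above the tail index. -/
lemma exists_lintegral_rpow_le_le {Ω : Type*} [MeasurableSpace Ω] {μ : Measure Ω}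
    [IsProbabilityMeasure μ] {B : Ω → ℝ} {s q x₀ : ℝ} (hs : 0 < s)
    (hx₀ : 0 < x₀) (hq0 : 0 < q) (hq : 1 < 2 ^ s * q) (hpos : ∀ x > 0, 0 < μ.real {ω | x < B ω})
    (h : ∀ x ≥ x₀, q * μ.real {ω | x < B ω} ≤ μ.real {ω | 2 * x < B ω}) :
    ∃ C ≥ 0, ∀ x ≥ x₀, ∫⁻ ω in {ω | 0 < B ω ∧ B ω ≤ x}, ENNReal.ofReal (B ω ^ s) ∂μ ≤
      ENNReal.ofReal (C * x ^ s * μ.real {ω | x < B ω}) := by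
  set p : ℝ → ℝ := fun x => μ.real {ω | x < B ω} with hp
  have hanti : ∀ {x y}, x ≤ y → p y ≤ p x := fun {x y} hxy =>
    measureReal_mono (fun ω hω => lt_of_le_of_lt hxy hω)
  set θ := (2 ^ s * q)⁻¹ with hθ
  have hθ1 : θ < 1 := inv_lt_one_of_one_lt₀ hq
  have hθ0 : 0 < θ := by positivity
  set C := max (2 ^ s * θ / (1 - θ)) ((2 * x₀) ^ s / (x₀ ^ s * p (2 * x₀))) with hC
  have hp2 : 0 < p (2 * x₀) := hpos _ (by positivity)
  have hC0 : 0 ≤ C := le_max_of_le_right (by positivity)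
  refine ⟨C, hC0, ?_⟩
  have hind : ∀ n : ℕ, ∀ x ≥ x₀, x ≤ 2 ^ (n + 1) * x₀ →
      ∫⁻ ω in {ω | 0 < B ω ∧ B ω ≤ x}, ENNReal.ofReal (B ω ^ s) ∂μ ≤
      ENNReal.ofReal (C * x ^ s * p x) := by
    intro n
    induction n with
    | zero =>
      intro x hx hx2
      simp only [zero_add, pow_one] at hx2
      have hx0 : 0 < x := hx₀.trans_le hx
      have hpx := hanti hx2
      calc ∫⁻ ω in {ω | 0 < B ω ∧ B ω ≤ x}, ENNReal.ofReal (B ω ^ s) ∂μ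
          ≤ ∫⁻ ω in {ω | 0 < B ω ∧ B ω ≤ x}, ENNReal.ofReal ((2 * x₀) ^ s) ∂μ := by
            refine setLIntegral_mono measurable_const fun ω hω => ?_
            apply ENNReal.ofReal_le_ofReal
            exact Real.rpow_le_rpow hω.1.le (hω.2.trans hx2) hs.le
        _ ≤ ENNReal.ofReal ((2 * x₀) ^ s) := by
            rw [setLIntegral_const]
            exact mul_le_of_le_one_right (by positivity) prob_le_one
        _ ≤ _ := by
            apply ENNReal.ofReal_le_ofReal
            calc (2 * x₀) ^ s = ((2 * x₀) ^ s / (x₀ ^ s * p (2 * x₀))) * (x₀ ^ s * p (2 * x₀)) := by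
                  field_simp
              _ ≤ C * (x ^ s * p x) := by
                  gcongr
                  exact le_max_right _ _
              _ = _ := by ring
    | succ n ih =>
      intro x hx hx2
      rcases le_total x (2 ^ (n + 1) * x₀) with hle | hle
      · exact ih x hx hle
      set y := x / 2 with hy
      have hxy : x = 2 * y := by rw [hy]; ring
      have hyx : x₀ ≤ y := by
        have : (1:ℝ) ≤ 2 ^ n := one_le_pow₀ (by norm_num)
        rw [pow_succ] at hle
        nlinarith
      have hy0 : 0 < y := hx₀.trans_le hyx
      have hx0 : 0 < x := hx₀.trans_le hx
      have h1 := ih y hyx (by rw [hy, div_le_iff₀ two_pos]; rw [pow_succ] at hx2; linarith)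
      have hsub : {ω | 0 < B ω ∧ B ω ≤ x} ⊆ {ω | 0 < B ω ∧ B ω ≤ y} ∪ {ω | y < B ω ∧ B ω ≤ x} := by
        intro ω hω
        rcases le_or_gt (B ω) y with h | h
        · exact Or.inl ⟨hω.1, h⟩
        · exact Or.inr ⟨h, hω.2⟩
      calc ∫⁻ ω in {ω | 0 < B ω ∧ B ω ≤ x}, ENNReal.ofReal (B ω ^ s) ∂μ
          ≤ ∫⁻ ω in {ω | 0 < B ω ∧ B ω ≤ y} ∪ {ω | y < B ω ∧ B ω ≤ x},
              ENNReal.ofReal (B ω ^ s) ∂μ := lintegral_mono_set hsub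
        _ ≤ ∫⁻ ω in {ω | 0 < B ω ∧ B ω ≤ y}, ENNReal.ofReal (B ω ^ s) ∂μ +
            ∫⁻ ω in {ω | y < B ω ∧ B ω ≤ x}, ENNReal.ofReal (B ω ^ s) ∂μ :=
            lintegral_union_le _ _ _
        _ ≤ ENNReal.ofReal (C * y ^ s * p y) + ENNReal.ofReal (x ^ s * p y) := by
            gcongr
            calc ∫⁻ ω in {ω | y < B ω ∧ B ω ≤ x}, ENNReal.ofReal (B ω ^ s) ∂μ
                ≤ ∫⁻ ω in {ω | y < B ω ∧ B ω ≤ x}, ENNReal.ofReal (x ^ s) ∂μ := by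
                  refine setLIntegral_mono measurable_const fun ω hω => ?_
                  apply ENNReal.ofReal_le_ofReal
                  exact Real.rpow_le_rpow (hy0.trans hω.1).le hω.2 hs.le
              _ = ENNReal.ofReal (x ^ s) * μ {ω | y < B ω ∧ B ω ≤ x} := by rw [setLIntegral_const]
              _ ≤ ENNReal.ofReal (x ^ s) * ENNReal.ofReal (p y) := by
                  gcongr
                  rw [hp]
                  simp only [measureReal_def]
                  rw [ENNReal.ofReal_toReal (measure_ne_top _ _)]
                  exact measure_mono fun ω hω => hω.1
              _ = _ := by rw [← ENNReal.ofReal_mul (by positivity)]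
        _ = ENNReal.ofReal (C * y ^ s * p y + x ^ s * p y) := by
            have : 0 ≤ p y := measureReal_nonneg
            rw [← ENNReal.ofReal_add (by positivity) (by positivity)]
        _ ≤ _ := by
            apply ENNReal.ofReal_le_ofReal
            have h2 : q * p y ≤ p x := by rw [hxy]; exact h y hyx
            have h3 : x ^ s = 2 ^ s * y ^ s := by rw [hxy, Real.mul_rpow (by norm_num) hy0.le]
            have h4 : 2 ^ s * θ / (1 - θ) ≤ C := le_max_left _ _
            rw [div_le_iff₀ (by linarith)] at h4
            have h5 : θ * (C + 2 ^ s) ≤ C := by linarith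
            have h6 : 0 ≤ p y := measureReal_nonneg
            have h7 : θ * (2 ^ s * q) = 1 := inv_mul_cancel₀ (by positivity)
            have hys : 0 < y ^ s := by positivity
            calc C * y ^ s * p y + x ^ s * p y = (θ * (2 ^ s * q)) * ((C + 2 ^ s) * (y ^ s * p y)) := by
                  rw [h3, h7]; ring
              _ = (θ * (C + 2 ^ s)) * (2 ^ s * y ^ s * (q * p y)) := by ring
              _ ≤ C * (2 ^ s * y ^ s * p x) := by gcongr
              _ = _ := by rw [h3]; ring
  intro x hx
  obtain ⟨n, hn⟩ := pow_unbounded_of_one_lt (x / x₀) (one_lt_two : (1:ℝ) < 2)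
  refine hind n x hx ?_
  rw [div_lt_iff₀ hx₀] at hn
  rw [pow_succ]
  nlinarith

lemma tendsto_tail_ratio_of_slowlyVarying {p L : ℝ → ℝ} {α : ℝ} (hLdef : ∀ x, L x = x ^ α * p x)
    (hL : SlowlyVarying L) :
    (∀ x > 0, 0 < p x) ∧ Tendsto (fun x => p (2 * x) / p x) atTop (nhds (2 ^ (-α))) := by
  have hpos : ∀ x > 0, 0 < p x := by
    intro x hx
    have h1 := hL.1 x hx
    rw [hLdef] at h1
    exact (pos_iff_pos_of_mul_pos h1).1 (Real.rpow_pos_of_pos hx _)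
  refine ⟨hpos, ?_⟩
  have h2 := (hL.2 2 two_pos).const_mul ((2:ℝ) ^ (-α))
  rw [mul_one] at h2
  refine h2.congr' ?_
  filter_upwards [eventually_gt_atTop 0] with x hx
  have h3 := hpos x hx
  have h4 : (0:ℝ) < x ^ α := Real.rpow_pos_of_pos hx _
  rw [hLdef, hLdef, Real.mul_rpow (by norm_num) hx.le, Real.rpow_neg (by norm_num)]
  field_simp

lemma exists_tail_doubling {p : ℝ → ℝ} {α κ s : ℝ} (hpos : ∀ x > 0, 0 < p x)
    (hlim : Tendsto (fun x => p (2 * x) / p x) atTop (nhds (2 ^ (-α)))) (hκ : κ < α) (hs : α < s) :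
    ∃ q₁ q₂ : ℝ, 0 < q₁ ∧ 2 ^ κ * q₁ < 1 ∧ 0 < q₂ ∧ 1 < 2 ^ s * q₂ ∧ ∃ x₀ > 0, ∀ x ≥ x₀,
      p (2 * x) ≤ q₁ * p x ∧ q₂ * p x ≤ p (2 * x) := by
  have h2 : ∀ {a b : ℝ}, a < b → (2:ℝ) ^ a < 2 ^ b := fun h =>
    Real.rpow_lt_rpow_of_exponent_lt one_lt_two h
  refine ⟨2 ^ (-((α + κ) / 2)), 2 ^ (-((α + s) / 2)), by positivity, ?_, by positivity, ?_, ?_⟩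
  · rw [← Real.rpow_add two_pos]
    exact Real.rpow_lt_one_of_one_lt_of_neg one_lt_two (by linarith)
  · rw [← Real.rpow_add two_pos]
    exact Real.one_lt_rpow one_lt_two (by linarith)
  · have e1 := hlim.eventually_lt_const (h2 (by linarith : -α < -((α + κ) / 2)))
    have e2 := hlim.eventually_const_lt (h2 (by linarith : -((α + s) / 2) < -α))
    obtain ⟨x₁, hx₁⟩ := eventually_atTop.1 (e1.and e2)
    refine ⟨max x₁ 1, by positivity, fun x hx => ?_⟩
    have hx0 : 0 < p x := hpos x (by linarith [le_max_right x₁ 1])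
    obtain ⟨a1, a2⟩ := hx₁ x ((le_max_left _ _).trans hx)
    rw [div_lt_iff₀ hx0] at a1
    rw [lt_div_iff₀ hx0] at a2
    exact ⟨a1.le, a2.le⟩

/-- A power function that is flatter at infinity than at the origin integrates, after rescaling,
to at most a multiple of the tail. -/
lemma exists_lintegral_min_rpow_le {Ω : Type*} [MeasurableSpace Ω] {μ : Measure Ω}
    [IsProbabilityMeasure μ] {B : Ω → ℝ} {α κ s : ℝ} (hB : Measurable B)
    (hκ0 : 0 < κ) (hκ : κ < α) (hs : α < s)
    (hpos : ∀ x > 0, 0 < μ.real {ω | x < B ω})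
    (hlim : Tendsto (fun x => μ.real {ω | 2 * x < B ω} / μ.real {ω | x < B ω}) atTop
      (nhds (2 ^ (-α)))) :
    ∃ C ≥ 0, ∃ x₀ > 0, ∀ x ≥ x₀, ∫⁻ ω, ENNReal.ofReal
      (min ((2 * max (B ω) 0 / x) ^ κ) ((2 * max (B ω) 0 / x) ^ s)) ∂μ ≤
      ENNReal.ofReal (C * μ.real {ω | x < B ω}) := by
  obtain ⟨q₁, q₂, hq₁, hq₁', hq₂, hq₂', x₀, hx₀, hx⟩ :=
    exists_tail_doubling (p := fun x => μ.real {ω | x < B ω}) hpos hlim hκ hs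
  obtain ⟨C₁, hC₁, h₁⟩ := exists_lintegral_rpow_gt_le hκ0 hx₀ hq₁ hq₁' fun x h => (hx x h).1
  obtain ⟨C₂, hC₂, h₂⟩ := exists_lintegral_rpow_le_le (by linarith) hx₀ hq₂ hq₂' hpos
    fun x h => (hx x h).2
  have hs0 : 0 < s := by linarith
  refine ⟨2 ^ κ * C₁ + 2 ^ s * C₂, by positivity, x₀, hx₀, fun x hxx => ?_⟩
  have hx0 : 0 < x := hx₀.trans_le hxx
  have hm1 : MeasurableSet {ω | x < B ω} := measurableSet_lt measurable_const hB
  have hm2 : MeasurableSet {ω | 0 < B ω ∧ B ω ≤ x} :=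
    (measurableSet_lt measurable_const hB).inter (measurableSet_le hB measurable_const)
  have hpw : ∀ ω, ENNReal.ofReal
      (min ((2 * max (B ω) 0 / x) ^ κ) ((2 * max (B ω) 0 / x) ^ s)) ≤
      indicator {ω | x < B ω} (fun ω => ENNReal.ofReal ((2 / x) ^ κ) * ENNReal.ofReal (B ω ^ κ)) ω +
      indicator {ω | 0 < B ω ∧ B ω ≤ x}
        (fun ω => ENNReal.ofReal ((2 / x) ^ s) * ENNReal.ofReal (B ω ^ s)) ω := by
    intro ω
    rcases le_or_gt (B ω) 0 with h | h
    · rw [max_eq_right h]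
      simp [Real.zero_rpow hκ0.ne', Real.zero_rpow hs0.ne']
    · rw [max_eq_left h.le]
      have e : ∀ t : ℝ, (2 * B ω / x) ^ t = (2 / x) ^ t * B ω ^ t := by
        intro t
        rw [← Real.mul_rpow (by positivity) h.le]; ring_nf
      simp_rw [← ENNReal.ofReal_mul (Real.rpow_nonneg (by positivity : 0 ≤ 2 / x) _), e]
      rcases le_or_gt (B ω) x with h' | h'
      · refine le_trans ?_ (le_add_of_nonneg_left (by positivity))
        rw [indicator_of_mem (show ω ∈ {ω | 0 < B ω ∧ B ω ≤ x} from ⟨h, h'⟩)]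
        exact ENNReal.ofReal_le_ofReal (min_le_right _ _)
      · refine le_trans ?_ (le_add_of_nonneg_right (by positivity))
        rw [indicator_of_mem (show ω ∈ {ω | x < B ω} from h')]
        exact ENNReal.ofReal_le_ofReal (min_le_left _ _)
  refine (lintegral_mono hpw).trans ?_
  rw [lintegral_add_left (by measurability), lintegral_indicator hm1, lintegral_indicator hm2,
    lintegral_const_mul _ (by fun_prop), lintegral_const_mul _ (by fun_prop)]
  set P := μ.real {ω | x < B ω}
  have hP : 0 ≤ P := measureReal_nonneg
  calc _ ≤ ENNReal.ofReal ((2 / x) ^ κ) * ENNReal.ofReal (C₁ * x ^ κ * P) +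
        ENNReal.ofReal ((2 / x) ^ s) * ENNReal.ofReal (C₂ * x ^ s * P) := by
        gcongr
        · exact h₁ x hxx
        · exact h₂ x hxx
    _ = _ := by
        have e : ∀ t : ℝ, (2 / x) ^ t * x ^ t = 2 ^ t := by
          intro t
          rw [← Real.mul_rpow (by positivity) hx0.le]; field_simp
        rw [← ENNReal.ofReal_mul (by positivity), ← ENNReal.ofReal_mul (by positivity),
          ← ENNReal.ofReal_add (by positivity) (by positivity)]
        congr 1
        linear_combination C₁ * P * e κ + C₂ * P * e s

lemma integrable_pos_part_rpow_of_tail {Ω : Type*} [MeasurableSpace Ω] {μ : Measure Ω}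
    [IsProbabilityMeasure μ] {B : Ω → ℝ} {α κ : ℝ} (hB : Measurable B)
    (hκ0 : 0 < κ) (hκ : κ < α)
    (hpos : ∀ x > 0, 0 < μ.real {ω | x < B ω})
    (hlim : Tendsto (fun x => μ.real {ω | 2 * x < B ω} / μ.real {ω | x < B ω}) atTop
      (nhds (2 ^ (-α)))) :
    Integrable (fun ω => max (B ω) 0 ^ κ) μ := by
  obtain ⟨q₁, q₂, hq₁, hq₁', hq₂, hq₂', x₀, hx₀, hx⟩ :=
    exists_tail_doubling (p := fun x => μ.real {ω | x < B ω}) hpos hlim hκ (lt_add_one α)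
  obtain ⟨C₁, hC₁, h₁⟩ := exists_lintegral_rpow_gt_le hκ0 hx₀ hq₁ hq₁' fun x h => (hx x h).1
  refine ⟨(by fun_prop : Measurable _).aestronglyMeasurable, ?_⟩
  rw [hasFiniteIntegral_iff_ofReal (Eventually.of_forall fun ω => by positivity)]
  have hpw : ∀ ω, ENNReal.ofReal (max (B ω) 0 ^ κ) ≤
      indicator {ω | x₀ < B ω} (fun ω => ENNReal.ofReal (B ω ^ κ)) ω + ENNReal.ofReal (x₀ ^ κ) := by
    intro ω
    rcases le_or_gt (B ω) x₀ with h | h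
    · refine le_trans (ENNReal.ofReal_le_ofReal ?_) le_add_self
      exact Real.rpow_le_rpow (le_max_right _ _) (max_le h hx₀.le) hκ0.le
    · rw [indicator_of_mem (show ω ∈ {ω | x₀ < B ω} from h), max_eq_left (hx₀.trans h).le]
      exact le_self_add
  refine (lintegral_mono hpw).trans_lt ?_
  rw [lintegral_add_right _ measurable_const,
    lintegral_indicator (measurableSet_lt measurable_const hB)]
  refine ENNReal.add_lt_top.2 ⟨(h₁ x₀ le_rfl).trans_lt ENNReal.ofReal_lt_top, ?_⟩
  simp

lemma integrable_of_integral_min_le {Ω : Type*} [MeasurableSpace Ω] {μ : Measure Ω}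
    [IsFiniteMeasure μ] {T : Ω → ℝ} (hT : Measurable T) (hT0 : ∀ ω, 0 ≤ T ω) {K : ℝ}
    (h : ∀ M > 0, ∫ ω, min (T ω) M ∂μ ≤ K) : Integrable T μ := by
  refine ⟨hT.aestronglyMeasurable, ?_⟩
  rw [hasFiniteIntegral_iff_ofReal (Eventually.of_forall hT0)]
  have hlim : Tendsto (fun n : ℕ => ∫⁻ ω, ENNReal.ofReal (min (T ω) (n + 1)) ∂μ) atTop
      (nhds (∫⁻ ω, ENNReal.ofReal (T ω) ∂μ)) := by
    refine lintegral_tendsto_of_tendsto_of_monotone (fun n => by fun_prop) ?_ ?_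
    · refine Eventually.of_forall fun ω n m hnm => ?_
      apply ENNReal.ofReal_le_ofReal
      gcongr
    · refine Eventually.of_forall fun ω => ?_
      refine tendsto_const_nhds.congr' ?_
      filter_upwards [eventually_ge_atTop ⌈T ω⌉₊] with n hn
      rw [min_eq_left]
      have := (Nat.ceil_le).1 hn
      linarith
  refine lt_of_le_of_lt (le_of_tendsto' hlim (b := ENNReal.ofReal K) fun n => ?_)
    ENNReal.ofReal_lt_top
  have hint : Integrable (fun ω => min (T ω) (n + 1 : ℝ)) μ := by
    refine (integrable_const (n + 1 : ℝ)).mono' (by fun_prop) (Eventually.of_forall fun ω => ?_)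
    rw [Real.norm_eq_abs, abs_of_nonneg (le_min (hT0 ω) (by positivity))]
    exact min_le_right _ _
  rw [← ofReal_integral_eq_lintegral_ofReal hint
    (Eventually.of_forall fun ω => le_min (hT0 ω) (by positivity))]
  exact ENNReal.ofReal_le_ofReal (h _ (by positivity))

lemma rpow_abs_add_le {κ ε : ℝ} (hκ : 0 < κ) (hε : 0 < ε) (a b : ℝ) :
    |a + b| ^ κ ≤ (1 + ε) ^ κ * |a| ^ κ + (1 + ε⁻¹) ^ κ * |b| ^ κ := by
  rw [← Real.mul_rpow (by positivity) (abs_nonneg a),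
    ← Real.mul_rpow (by positivity) (abs_nonneg b)]
  have h := abs_add_le a b
  rcases le_total |b| (ε * |a|) with hb | hb
  · refine le_trans ?_ (le_add_of_nonneg_right (by positivity))
    refine Real.rpow_le_rpow (abs_nonneg _) (by linarith) hκ.le
  · refine le_trans ?_ (le_add_of_nonneg_left (by positivity))
    refine Real.rpow_le_rpow (abs_nonneg _) ?_ hκ.le
    have : |a| ≤ ε⁻¹ * |b| := by rw [inv_mul_eq_div, le_div_iff₀ hε]; linarith
    linarith

/-- Absolute moments of a solution of `R = A R + B` in law. -/
lemma integrable_abs_rpow_of_fixed_point {Ω : Type*} [MeasurableSpace Ω] {μ : Measure Ω}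
    [IsProbabilityMeasure μ] {A B R : Ω → ℝ} (hA : Measurable A) (hB : Measurable B)
    (hR : Measurable R) (hAR : IndepFun A R μ)
    (hfix : Measure.map R μ = Measure.map (fun ω => A ω * R ω + B ω) μ)
    {κ : ℝ} (hκ : 0 < κ) (hAκ : Integrable (fun ω => |A ω| ^ κ) μ)
    (hA1 : ∫ ω, |A ω| ^ κ ∂μ < 1) (hA0 : 0 < ∫ ω, |A ω| ^ κ ∂μ)
    (hBκ : Integrable (fun ω => |B ω| ^ κ) μ) :
    Integrable (fun ω => |R ω| ^ κ) μ := by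
  set q₀ := ∫ ω, |A ω| ^ κ ∂μ with hq₀
  obtain ⟨ε, hε, hεq⟩ : ∃ ε > 0, (1 + ε) ^ κ * q₀ < 1 := by
    have : Tendsto (fun ε : ℝ => (1 + ε) ^ κ * q₀) (nhds 0) (nhds ((1 + 0) ^ κ * q₀)) := by
      refine Tendsto.mul_const _ ?_
      exact (ContinuousAt.rpow_const (by fun_prop) (Or.inr hκ.le))
    rw [add_zero, Real.one_rpow, one_mul] at this
    have h1 := (this.mono_left (nhdsWithin_le_nhds (s := Ioi 0))).eventually_lt_const hA1
    obtain ⟨ε, h2, h3⟩ := (h1.and self_mem_nhdsWithin).exists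
    exact ⟨ε, h3, h2⟩
  set q := (1 + ε) ^ κ * q₀ with hq
  have hqpos : 0 < q := by positivity
  set T : Ω → ℝ := fun ω => |R ω| ^ κ with hTdef
  have hT : Measurable T := by fun_prop
  have hT0 : ∀ ω, 0 ≤ T ω := fun ω => by positivity
  set d := ∫ ω, (1 + ε⁻¹) ^ κ * |B ω| ^ κ ∂μ with hd
  have hd0 : 0 ≤ d := integral_nonneg fun ω => by positivity
  set m : ℝ → ℝ := fun M => ∫ ω, min (T ω) M ∂μ with hm
  have hmin : ∀ {f : Ω → ℝ} (M : ℝ), Measurable f → (∀ ω, 0 ≤ f ω) → 0 ≤ M →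
      Integrable (fun ω => min (f ω) M) μ := by
    intro f M hf hf0 hM
    refine (integrable_const M).mono' (by fun_prop) (Eventually.of_forall fun ω => ?_)
    rw [Real.norm_eq_abs, abs_of_nonneg (le_min (hf0 ω) hM)]
    exact min_le_right _ _
  have hrec : ∀ M > 0, m M ≤ q * m (M / q) + d := by
    intro M hM
    have hid : IdentDistrib R (fun ω => A ω * R ω + B ω) μ μ :=
      ⟨hR.aemeasurable, by fun_prop, hfix⟩
    have h1 : m M = ∫ ω, min (|A ω * R ω + B ω| ^ κ) M ∂μ :=
      (hid.comp (u := fun r => min (|r| ^ κ) M) (by fun_prop)).integral_eq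
    have h2 : ∫ ω, min (|A ω * R ω + B ω| ^ κ) M ∂μ ≤
        ∫ ω, (min ((1 + ε) ^ κ * |A ω * R ω| ^ κ) M + (1 + ε⁻¹) ^ κ * |B ω| ^ κ) ∂μ := by
      refine integral_mono (hmin M (by fun_prop) (fun ω => by positivity) hM.le)
        ((hmin M (by fun_prop) (fun ω => by positivity) hM.le).add (hBκ.const_mul _)) fun ω => ?_
      have h3 := rpow_abs_add_le hκ hε (A ω * R ω) (B ω)
      have h4 : 0 ≤ (1 + ε⁻¹) ^ κ * |B ω| ^ κ := by positivity
      simp only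
      rw [min_add]
      exact le_min ((min_le_left _ _).trans h3) ((min_le_right _ _).trans (by linarith))
    have h5 : ∫ ω, min ((1 + ε) ^ κ * |A ω * R ω| ^ κ) M ∂μ ≤ q * m (M / q) := by
      set g : ℝ × ℝ → ℝ := fun p => min ((1 + ε) ^ κ * |p.2 * p.1| ^ κ) M with hg
      have hgm : Measurable g := by fun_prop
      have hprod := (indepFun_iff_map_prod_eq_prod_map_map hR.aemeasurable hA.aemeasurable).1
        hAR.symm
      have := Measure.isProbabilityMeasure_map (μ := μ) hR.aemeasurable
      have := Measure.isProbabilityMeasure_map (μ := μ) hA.aemeasurable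
      have hgi : Integrable g ((μ.map R).prod (μ.map A)) := by
        refine (integrable_const M).mono' hgm.aestronglyMeasurable
          (Eventually.of_forall fun p => ?_)
        rw [Real.norm_eq_abs, abs_of_nonneg (le_min (by positivity) hM.le)]
        exact min_le_right _ _
      have e1 : ∫ ω, min ((1 + ε) ^ κ * |A ω * R ω| ^ κ) M ∂μ = ∫ p, g p ∂(μ.map fun ω => (R ω, A ω)) :=
        (integral_map (hR.prodMk hA).aemeasurable hgm.aestronglyMeasurable).symm
      rw [e1, hprod, integral_prod _ hgi]
      have e2 : q * m (M / q) = ∫ r, q * min (|r| ^ κ) (M / q) ∂(μ.map R) := by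
        rw [integral_map hR.aemeasurable (Measurable.aestronglyMeasurable (by fun_prop)), integral_const_mul]
      rw [e2]
      refine integral_mono hgi.integral_prod_left ?_ fun r => ?_
      · refine Integrable.const_mul ?_ _
        refine (integrable_const (M / q)).mono' (Measurable.aestronglyMeasurable (by fun_prop)) (Eventually.of_forall fun ω => ?_)
        rw [Real.norm_eq_abs, abs_of_nonneg (le_min (by positivity) (by positivity))]
        exact min_le_right _ _
      · simp only [hg]
        rw [mul_min_of_nonneg _ _ hqpos.le, mul_div_cancel₀ _ hqpos.ne',
          integral_map hA.aemeasurable (Measurable.aestronglyMeasurable (by fun_prop))]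
        refine le_min ?_ ?_
        · calc ∫ ω, min ((1 + ε) ^ κ * |A ω * r| ^ κ) M ∂μ
              ≤ ∫ ω, ((1 + ε) ^ κ * |r| ^ κ) * |A ω| ^ κ ∂μ := by
                refine integral_mono (hmin M (by fun_prop) (fun ω => by positivity) hM.le)
                  (hAκ.const_mul _) fun ω => (min_le_left _ _).trans_eq ?_
                rw [abs_mul, Real.mul_rpow (abs_nonneg _) (abs_nonneg _)]; ring
            _ = q * |r| ^ κ := by rw [integral_const_mul]; ring
        · calc ∫ ω, min ((1 + ε) ^ κ * |A ω * r| ^ κ) M ∂μ ≤ ∫ _ω, M ∂μ :=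
                integral_mono (hmin M (by fun_prop) (fun ω => by positivity) hM.le)
                  (integrable_const _) fun ω => min_le_right _ _
            _ = M := by simp
    rw [h1]
    refine h2.trans ?_
    rw [integral_add (hmin M (by fun_prop) (fun ω => by positivity) hM.le) (hBκ.const_mul _)]
    linarith
  have hlim : Tendsto (fun N : ℝ => m N / N) atTop (nhds 0) := by
    have h0 : Tendsto (fun N : ℝ => ∫ ω, min (T ω) N / N ∂μ) atTop (nhds (∫ _ω, (0:ℝ) ∂μ)) := by
      refine tendsto_integral_filter_of_dominated_convergence (fun _ => 1) ?_ ?_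
        (integrable_const _) ?_
      · exact Eventually.of_forall fun N => (by fun_prop : Measurable _).aestronglyMeasurable
      · filter_upwards [eventually_gt_atTop 0] with N hN
        refine Eventually.of_forall fun ω => ?_
        rw [Real.norm_eq_abs, abs_of_nonneg (div_nonneg (le_min (hT0 ω) hN.le) hN.le),
          div_le_one hN]
        exact min_le_right _ _
      · refine Eventually.of_forall fun ω => ?_
        refine (tendsto_const_nhds.div_atTop tendsto_id (a := T ω)).congr' ?_
        filter_upwards [eventually_ge_atTop (T ω)] with N hN
        rw [min_eq_left hN]; rfl
    simpa [hm, integral_div] using h0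
  refine integrable_of_integral_min_le hT hT0 (K := d / (1 - q)) fun M hM => ?_
  have hiter : ∀ n : ℕ, m M ≤ q ^ n * m (M / q ^ n) + d / (1 - q) * (1 - q ^ n) := by
    intro n
    induction n with
    | zero => simp
    | succ n ih =>
      have h1 := hrec (M / q ^ n) (by positivity)
      have h2 : M / q ^ n / q = M / q ^ (n + 1) := by rw [pow_succ, div_div]
      rw [h2] at h1
      refine ih.trans ?_
      have h3 := mul_le_mul_of_nonneg_left h1 (pow_nonneg hqpos.le n)
      have h4 : d = d / (1 - q) * (1 - q) := by
        rw [div_mul_cancel₀]; linarith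
      calc q ^ n * m (M / q ^ n) + d / (1 - q) * (1 - q ^ n)
          ≤ q ^ n * (q * m (M / q ^ (n + 1)) + d) + d / (1 - q) * (1 - q ^ n) := by linarith
        _ = q ^ n * (q * m (M / q ^ (n + 1)) + d / (1 - q) * (1 - q)) +
            d / (1 - q) * (1 - q ^ n) := by rw [← h4]
        _ = _ := by ring
  have hN : Tendsto (fun n : ℕ => M / q ^ n) atTop atTop := by
    have := (tendsto_pow_atTop_atTop_of_one_lt ((one_lt_inv₀ hqpos).2 hεq)).const_mul_atTop hM
    refine this.congr fun n => ?_
    rw [inv_pow, div_eq_mul_inv]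
  have hfin : Tendsto (fun n : ℕ => M * (m (M / q ^ n) / (M / q ^ n)) + d / (1 - q) * (1 - q ^ n))
      atTop (nhds (M * 0 + d / (1 - q) * (1 - 0))) :=
    ((hlim.comp hN).const_mul M).add
      (((tendsto_pow_atTop_nhds_zero_of_lt_one hqpos.le hεq).const_sub 1).const_mul _)
  simp only [mul_zero, sub_zero, mul_one, zero_add] at hfin
  refine ge_of_tendsto' hfin fun n => (hiter n).trans_eq ?_
  congr 1
  field_simp

/-- Mixed moments of the pair `(A, B)` by the weighted arithmetic–geometric mean inequality. -/
lemma integrable_rpow_mul_rpow {Ω : Type*} [MeasurableSpace Ω] {μ : Measure Ω}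
    {A B : Ω → ℝ} (hA : Measurable A) (hB : Measurable B) {p q γ : ℝ}
    (hp : 0 ≤ p) (hpγ : p < γ) (hAγ : Integrable (fun ω => |A ω| ^ γ) μ)
    (hBq : Integrable (fun ω => |B ω| ^ (q / (1 - p / γ))) μ) :
    Integrable (fun ω => |A ω| ^ p * |B ω| ^ q) μ := by
  have hγ : 0 < γ := hp.trans_lt hpγ
  have h1 : p / γ < 1 := (div_lt_one hγ).2 hpγ
  have h0 : 0 ≤ p / γ := by positivity
  refine ((hAγ.const_mul (p / γ)).add (hBq.const_mul (1 - p / γ))).mono'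
    (by fun_prop : Measurable _).aestronglyMeasurable (Eventually.of_forall fun ω => ?_)
  rw [Real.norm_eq_abs, abs_of_nonneg (by positivity)]
  have := Real.geom_mean_le_arith_mean2_weighted h0 (sub_nonneg.2 h1.le)
    (by positivity : 0 ≤ |A ω| ^ γ) (by positivity : 0 ≤ |B ω| ^ (q / (1 - p / γ))) (by ring)
  rw [← Real.rpow_mul (abs_nonneg _), ← Real.rpow_mul (abs_nonneg _),
    mul_div_cancel₀ _ hγ.ne', div_mul_cancel₀ _ (by linarith : 1 - p / γ ≠ 0)] at this
  exact this

lemma integrable_mul_rpow_mul_rpow {Ω : Type*} [MeasurableSpace Ω] {μ : Measure Ω}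
    [IsProbabilityMeasure μ] {A B R : Ω → ℝ} (hA : Measurable A) (hB : Measurable B)
    (hindep : IndepFun (fun ω => (A ω, B ω)) R μ) {p q γ : ℝ}
    (hp : 0 ≤ p) (hpγ : p < γ) (hAγ : Integrable (fun ω => |A ω| ^ γ) μ)
    (hBq : Integrable (fun ω => |B ω| ^ (q / (1 - p / γ))) μ)
    (hRp : Integrable (fun ω => |R ω| ^ p) μ) :
    Integrable (fun ω => |A ω * R ω| ^ p * |B ω| ^ q) μ := by
  have h1 := integrable_rpow_mul_rpow hA hB hp hpγ hAγ hBq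
  have h2 : IndepFun (fun ω => |A ω| ^ p * |B ω| ^ q) (fun ω => |R ω| ^ p) μ :=
    hindep.comp (φ := fun z : ℝ × ℝ => |z.1| ^ p * |z.2| ^ q) (ψ := fun r => |r| ^ p)
      (by fun_prop) (by fun_prop)
  refine (h2.integrable_mul h1 hRp).congr (Eventually.of_forall fun ω => ?_)
  simp only [Pi.mul_apply]
  rw [abs_mul, Real.mul_rpow (abs_nonneg _) (abs_nonneg _)]
  ring

/-- Fubini for the probability of a planar event under independence. -/
lemma measure_pair_mem_eq_lintegral {Ω : Type*} [MeasurableSpace Ω] {μ : Measure Ω}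
    [IsProbabilityMeasure μ] {X Y : Ω → ℝ} (hX : Measurable X) (hY : Measurable Y)
    (hXY : IndepFun X Y μ) {s : Set (ℝ × ℝ)} (hs : MeasurableSet s) :
    μ {ω | (X ω, Y ω) ∈ s} = ∫⁻ ω, μ {ω' | (X ω', Y ω) ∈ s} ∂μ := by
  have hprod := (indepFun_iff_map_prod_eq_prod_map_map hX.aemeasurable hY.aemeasurable).1 hXY
  have := Measure.isProbabilityMeasure_map (μ := μ) hX.aemeasurable
  have := Measure.isProbabilityMeasure_map (μ := μ) hY.aemeasurable
  have h1 : μ {ω | (X ω, Y ω) ∈ s} = (μ.map fun ω => (X ω, Y ω)) s :=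
    (Measure.map_apply (hX.prodMk hY) hs).symm
  rw [h1, hprod, Measure.prod_apply_symm hs,
    lintegral_map (measurable_measure_prodMk_right hs) hY]
  refine lintegral_congr fun ω => ?_
  rw [Measure.map_apply hX (by exact measurable_prodMk_right hs)]
  rfl

/-- Interpolation of two bounds. -/
lemma le_rpow_mul_rpow_of_le {p a b τ : ℝ} (hp : 0 ≤ p) (ha : p ≤ a) (hb : p ≤ b)
    (hτ0 : 0 ≤ τ) (hτ1 : τ ≤ 1) : p ≤ a ^ (1 - τ) * b ^ τ := by
  rcases hp.eq_or_lt with rfl | hp'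
  · positivity
  calc p = p ^ (1 - τ) * p ^ τ := by
        rw [← Real.rpow_add hp']; simp
    _ ≤ a ^ (1 - τ) * b ^ τ := by
        have ha0 := hp.trans ha
        gcongr

/-- If `log A` has a Hölder continuous distribution function, the product `A * R` puts little mass
near a large level. -/
lemma exists_measure_abs_mul_sub_le {Ω : Type*} [MeasurableSpace Ω] {μ : Measure Ω}
    [IsProbabilityMeasure μ] {A R : Ω → ℝ} (hA : Measurable A) (hR : Measurable R)
    (hAR : IndepFun A R μ) (hA0 : ∀ᵐ ω ∂μ, 0 < A ω) {β γ κ : ℝ}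
    (hcond : ∃ C > (0:ℝ), ∃ h₀ > (0:ℝ), ∀ h ∈ Set.Ioc (0:ℝ) h₀, ∀ a : ℝ,
      (μ {ω | a < Real.log (A ω) ∧ Real.log (A ω) ≤ a + h}).toReal ≤ C * h ^ β)
    (hAγ : Integrable (fun ω => A ω ^ γ) μ) (hκ0 : 0 < κ) (hκγ : κ < γ)
    (hRκ : Integrable (fun ω => |R ω| ^ κ) μ) :
    ∃ C ≥ 0, ∃ z₀ > 0, ∀ z ≥ z₀, μ {ω | |A ω * R ω - z| ≤ 2 * √z} ≤
      ENNReal.ofReal (C * z ^ (-(κ + β / 2 * (1 - κ / γ)))) := by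
  obtain ⟨C, hC, h₀, hh₀, hcond⟩ := hcond
  have hγ : 0 < γ := hκ0.trans hκγ
  have hm0 : 0 ≤ ∫ ω, A ω ^ γ ∂μ := integral_nonneg_of_ae (by
    filter_upwards [hA0] with ω hω using by simp only [Pi.zero_apply]; positivity)
  set m := ∫ ω, A ω ^ γ ∂μ
  set τ := κ / γ with hτ
  have hτ0 : 0 < τ := by positivity
  have hτ1 : τ < 1 := (div_lt_one hγ).2 hκγ
  set D := (C * 8 ^ β) ^ (1 - τ) * (m * 2 ^ γ) ^ τ with hD
  have hD0 : 0 ≤ D := by positivity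
  refine ⟨D * ∫ ω, |R ω| ^ κ ∂μ, mul_nonneg hD0 (integral_nonneg fun ω => by positivity),
    max 16 ((8 / h₀) ^ 2), by positivity, fun z hz => ?_⟩
  have hz16 : 16 ≤ z := (le_max_left _ _).trans hz
  have hz0 : 0 < z := by linarith
  have hs4 : 4 ≤ √z := by
    rw [show (4:ℝ) = √16 by rw [show (16:ℝ) = 4 ^ 2 by norm_num, Real.sqrt_sq (by norm_num)]]
    exact Real.sqrt_le_sqrt hz16
  have hsz : √z * √z = z := Real.mul_self_sqrt hz0.le
  have hsh : 8 / h₀ ≤ √z := Real.le_sqrt_of_sq_le ((le_max_right _ _).trans hz)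
  set η := 2 / √z with hη
  have hη0 : 0 < η := by positivity
  have hη2 : η ≤ 1 / 2 := by rw [hη, div_le_div_iff₀ (by linarith) (by norm_num)]; linarith
  have hzη : 2 * √z = η * z := by
    rw [hη, div_mul_eq_mul_div, eq_div_iff (by linarith), mul_assoc, hsz]
  have hmeas : MeasurableSet {p : ℝ × ℝ | |p.1 * p.2 - z| ≤ 2 * √z} :=
    measurableSet_le (by fun_prop) measurable_const
  rw [show {ω | |A ω * R ω - z| ≤ 2 * √z} =
    {ω | (A ω, R ω) ∈ {p : ℝ × ℝ | |p.1 * p.2 - z| ≤ 2 * √z}} from rfl,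
    measure_pair_mem_eq_lintegral hA hR hAR hmeas]
  set e := κ + β / 2 * (1 - τ) with he
  have key : ∀ r : ℝ, μ {ω | (A ω, r) ∈ {p : ℝ × ℝ | |p.1 * p.2 - z| ≤ 2 * √z}} ≤
      ENNReal.ofReal (D * z ^ (-e) * |r| ^ κ) := by
    intro r
    simp only [mem_ofPred_eq]
    rcases le_or_gt r 0 with hr | hr
    · rw [measure_eq_zero_iff_ae_notMem.2]
      · exact zero_le
      · filter_upwards [hA0] with ω hω
        simp only [not_le]
        rw [abs_of_neg (by nlinarith)]
        nlinarith
    rw [ENNReal.le_ofReal_iff_toReal_le (measure_ne_top _ _) (by positivity)]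
    have hsub : ∀ ω, 0 < A ω → |A ω * r - z| ≤ 2 * √z →
        (1 - η) * (z / r) ≤ A ω ∧ A ω ≤ (1 + η) * (z / r) := by
      intro ω hω h
      rw [abs_le, hzη] at h
      constructor
      · rw [← mul_div_assoc, div_le_iff₀ hr]; linarith
      · rw [← mul_div_assoc, le_div_iff₀ hr]; linarith
    have hzr : 0 < z / r := by positivity
    have b1 : (μ {ω | |A ω * r - z| ≤ 2 * √z}).toReal ≤ (C * 8 ^ β) * z ^ (-(β / 2)) := by
      have h4 : 4 * η ∈ Ioc 0 h₀ := by
        refine ⟨by positivity, ?_⟩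
        rw [hη, ← mul_div_assoc, div_le_iff₀ (by linarith)]
        rw [div_le_iff₀ hh₀] at hsh
        linarith
      have h5 := hcond _ h4 (Real.log (z / r) - 3 * η)
      have h6 : C * (4 * η) ^ β = (C * 8 ^ β) * z ^ (-(β / 2)) := by
        rw [hη, show 4 * (2 / √z) = 8 * (√z)⁻¹ by ring, Real.mul_rpow (by norm_num) (by positivity),
          Real.sqrt_eq_rpow, ← Real.rpow_neg hz0.le, ← Real.rpow_mul hz0.le]
        ring_nf
      rw [← h6]
      refine le_trans ?_ h5
      refine ENNReal.toReal_mono (measure_ne_top _ _) (measure_mono_ae ?_)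
      filter_upwards [hA0] with ω hω h
      obtain ⟨h7, h8⟩ := hsub ω hω h
      have h9 := Real.log_le_log (by nlinarith) h7
      have h10 := Real.log_le_log hω h8
      rw [Real.log_mul (by linarith) hzr.ne'] at h9
      rw [Real.log_mul (by linarith) hzr.ne'] at h10
      have h11 := Real.log_le_sub_one_of_pos (x := 1 + η) (by linarith)
      have h12 := Real.one_sub_inv_le_log_of_pos (x := 1 - η) (by linarith)
      have h13 : (1 - η)⁻¹ < 1 + 3 * η := by
        rw [inv_lt_iff_one_lt_mul₀ (by linarith)]
        nlinarith
      exact ⟨by linarith, by linarith⟩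
    have b2 : (μ {ω | |A ω * r - z| ≤ 2 * √z}).toReal ≤ (m * 2 ^ γ) * (r / z) ^ γ := by
      have h5 := mul_meas_ge_le_integral_of_nonneg (μ := μ) (f := fun ω => A ω ^ γ)
        (by filter_upwards [hA0] with ω hω using by simp only [Pi.zero_apply]; positivity) hAγ
        ((z / r / 2) ^ γ)
      have h6 : (μ {ω | |A ω * r - z| ≤ 2 * √z}).toReal ≤
          μ.real {ω | (z / r / 2) ^ γ ≤ A ω ^ γ} := by
        refine ENNReal.toReal_mono (measure_ne_top _ _) (measure_mono_ae ?_)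
        filter_upwards [hA0] with ω hω h
        obtain ⟨h7, -⟩ := hsub ω hω h
        refine Real.rpow_le_rpow (by positivity) (le_trans ?_ h7) hγ.le
        nlinarith
      refine h6.trans ?_
      have h7 : (m * 2 ^ γ) * (r / z) ^ γ = m / (z / r / 2) ^ γ := by
        rw [eq_div_iff (by positivity), mul_assoc, mul_assoc, ← Real.mul_rpow (by positivity)
          (by positivity), ← Real.mul_rpow (by norm_num) (by positivity)]
        rw [show 2 * (r / z * (z / r / 2)) = 1 by field_simp]
        simp
      rw [h7, le_div_iff₀ (by positivity)]
      linarith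
    refine (le_rpow_mul_rpow_of_le ENNReal.toReal_nonneg b1 b2 hτ0.le hτ1.le).trans_eq ?_
    rw [Real.mul_rpow (x := C * 8 ^ β) (by positivity) (by positivity),
      Real.mul_rpow (x := m * 2 ^ γ) (by positivity) (by positivity), ← Real.rpow_mul hz0.le,
      ← Real.rpow_mul (by positivity), hτ, mul_div_cancel₀ _ hγ.ne',
      Real.div_rpow hr.le hz0.le, abs_of_pos hr, ← hτ, hD, div_eq_mul_inv (r ^ κ),
      ← Real.rpow_neg hz0.le, show -e = -(β / 2) * (1 - τ) + -κ by rw [he]; ring,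
      Real.rpow_add hz0]
    ring
  refine (lintegral_mono fun ω => key (R ω)).trans_eq ?_
  rw [← ofReal_integral_eq_lintegral_ofReal (hRκ.const_mul _)
    (Eventually.of_forall fun ω => by positivity), integral_const_mul]
  congr 1
  ring

/-- The power `w₊ ^ α` truncated at level `x`. -/
def truncPow (α x w : ℝ) : ℝ := (min (max w 0) x) ^ α

lemma measurable_truncPow (α x : ℝ) : Measurable (truncPow α x) := by
  unfold truncPow; fun_prop

lemma truncPow_nonneg {α x : ℝ} (hx : 0 ≤ x) (w : ℝ) : 0 ≤ truncPow α x w :=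
  Real.rpow_nonneg (le_min (le_max_right _ _) hx) _

lemma truncPow_le {α x : ℝ} (hα : 0 < α) (hx : 0 ≤ x) (w : ℝ) : truncPow α x w ≤ x ^ α :=
  Real.rpow_le_rpow (le_min (le_max_right _ _) hx) (min_le_right _ _) hα.le

lemma truncPow_le_abs_rpow {α x : ℝ} (hα : 0 < α) (hx : 0 ≤ x) (w : ℝ) :
    truncPow α x w ≤ |w| ^ α :=
  Real.rpow_le_rpow (le_min (le_max_right _ _) hx)
    ((min_le_left _ _).trans (max_le (le_abs_self w) (abs_nonneg w))) hα.le

lemma truncPow_of_le {α x w : ℝ} (hx : 0 ≤ x) (h : w ≤ x) : truncPow α x w = max w 0 ^ α := by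
  rw [truncPow, min_eq_left (max_le h hx)]

lemma rpow_sub_rpow_le {α θ u v : ℝ} (hα : 0 < α) (hθ0 : 0 ≤ θ) (hθ1 : θ ≤ 1) (hv : 0 ≤ v)
    (hvu : v ≤ u) : u ^ α - v ^ α ≤ (1 + α) * u ^ (α - θ) * (u - v) ^ θ := by
  rcases (hv.trans hvu).eq_or_lt with rfl | hu
  · obtain rfl : v = 0 := le_antisymm hvu hv
    rw [sub_self]
    positivity
  have ht0 : 0 ≤ (u - v) / u := div_nonneg (by linarith) hu.le
  have ht1 : (u - v) / u ≤ 1 := by rw [div_le_one hu]; linarith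
  set t := (u - v) / u with ht
  have hvt : v = u * (1 - t) := by rw [ht]; field_simp; ring
  have huv : u - v = u * t := by rw [ht]; field_simp
  have h1 : 1 - (1 - t) ^ α ≤ (1 + α) * t := by
    rcases le_total 1 α with h | h
    · have := one_add_mul_self_le_rpow_one_add (s := -t) (by linarith) h
      rw [← sub_eq_add_neg] at this
      nlinarith
    · have := Real.rpow_le_rpow_of_exponent_ge' (x := 1 - t) (by linarith) (by linarith) hα.le h
      rw [Real.rpow_one] at this
      nlinarith
  have h2 : t ≤ t ^ θ := by
    have := Real.rpow_le_rpow_of_exponent_ge' ht0 ht1 hθ0 hθ1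
    rwa [Real.rpow_one] at this
  rw [huv, hvt, Real.mul_rpow hu.le (by linarith), Real.mul_rpow hu.le ht0]
  have h3 : u ^ α = u ^ (α - θ) * u ^ θ := by rw [← Real.rpow_add hu]; ring_nf
  calc u ^ α - u ^ α * (1 - t) ^ α = u ^ α * (1 - (1 - t) ^ α) := by ring
    _ ≤ u ^ α * ((1 + α) * t ^ θ) := by gcongr; nlinarith
    _ = _ := by rw [h3]; ring

lemma abs_truncPow_sub_le {α θ x : ℝ} (hα : 0 < α) (hθ0 : 0 ≤ θ) (hθ1 : θ ≤ 1) (hθα : θ ≤ α)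
    (hx : 0 ≤ x) {v w M : ℝ} (hv : |v| ≤ M) (hw : |w| ≤ M) :
    |truncPow α x v - truncPow α x w| ≤ (1 + α) * M ^ (α - θ) * |v - w| ^ θ := by
  wlog h : w ≤ v generalizing v w
  · rw [abs_sub_comm, abs_sub_comm v]
    exact this hw hv (le_of_not_ge h)
  have h1 : min (max w 0) x ≤ min (max v 0) x := by gcongr
  have h0 : 0 ≤ min (max w 0) x := le_min (le_max_right _ _) hx
  have h2 : min (max v 0) x ≤ M :=
    (min_le_left _ _).trans ((max_le (le_abs_self v) (abs_nonneg v)).trans hv)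
  have h3 : min (max v 0) x - min (max w 0) x ≤ |v - w| := by
    refine (le_abs_self _).trans ((abs_min_sub_min_le_max _ _ _ _).trans ?_)
    rw [sub_self, abs_zero, max_eq_left (abs_nonneg _)]
    exact (abs_max_sub_max_le_abs _ _ _)
  unfold truncPow
  rw [abs_of_nonneg (sub_nonneg.2 (Real.rpow_le_rpow h0 h1 hα.le))]
  refine (rpow_sub_rpow_le hα hθ0 hθ1 h0 h1).trans ?_
  have h4 : 0 ≤ min (max v 0) x - min (max w 0) x := sub_nonneg.2 h1
  have h5 := h0.trans h1
  have h6 : 0 ≤ α - θ := by linarith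
  have h7 : 0 ≤ M := h5.trans h2
  gcongr

lemma abs_truncPow_add_sub_sub_le {α θ x : ℝ} (hα : 0 < α) (hθ0 : 0 ≤ θ) (hθ1 : θ ≤ 1)
    (hθα : θ ≤ α) (hx : 0 ≤ x) (a b : ℝ) :
    |truncPow α x (a + b) - truncPow α x a - truncPow α x b| ≤
      ((1 + α) * 2 ^ α + 1) * (|a| ^ (α - θ) * |b| ^ θ + |b| ^ (α - θ) * |a| ^ θ) := by
  wlog h : |b| ≤ |a| generalizing a b
  · have := this b a (le_of_not_ge h)
    rw [add_comm b a] at this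
    rw [sub_right_comm, add_comm (|a| ^ (α - θ) * |b| ^ θ)]
    exact this
  have hab : |a + b| ≤ 2 * |a| := (abs_add_le a b).trans (by linarith)
  have h1 := abs_truncPow_sub_le hα hθ0 hθ1 hθα hx hab (w := a) (by linarith [abs_nonneg a])
  rw [add_sub_cancel_left, Real.mul_rpow (by norm_num) (abs_nonneg a)] at h1
  have h2 : (2:ℝ) ^ (α - θ) ≤ 2 ^ α :=
    Real.rpow_le_rpow_of_exponent_le (by norm_num) (by linarith)
  have h3 : truncPow α x b ≤ |a| ^ (α - θ) * |b| ^ θ := by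
    refine (truncPow_le_abs_rpow hα hx b).trans ?_
    have h4 : |b| ^ α = |b| ^ (α - θ) * |b| ^ θ := by
      rw [← Real.rpow_add_of_nonneg (abs_nonneg b) (by linarith) hθ0]; ring_nf
    rw [h4]
    have h6 : 0 ≤ α - θ := by linarith
    gcongr
  have h5 := truncPow_nonneg (α := α) hx b
  calc |truncPow α x (a + b) - truncPow α x a - truncPow α x b|
      ≤ |truncPow α x (a + b) - truncPow α x a| + |truncPow α x b| := abs_sub _ _
    _ ≤ (1 + α) * (2 ^ α * |a| ^ (α - θ)) * |b| ^ θ + |a| ^ (α - θ) * |b| ^ θ := by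
        rw [abs_of_nonneg h5]
        refine add_le_add (h1.trans ?_) h3
        gcongr
    _ = ((1 + α) * 2 ^ α + 1) * (|a| ^ (α - θ) * |b| ^ θ) := by ring
    _ ≤ _ := by
        have : 0 ≤ |b| ^ (α - θ) * |a| ^ θ := by positivity
        gcongr
        linarith

lemma integral_truncPow_eq {Ω : Type*} [MeasurableSpace Ω] {μ : Measure Ω}
    [IsProbabilityMeasure μ] {B : Ω → ℝ} (hB : Measurable B) {α x : ℝ} (hα : 0 < α)
    (hx : 0 < x) {L : ℝ → ℝ} (hL : ∀ x, L x = x ^ α * (μ {ω | x < B ω}).toReal) :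
    ∫ t in Ioc 0 x, L t / t = (∫ ω, truncPow α x (B ω) ∂μ) / α := by
  have h1 := lintegral_rpow_eq_lintegral_meas_lt_mul (μ := μ) (f := fun ω => min (max (B ω) 0) x)
    (Eventually.of_forall fun ω => le_min (le_max_right _ _) hx.le) (by fun_prop) hα
  have hanti : Measurable fun t => μ {ω | t < B ω} :=
    Antitone.measurable fun s t hst => measure_mono fun ω (hω : t < B ω) => lt_of_le_of_lt hst hω
  rw [integral_eq_lintegral_of_nonneg_ae, integral_eq_lintegral_of_nonneg_ae]
  · change _ = (∫⁻ ω, ENNReal.ofReal (min (max (B ω) 0) x ^ α) ∂μ).toReal / α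
    rw [h1, ENNReal.toReal_mul, ENNReal.toReal_ofReal hα.le, mul_div_cancel_left₀ _ hα.ne']
    congr 1
    rw [← lintegral_indicator measurableSet_Ioc, ← lintegral_indicator measurableSet_Ioi]
    refine lintegral_congr_ae ?_
    filter_upwards [Measure.ae_ne volume x] with t ht
    by_cases h0 : 0 < t
    · rw [indicator_of_mem (show t ∈ Ioi 0 from h0)]
      rcases lt_or_gt_of_ne ht with h | h
      · rw [indicator_of_mem (show t ∈ Ioc 0 x from ⟨h0, h.le⟩)]
        have : {ω | t < min (max (B ω) 0) x} = {ω | t < B ω} := by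
          ext ω; simp [h, h0.not_gt]
        rw [this, hL, ← ENNReal.ofReal_toReal (measure_ne_top μ {ω | t < B ω}),
          ← ENNReal.ofReal_mul ENNReal.toReal_nonneg, ENNReal.toReal_ofReal ENNReal.toReal_nonneg,
          Real.rpow_sub_one h0.ne']
        congr 1
        ring
      · rw [indicator_of_notMem (show t ∉ Ioc 0 x from fun h' => h.not_ge h'.2)]
        have : {ω | t < min (max (B ω) 0) x} = ∅ := by
          ext ω; simp [h.le]
        rw [this, measure_empty, zero_mul]
    · rw [indicator_of_notMem (show t ∉ Ioc 0 x from fun h' => h0 h'.1),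
        indicator_of_notMem (show t ∉ Ioi 0 from h0)]
  · exact Eventually.of_forall fun ω => truncPow_nonneg hx.le _
  · exact ((measurable_truncPow α x).comp hB).aestronglyMeasurable
  · filter_upwards [ae_restrict_mem measurableSet_Ioc] with t ht
    have := ht.1
    simp only [Pi.zero_apply]
    rw [hL]
    positivity
  · simp_rw [hL]
    have := hanti.ennreal_toReal
    exact Measurable.aestronglyMeasurable (by fun_prop)

lemma integrable_truncPow_comp {Ω : Type*} [MeasurableSpace Ω] {μ : Measure Ω}
    [IsProbabilityMeasure μ] {X : Ω → ℝ} (hX : Measurable X) {α x : ℝ} (hα : 0 < α)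
    (hx : 0 ≤ x) : Integrable (fun ω => truncPow α x (X ω)) μ := by
  refine (integrable_const (x ^ α)).mono' ((measurable_truncPow α x).comp hX).aestronglyMeasurable
    (Eventually.of_forall fun ω => ?_)
  rw [Real.norm_eq_abs, abs_of_nonneg (truncPow_nonneg hx _)]
  exact truncPow_le hα hx _

/-- Removing the truncation in the defect of additivity of `w ↦ w₊ ^ α`. -/
lemma tendsto_integral_truncPow_add_sub_sub {Ω : Type*} [MeasurableSpace Ω] {μ : Measure Ω}
    {X Y : Ω → ℝ} (hX : Measurable X) (hY : Measurable Y) {α θ : ℝ} (hα : 0 < α)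
    (hθ0 : 0 ≤ θ) (hθ1 : θ ≤ 1) (hθα : θ ≤ α)
    (h1 : Integrable (fun ω => |X ω| ^ (α - θ) * |Y ω| ^ θ) μ)
    (h2 : Integrable (fun ω => |X ω| ^ θ * |Y ω| ^ (α - θ)) μ) :
    Integrable (fun ω => max (X ω + Y ω) 0 ^ α - max (X ω) 0 ^ α - max (Y ω) 0 ^ α) μ ∧
    Tendsto (fun x => ∫ ω, (truncPow α x (X ω + Y ω) - truncPow α x (X ω) -
      truncPow α x (Y ω)) ∂μ) atTop
      (nhds (∫ ω, (max (X ω + Y ω) 0 ^ α - max (X ω) 0 ^ α - max (Y ω) 0 ^ α) ∂μ)) := by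
  set D := fun ω => ((1 + α) * 2 ^ α + 1) * (|X ω| ^ (α - θ) * |Y ω| ^ θ +
    |Y ω| ^ (α - θ) * |X ω| ^ θ)
  have hD : Integrable D μ := by
    refine Integrable.const_mul (h1.add (h2.congr (Eventually.of_forall fun ω => ?_))) _
    simp only [mul_comm]
  have hlim : ∀ ω, ∀ᶠ x in atTop, truncPow α x (X ω + Y ω) - truncPow α x (X ω) -
      truncPow α x (Y ω) = max (X ω + Y ω) 0 ^ α - max (X ω) 0 ^ α - max (Y ω) 0 ^ α := by
    intro ω
    filter_upwards [eventually_ge_atTop 0, eventually_ge_atTop (X ω + Y ω),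
      eventually_ge_atTop (X ω), eventually_ge_atTop (Y ω)] with x h0 h3 h4 h5
    rw [truncPow_of_le h0 h3, truncPow_of_le h0 h4, truncPow_of_le h0 h5]
  have hb : ∀ x ≥ 0, ∀ ω, ‖truncPow α x (X ω + Y ω) - truncPow α x (X ω) -
      truncPow α x (Y ω)‖ ≤ D ω := fun x hx ω =>
    abs_truncPow_add_sub_sub_le hα hθ0 hθ1 hθα hx _ _
  refine ⟨hD.mono' (Measurable.aestronglyMeasurable (by fun_prop)) (Eventually.of_forall fun ω =>
      ?_), tendsto_integral_filter_of_dominated_convergence D ?_ ?_ hD ?_⟩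
  · obtain ⟨x, hx, hx0⟩ := ((hlim ω).and (eventually_ge_atTop 0)).exists
    rw [← hx]
    exact hb x hx0 ω
  · refine Eventually.of_forall fun x => Measurable.aestronglyMeasurable ?_
    have := measurable_truncPow α x
    fun_prop
  · filter_upwards [eventually_ge_atTop 0] with x hx
    exact Eventually.of_forall fun ω => hb x hx ω
  · exact Eventually.of_forall fun ω => tendsto_const_nhds.congr' ((hlim ω).mono fun _ h => h.symm)

/-- Integrated oscillation of the renewal tail over windows of square-root width. -/
lemma exists_setLIntegral_renewalTail_sub_le {Ω : Type*} [MeasurableSpace Ω] {μ : Measure Ω}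
    [IsProbabilityMeasure μ] {ν : Measure ℝ} [IsProbabilityMeasure ν] {X : Ω → ℝ}
    (hX : Measurable X) {α s C K₁ z₀ : ℝ} (hC : 0 ≤ C) (hK₁ : 0 ≤ K₁)
    (hfin : ∀ y, renewalMeasure ν (Ioi y) < ⊤)
    (hP : ∀ z ≥ z₀, μ {ω | |X ω - z| ≤ 2 * √z} ≤ ENNReal.ofReal (C * z ^ (-s)))
    (hU : ∀ y, ∫⁻ v in Iic y, ENNReal.ofReal (Real.exp (s * v)) ∂(renewalMeasure ν) ≤
      ENNReal.ofReal (K₁ * Real.exp ((s - α) * y))) :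
    ∃ C' ≥ 0, ∀ K, 4 ≤ K → 2 * z₀ ≤ K → ∀ x > 0,
      ∫⁻ ω in {ω | K < X ω}, ENNReal.ofReal (renewalTail ν ((X ω + √(X ω)) / x) -
        renewalTail ν ((X ω - √(X ω)) / x)) ∂μ ≤
      ENNReal.ofReal (C' * K ^ (-(s - α)) * x ^ (-α)) := by
  refine ⟨C * K₁ * 2 ^ (s - α), by positivity, fun K hK4 hKz x hx => ?_⟩
  have hK0 : 0 < K := by linarith
  set T : Set (ℝ × ℝ) := {p | K / 2 ≤ x * Real.exp (-p.2) ∧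
    |p.1 - x * Real.exp (-p.2)| ≤ 2 * √(x * Real.exp (-p.2))} with hT
  have hTm : MeasurableSet T :=
    MeasurableSet.inter
      (measurableSet_le (f := fun _ => K / 2) (g := fun p : ℝ × ℝ => x * Real.exp (-p.2))
        (by fun_prop) (by fun_prop))
      (measurableSet_le (f := fun p : ℝ × ℝ => |p.1 - x * Real.exp (-p.2)|)
        (g := fun p : ℝ × ℝ => 2 * √(x * Real.exp (-p.2))) (by fun_prop) (by fun_prop))
  have hTm' : MeasurableSet {p : Ω × ℝ | (X p.1, p.2) ∈ T} :=
    (show Measurable fun p : Ω × ℝ => (X p.1, p.2) by fun_prop) hTm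
  have h1 : ∀ ω, K < X ω → ENNReal.ofReal (renewalTail ν ((X ω + √(X ω)) / x) -
      renewalTail ν ((X ω - √(X ω)) / x)) ≤ renewalMeasure ν {u | (X ω, u) ∈ T} := by
    intro ω hω
    rw [ENNReal.ofReal_sub _ (renewalTail_nonneg _ _), ofReal_renewalTail hfin,
      ofReal_renewalTail hfin]
    refine le_measure_sdiff.trans (measure_mono ?_)
    rintro u ⟨hu1, hu2⟩
    simp only [mem_ofPred_eq, not_lt] at hu1 hu2
    set a := X ω
    have ha : 4 < a := by linarith
    have hsq : √a * √a = a := Real.mul_self_sqrt (by linarith)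
    have hs2 : 2 ≤ √a := Real.le_sqrt_of_sq_le (by linarith)
    have hz : 0 < x * Real.exp (-u) := by positivity
    have hxe : x = x * Real.exp (-u) * Real.exp u := by
      rw [mul_assoc, ← Real.exp_add]; simp
    have hE := Real.exp_pos u
    have g1 : x * Real.exp (-u) < a + √a := by
      rw [← mul_div_assoc, lt_div_iff₀ hx, one_mul] at hu1
      nlinarith
    have g2 : a - √a ≤ x * Real.exp (-u) := by
      rw [← mul_div_assoc, div_le_iff₀ hx, one_mul] at hu2
      refine le_of_mul_le_mul_left ?_ hE
      linarith
    set z := x * Real.exp (-u)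
    have g3 : a ≤ 2 * z := by nlinarith
    have g4 : √a ≤ 2 * √z := by
      refine Real.sqrt_le_iff.2 ⟨by positivity, ?_⟩
      rw [mul_pow, Real.sq_sqrt hz.le]
      linarith
    refine ⟨by change K / 2 ≤ z; linarith, ?_⟩
    change |a - z| ≤ 2 * √z
    rw [abs_le]
    constructor <;> linarith
  have hslice : ∀ u, μ {ω | (X ω, u) ∈ T} ≤ (Iic (Real.log (2 * x / K))).indicator
      (fun u => ENNReal.ofReal (C * x ^ (-s)) * ENNReal.ofReal (Real.exp (s * u))) u := by
    intro u
    by_cases hu : K / 2 ≤ x * Real.exp (-u)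
    · have hu' : u ∈ Iic (Real.log (2 * x / K)) := by
        rw [mem_Iic, Real.le_log_iff_exp_le (by positivity), le_div_iff₀ hK0]
        rw [Real.exp_neg, ← div_eq_mul_inv, div_le_div_iff₀ (by norm_num) (Real.exp_pos u)] at hu
        linarith
      rw [indicator_of_mem hu', ← ENNReal.ofReal_mul (by positivity)]
      refine (measure_mono fun ω hω => ?_).trans ((hP (x * Real.exp (-u)) (by linarith)).trans_eq ?_)
      · exact hω.2
      · rw [Real.mul_rpow hx.le (Real.exp_nonneg _), ← Real.exp_mul, mul_assoc]
        ring_nf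
    · have : {ω | (X ω, u) ∈ T} = ∅ := by
        ext ω
        simp only [hT, mem_ofPred_eq, mem_empty_iff_false, iff_false]
        exact fun h => hu h.1
      rw [this, measure_empty]
      exact zero_le
  calc ∫⁻ ω in {ω | K < X ω}, ENNReal.ofReal (renewalTail ν ((X ω + √(X ω)) / x) -
        renewalTail ν ((X ω - √(X ω)) / x)) ∂μ
      ≤ ∫⁻ ω in {ω | K < X ω}, renewalMeasure ν {u | (X ω, u) ∈ T} ∂μ :=
        setLIntegral_mono' (measurableSet_lt measurable_const hX) h1
    _ ≤ ∫⁻ ω, renewalMeasure ν {u | (X ω, u) ∈ T} ∂μ := setLIntegral_le_lintegral _ _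
    _ = ∫⁻ u, μ {ω | (X ω, u) ∈ T} ∂(renewalMeasure ν) :=
        (Measure.prod_apply (μ := μ) (ν := renewalMeasure ν) hTm').symm.trans
          (Measure.prod_apply_symm hTm')
    _ ≤ ∫⁻ u, (Iic (Real.log (2 * x / K))).indicator (fun u => ENNReal.ofReal (C * x ^ (-s)) *
          ENNReal.ofReal (Real.exp (s * u))) u ∂(renewalMeasure ν) := lintegral_mono hslice
    _ = ENNReal.ofReal (C * x ^ (-s)) * ∫⁻ u in Iic (Real.log (2 * x / K)),
          ENNReal.ofReal (Real.exp (s * u)) ∂(renewalMeasure ν) := by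
        rw [lintegral_indicator measurableSet_Iic, lintegral_const_mul _ (by fun_prop)]
    _ ≤ ENNReal.ofReal (C * x ^ (-s)) * ENNReal.ofReal (K₁ * Real.exp ((s - α) *
          Real.log (2 * x / K))) := by gcongr; exact hU _
    _ = _ := by
        rw [← ENNReal.ofReal_mul (by positivity), mul_comm (s - α), Real.exp_mul,
          Real.exp_log (by positivity), Real.div_rpow (by positivity) hK0.le,
          Real.mul_rpow (by norm_num) hx.le, Real.rpow_neg hK0.le, Real.rpow_sub hx,
          Real.rpow_neg hx.le, Real.rpow_neg hx.le]
        congr 1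
        field_simp

/-- The envelope of the remainder in the renewal tail, at scale `x`. -/
def tailEnvelope (α r x t : ℝ) : ℝ := x ^ α * min ((t / x) ^ (α / 2)) ((t / x) ^ (α + r))

lemma measurable_tailEnvelope (α r x : ℝ) : Measurable (tailEnvelope α r x) := by
  unfold tailEnvelope; fun_prop

lemma tailEnvelope_nonneg {α r x t : ℝ} (hx : 0 < x) (ht : 0 ≤ t) : 0 ≤ tailEnvelope α r x t := by
  unfold tailEnvelope; positivity

lemma tailEnvelope_mono {α r x t s : ℝ} (hα : 0 < α) (hr : 0 < r) (hx : 0 < x) (ht : 0 ≤ t)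
    (hts : t ≤ s) : tailEnvelope α r x t ≤ tailEnvelope α r x s := by
  unfold tailEnvelope
  gcongr

lemma tailEnvelope_le_rpow {α r x t : ℝ} (hα : 0 < α) (hr : 0 < r) (hx : 0 < x) (ht : 0 ≤ t) :
    tailEnvelope α r x t ≤ t ^ α := by
  have h : min ((t / x) ^ (α / 2)) ((t / x) ^ (α + r)) ≤ (t / x) ^ α := by
    rcases le_total (t / x) 1 with h | h
    · exact (min_le_right _ _).trans
        (Real.rpow_le_rpow_of_exponent_ge' (by positivity) h hα.le (by linarith))
    · exact (min_le_left _ _).trans (Real.rpow_le_rpow_of_exponent_le h (by linarith))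
  calc tailEnvelope α r x t ≤ x ^ α * (t / x) ^ α := by unfold tailEnvelope; gcongr
    _ = t ^ α := by
      rw [Real.div_rpow ht hx.le, mul_div_cancel₀ _ (by positivity)]

lemma tailEnvelope_le_mul_rpow_neg {α r x t : ℝ} (hx : 0 < x) (ht : 0 ≤ t) :
    tailEnvelope α r x t ≤ t ^ (α + r) * x ^ (-r) := by
  calc tailEnvelope α r x t ≤ x ^ α * (t / x) ^ (α + r) := by
        unfold tailEnvelope; gcongr; exact min_le_right _ _
    _ = t ^ (α + r) * x ^ (-r) := by
      rw [Real.div_rpow ht hx.le, Real.rpow_neg hx.le, Real.rpow_add hx]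
      field_simp

lemma tendsto_tailEnvelope {α r t : ℝ} (hr : 0 < r) (ht : 0 ≤ t) :
    Tendsto (fun x => tailEnvelope α r x t) atTop (nhds 0) := by
  have h : Tendsto (fun x : ℝ => t ^ (α + r) * x ^ (-r)) atTop (nhds 0) := by
    simpa using (tendsto_rpow_neg_atTop hr).const_mul (t ^ (α + r))
  refine tendsto_of_tendsto_of_tendsto_of_le_of_le' tendsto_const_nhds h ?_ ?_
  · filter_upwards [eventually_gt_atTop 0] with x hx using tailEnvelope_nonneg hx ht
  · filter_upwards [eventually_gt_atTop 0] with x hx using tailEnvelope_le_mul_rpow_neg hx ht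

/-- The scaled remainder in the renewal tail. -/
def tailRemainder (Q : ℝ → ℝ) (α c x w : ℝ) : ℝ := x ^ α * Q (w / x) - c * truncPow α x w

lemma abs_tailRemainder_le {Q : ℝ → ℝ} {α c r C x : ℝ} (hα : 0 < α) (hr : 0 < r)
    (hx : 0 < x) (hQ0 : ∀ w ≤ 0, Q w = 0)
    (hQ : ∀ w > 0, |Q w - c * (min w 1) ^ α| ≤ C * min (w ^ (α / 2)) (w ^ (α + r))) (w : ℝ) :
    |tailRemainder Q α c x w| ≤ C * tailEnvelope α r x (max w 0) := by
  rcases le_or_gt w 0 with hw | hw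
  · have h1 : w / x ≤ 0 := div_nonpos_of_nonpos_of_nonneg hw hx.le
    rw [tailRemainder, hQ0 _ h1, truncPow, tailEnvelope, max_eq_right hw, min_eq_left hx.le,
      zero_div, Real.zero_rpow hα.ne', Real.zero_rpow (by positivity : α / 2 ≠ 0),
      Real.zero_rpow (by positivity : α + r ≠ 0)]
    simp
  · have h1 := hQ (w / x) (by positivity)
    have h2 : truncPow α x w = x ^ α * (min (w / x) 1) ^ α := by
      rw [truncPow, max_eq_left hw.le, ← Real.mul_rpow hx.le (le_min (by positivity) zero_le_one),
        mul_min_of_nonneg _ _ hx.le, mul_one, mul_div_cancel₀ _ hx.ne']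
    rw [tailRemainder, h2, tailEnvelope, max_eq_left hw.le,
      show x ^ α * Q (w / x) - c * (x ^ α * min (w / x) 1 ^ α) =
        x ^ α * (Q (w / x) - c * min (w / x) 1 ^ α) by ring, abs_mul,
      abs_of_pos (by positivity : 0 < x ^ α)]
    calc x ^ α * |Q (w / x) - c * min (w / x) 1 ^ α|
        ≤ x ^ α * (C * min ((w / x) ^ (α / 2)) ((w / x) ^ (α + r))) := by gcongr
      _ = _ := by ring

/-- Pointwise control of the increments of the scaled remainder. -/
lemma abs_tailRemainder_add_sub_le {Q : ℝ → ℝ} {α c r C θ x K : ℝ} (hα : 0 < α) (hr : 0 < r)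
    (hC : 0 ≤ C) (hc : 0 ≤ c) (hθ0 : 0 < θ) (hθ1 : θ ≤ 1) (hθα : θ ≤ α)
    (hx : 0 < x) (hK : 4 ≤ K) (hmono : Monotone Q) (hQ0 : ∀ w ≤ 0, Q w = 0)
    (hQ : ∀ w > 0, |Q w - c * (min w 1) ^ α| ≤ C * min (w ^ (α / 2)) (w ^ (α + r))) (a b : ℝ) :
    |tailRemainder Q α c x (a + b) - tailRemainder Q α c x a| ≤
      2 * C * tailEnvelope α r x (2 * max b 0) + 2 * C * tailEnvelope α r x (2 * K) +
      2 * C * (if √(max a 0) < |b| then tailEnvelope α r x (2 * max a 0) else 0) +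
      c * (1 + α) * 2 ^ α * K ^ (-(θ / 4)) * |a| ^ (α - θ / 4) +
      (if K < a then x ^ α * (Q ((a + √a) / x) - Q ((a - √a) / x)) else 0) := by
  have hb0 : 0 ≤ max b 0 := le_max_right _ _
  have ha0 : 0 ≤ max a 0 := le_max_right _ _
  have t1 : 0 ≤ 2 * C * tailEnvelope α r x (2 * max b 0) :=
    mul_nonneg (by positivity) (tailEnvelope_nonneg hx (by positivity))
  have t2 : 0 ≤ 2 * C * tailEnvelope α r x (2 * K) :=
    mul_nonneg (by positivity) (tailEnvelope_nonneg hx (by positivity))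
  have t3 : 0 ≤ 2 * C * (if √(max a 0) < |b| then tailEnvelope α r x (2 * max a 0) else 0) := by
    refine mul_nonneg (by positivity) ?_
    split_ifs
    · exact tailEnvelope_nonneg hx (by positivity)
    · exact le_rfl
  have t4 : 0 ≤ c * (1 + α) * 2 ^ α * K ^ (-(θ / 4)) * |a| ^ (α - θ / 4) := by
    have : 0 < K := by linarith
    positivity
  have hosc : Q ((a - √a) / x) ≤ Q ((a + √a) / x) := by
    refine hmono ?_
    gcongr
    linarith [Real.sqrt_nonneg a]
  have t5 : 0 ≤ (if K < a then x ^ α * (Q ((a + √a) / x) - Q ((a - √a) / x)) else 0) := by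
    split_ifs
    · exact mul_nonneg (by positivity) (by linarith)
    · exact le_rfl
  have hbd := abs_tailRemainder_le (c := c) (C := C) hα hr hx hQ0 hQ
  have hcommon : ∀ t, max (a + b) 0 ≤ t → max a 0 ≤ t →
      |tailRemainder Q α c x (a + b) - tailRemainder Q α c x a| ≤
        2 * C * tailEnvelope α r x t := by
    intro t h1 h2
    have h3 := tailEnvelope_mono hα hr hx (le_max_right _ _) h1
    have h4 := tailEnvelope_mono hα hr hx (le_max_right _ _) h2
    have h5 := mul_le_mul_of_nonneg_left h3 hC
    have h6 := mul_le_mul_of_nonneg_left h4 hC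
    have h7 := abs_sub (tailRemainder Q α c x (a + b)) (tailRemainder Q α c x a)
    linarith [hbd (a + b), hbd a]
  rcases le_or_gt a b with hab | hab
  · have h1 : b ≤ max b 0 := le_max_left _ _
    have := hcommon (2 * max b 0) (max_le (by linarith) (by linarith))
      (max_le (by linarith) (by linarith))
    linarith
  have h1 : a ≤ max a 0 := le_max_left _ _
  rcases le_or_gt a K with haK | haK
  · have := hcommon (2 * K) (max_le (by linarith) (by linarith))
      (max_le (by linarith) (by linarith))
    linarith
  by_cases hsq : √(max a 0) < |b|
  · have := hcommon (2 * max a 0) (max_le (by linarith) (by linarith))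
      (max_le (by linarith) (by linarith))
    rw [if_pos hsq] at t3 ⊢
    linarith
  have hapos : 0 < a := by linarith
  rw [max_eq_left hapos.le, not_lt] at hsq
  have hsa : √a * √a = a := Real.mul_self_sqrt hapos.le
  have hs2 : 2 ≤ √a := Real.le_sqrt_of_sq_le (by linarith)
  rw [if_pos haK] at t5 ⊢
  obtain ⟨hb1, hb2⟩ := abs_le.1 hsq
  have hQd : |Q ((a + b) / x) - Q (a / x)| ≤ Q ((a + √a) / x) - Q ((a - √a) / x) := by
    have g1 : Q ((a + b) / x) ≤ Q ((a + √a) / x) := hmono (by gcongr)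
    have g2 : Q ((a - √a) / x) ≤ Q ((a + b) / x) := hmono (by gcongr; linarith)
    have g3 : Q (a / x) ≤ Q ((a + √a) / x) := hmono (by gcongr; linarith)
    have g4 : Q ((a - √a) / x) ≤ Q (a / x) := hmono (by gcongr; linarith)
    rw [abs_le]; constructor <;> linarith
  have hf : |truncPow α x (a + b) - truncPow α x a| ≤
      (1 + α) * 2 ^ α * K ^ (-(θ / 4)) * |a| ^ (α - θ / 4) := by
    have g1 := abs_truncPow_sub_le hα hθ0.le hθ1 hθα hx.le (v := a + b) (w := a) (M := 2 * a)
      (by rw [abs_le]; constructor <;> nlinarith) (by rw [abs_of_pos hapos]; linarith)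
    refine g1.trans ?_
    rw [add_sub_cancel_left, abs_of_pos hapos, Real.mul_rpow (by norm_num) hapos.le]
    have g2 : |b| ^ θ ≤ a ^ (θ / 2) := by
      calc |b| ^ θ ≤ (√a) ^ θ := by gcongr
        _ = a ^ (θ / 2) := by
          rw [Real.sqrt_eq_rpow, ← Real.rpow_mul hapos.le]; ring_nf
    have g3 : (2:ℝ) ^ (α - θ) ≤ 2 ^ α :=
      Real.rpow_le_rpow_of_exponent_le (by norm_num) (by linarith)
    have g4 : a ^ (-(θ / 4)) ≤ K ^ (-(θ / 4)) :=
      Real.rpow_le_rpow_of_nonpos (by linarith) haK.le (by linarith)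
    have g5 : a ^ (α - θ) * a ^ (θ / 2) = a ^ (-(θ / 4)) * a ^ (α - θ / 4) := by
      rw [← Real.rpow_add hapos, ← Real.rpow_add hapos]; ring_nf
    calc (1 + α) * (2 ^ (α - θ) * a ^ (α - θ)) * |b| ^ θ
        ≤ (1 + α) * (2 ^ α * a ^ (α - θ)) * a ^ (θ / 2) := by gcongr
      _ = (1 + α) * 2 ^ α * (a ^ (α - θ) * a ^ (θ / 2)) := by ring
      _ = (1 + α) * 2 ^ α * a ^ (-(θ / 4)) * a ^ (α - θ / 4) := by rw [g5]; ring
      _ ≤ _ := by gcongr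
  have hfin : |tailRemainder Q α c x (a + b) - tailRemainder Q α c x a| ≤
      x ^ α * |Q ((a + b) / x) - Q (a / x)| + c * |truncPow α x (a + b) - truncPow α x a| := by
    unfold tailRemainder
    rw [show x ^ α * Q ((a + b) / x) - c * truncPow α x (a + b) -
        (x ^ α * Q (a / x) - c * truncPow α x a) = x ^ α * (Q ((a + b) / x) - Q (a / x)) -
        c * (truncPow α x (a + b) - truncPow α x a) by ring]
    refine (abs_sub _ _).trans_eq ?_
    rw [abs_mul, abs_mul, abs_of_nonneg hc, abs_of_pos (by positivity : 0 < x ^ α)]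
  have g6 := mul_le_mul_of_nonneg_left hQd (by positivity : 0 ≤ x ^ α)
  have g7 := mul_le_mul_of_nonneg_left hf hc
  linarith

lemma tendsto_integral_ite_tailEnvelope {Ω : Type*} [MeasurableSpace Ω] {μ : Measure Ω}
    {X Y : Ω → ℝ} (hX : Measurable X) (hY : Measurable Y) {α r θ : ℝ} (hα : 0 < α) (hr : 0 < r)
    (hθ0 : 0 < θ) (hθα : θ ≤ α)
    (hXY : Integrable (fun ω => |X ω| ^ (α - θ) * |Y ω| ^ (2 * θ)) μ) :
    (∀ x > 0, Integrable (fun ω => if √(max (X ω) 0) < |Y ω| then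
      tailEnvelope α r x (2 * max (X ω) 0) else 0) μ) ∧
    Tendsto (fun x => ∫ ω, (if √(max (X ω) 0) < |Y ω| then
      tailEnvelope α r x (2 * max (X ω) 0) else 0) ∂μ) atTop (nhds 0) := by
  have hm : ∀ x, Measurable (fun ω => if √(max (X ω) 0) < |Y ω| then
      tailEnvelope α r x (2 * max (X ω) 0) else 0) := fun x =>
    Measurable.ite (measurableSet_lt (by fun_prop) (by fun_prop))
      ((measurable_tailEnvelope α r x).comp (by fun_prop)) measurable_const
  have hb : ∀ x > 0, ∀ ω, ‖if √(max (X ω) 0) < |Y ω| then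
      tailEnvelope α r x (2 * max (X ω) 0) else 0‖ ≤
      2 ^ α * (|X ω| ^ (α - θ) * |Y ω| ^ (2 * θ)) := by
    intro x hx ω
    have h0 : 0 ≤ max (X ω) 0 := le_max_right _ _
    split_ifs with h
    · rw [Real.norm_eq_abs, abs_of_nonneg (tailEnvelope_nonneg hx (by positivity))]
      refine (tailEnvelope_le_rpow hα hr hx (by positivity)).trans ?_
      rw [Real.mul_rpow (by norm_num) h0]
      have h1 : max (X ω) 0 ^ α = max (X ω) 0 ^ (α - θ) * max (X ω) 0 ^ θ := by
        rw [← Real.rpow_add_of_nonneg h0 (by linarith) hθ0.le]; ring_nf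
      have h2 : max (X ω) 0 ^ θ ≤ |Y ω| ^ (2 * θ) := by
        calc max (X ω) 0 ^ θ = (√(max (X ω) 0)) ^ (2 * θ) := by
              rw [Real.sqrt_eq_rpow, ← Real.rpow_mul h0]; ring_nf
          _ ≤ _ := by gcongr
      have h3 : max (X ω) 0 ≤ |X ω| := max_le (le_abs_self _) (abs_nonneg _)
      have h4 : 0 ≤ α - θ := by linarith
      rw [h1]
      gcongr
    · rw [norm_zero]; positivity
  have hD := hXY.const_mul (2 ^ α)
  refine ⟨fun x hx => hD.mono' (hm x).aestronglyMeasurable (Eventually.of_forall (hb x hx)), ?_⟩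
  suffices h : Tendsto (fun x => ∫ ω, (if √(max (X ω) 0) < |Y ω| then
      tailEnvelope α r x (2 * max (X ω) 0) else 0) ∂μ) atTop (nhds (∫ _, 0 ∂μ)) by
    rwa [integral_zero] at h
  refine tendsto_integral_filter_of_dominated_convergence _
    (Eventually.of_forall fun x => (hm x).aestronglyMeasurable) ?_ hD
    (Eventually.of_forall fun ω => ?_)
  · filter_upwards [eventually_gt_atTop 0] with x hx using Eventually.of_forall (hb x hx)
  · split_ifs
    · exact tendsto_tailEnvelope hr (by have := le_max_right (X ω) 0; linarith)
    · exact tendsto_const_nhds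

/-- The increments of the scaled remainder are negligible up to the tail of `Y`. -/
lemma exists_eventually_abs_integral_tailRemainder_le {Ω : Type*} [MeasurableSpace Ω]
    {μ : Measure Ω} {X Y : Ω → ℝ} [IsProbabilityMeasure μ]
    (hX : Measurable X) (hY : Measurable Y) {Q : ℝ → ℝ} {α c r C θ : ℝ} (hα : 0 < α) (hr : 0 < r)
    (hC : 0 ≤ C) (hc : 0 ≤ c) (hθ0 : 0 < θ) (hθ1 : θ ≤ 1) (hθα : θ ≤ α)
    (hmono : Monotone Q) (hQ0 : ∀ w ≤ 0, Q w = 0)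
    (hQ : ∀ w > 0, |Q w - c * (min w 1) ^ α| ≤ C * min (w ^ (α / 2)) (w ^ (α + r)))
    (hXm : Integrable (fun ω => |X ω| ^ (α - θ / 4)) μ)
    (hXY : Integrable (fun ω => |X ω| ^ (α - θ) * |Y ω| ^ (2 * θ)) μ)
    (hYb : ∃ C₁ ≥ 0, ∃ x₀ > 0, ∀ x ≥ x₀, ∫⁻ ω, ENNReal.ofReal
      (min ((2 * max (Y ω) 0 / x) ^ (α / 2)) ((2 * max (Y ω) 0 / x) ^ (α + r))) ∂μ ≤
      ENNReal.ofReal (C₁ * μ.real {ω | x < Y ω}))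
    (hosc : ∃ C₂ ≥ 0, ∃ K₀ : ℝ, ∃ ε > (0:ℝ), ∀ K ≥ K₀, ∀ x > 0,
      ∫⁻ ω in {ω | K < X ω}, ENNReal.ofReal (Q ((X ω + √(X ω)) / x) - Q ((X ω - √(X ω)) / x)) ∂μ ≤
      ENNReal.ofReal (C₂ * K ^ (-ε) * x ^ (-α))) :
    ∃ D ≥ 0, ∀ ε > 0, ∀ᶠ x in atTop, |∫ ω, (tailRemainder Q α c x (X ω + Y ω) -
      tailRemainder Q α c x (X ω)) ∂μ| ≤ D * (x ^ α * μ.real {ω | x < Y ω}) + ε := by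
  obtain ⟨C₁, hC₁, x₀, hx₀, hYb⟩ := hYb
  obtain ⟨C₂, hC₂, K₀, δ, hδ, hosc⟩ := hosc
  refine ⟨2 * C * C₁, by positivity, fun ε hε => ?_⟩
  set m := ∫ ω, |X ω| ^ (α - θ / 4) ∂μ with hm
  have hm0 : 0 ≤ m := integral_nonneg fun ω => by positivity
  have l1 : Tendsto (fun K : ℝ => c * (1 + α) * 2 ^ α * m * K ^ (-(θ / 4))) atTop (nhds 0) := by
    simpa using (tendsto_rpow_neg_atTop (by positivity : 0 < θ / 4)).const_mul
      (c * (1 + α) * 2 ^ α * m)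
  have l2 : Tendsto (fun K : ℝ => C₂ * K ^ (-δ)) atTop (nhds 0) := by
    simpa using (tendsto_rpow_neg_atTop hδ).const_mul C₂
  obtain ⟨K, hK1, hK2, hK4, hK0⟩ := ((l1.eventually_le_const (u := ε / 4) (by positivity)).and
    ((l2.eventually_le_const (u := ε / 4) (by positivity)).and
      ((eventually_ge_atTop 4).and (eventually_ge_atTop K₀)))).exists
  obtain ⟨hHi, hHt⟩ := tendsto_integral_ite_tailEnvelope (r := r) hX hY hα hr hθ0 hθα hXY
  have l3 : Tendsto (fun x => 2 * C * tailEnvelope α r x (2 * K)) atTop (nhds 0) := by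
    simpa using (tendsto_tailEnvelope hr (by linarith)).const_mul (2 * C)
  have l4 := hHt.const_mul (2 * C)
  rw [mul_zero] at l4
  filter_upwards [eventually_ge_atTop x₀, l3.eventually_le_const (u := ε / 4) (by positivity),
    l4.eventually_le_const (u := ε / 4) (by positivity)] with x hxx₀ hx3 hx4
  have hx : 0 < x := by linarith
  have hbpos : ∀ ω, 0 ≤ 2 * max (Y ω) 0 := fun ω => by positivity
  set t1 : Ω → ℝ := fun ω => 2 * C * tailEnvelope α r x (2 * max (Y ω) 0) with ht1
  set t2 : ℝ := 2 * C * tailEnvelope α r x (2 * K) with ht2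
  set t3 : Ω → ℝ := fun ω => 2 * C * (if √(max (X ω) 0) < |Y ω| then
    tailEnvelope α r x (2 * max (X ω) 0) else 0) with ht3
  set t4 : Ω → ℝ := fun ω => c * (1 + α) * 2 ^ α * K ^ (-(θ / 4)) * |X ω| ^ (α - θ / 4) with ht4
  set t5 : Ω → ℝ := fun ω => if K < X ω then
    x ^ α * (Q ((X ω + √(X ω)) / x) - Q ((X ω - √(X ω)) / x)) else 0 with ht5
  have hQm := hmono.measurable
  have m1 : Measurable t1 := by
    have := measurable_tailEnvelope α r x
    fun_prop
  have m4 : Measurable t4 := by fun_prop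
  have i1 : ∫⁻ ω, ENNReal.ofReal (t1 ω) ∂μ ≤
      ENNReal.ofReal (2 * C * C₁ * (x ^ α * μ.real {ω | x < Y ω})) := by
    have : ∀ ω, ENNReal.ofReal (t1 ω) = ENNReal.ofReal (2 * C * x ^ α) * ENNReal.ofReal
        (min ((2 * max (Y ω) 0 / x) ^ (α / 2)) ((2 * max (Y ω) 0 / x) ^ (α + r))) := by
      intro ω
      rw [← ENNReal.ofReal_mul (by positivity), ht1]
      simp only [tailEnvelope, mul_assoc]
    simp_rw [this]
    rw [lintegral_const_mul _ (by fun_prop)]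
    refine (mul_le_mul_right (hYb x hxx₀) _).trans_eq ?_
    rw [← ENNReal.ofReal_mul (by positivity)]
    congr 1
    ring
  have i3 : ∫⁻ ω, ENNReal.ofReal (t3 ω) ∂μ ≤ ENNReal.ofReal (ε / 4) := by
    rw [← ofReal_integral_eq_lintegral_ofReal ((hHi x hx).const_mul _)
      (Eventually.of_forall fun ω => ?_), integral_const_mul]
    · exact ENNReal.ofReal_le_ofReal hx4
    · refine mul_nonneg (by positivity) ?_
      split_ifs
      · exact tailEnvelope_nonneg hx (by positivity)
      · exact le_rfl
  have i4 : ∫⁻ ω, ENNReal.ofReal (t4 ω) ∂μ ≤ ENNReal.ofReal (ε / 4) := by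
    rw [← ofReal_integral_eq_lintegral_ofReal (hXm.const_mul _)
      (Eventually.of_forall fun ω => ?_), integral_const_mul]
    · refine ENNReal.ofReal_le_ofReal (le_trans (le_of_eq ?_) hK1)
      ring
    · have : 0 < K := by linarith
      positivity
  have i5 : ∫⁻ ω, ENNReal.ofReal (t5 ω) ∂μ ≤ ENNReal.ofReal (ε / 4) := by
    have hs : MeasurableSet {ω | K < X ω} := measurableSet_lt measurable_const hX
    have : ∀ ω, ENNReal.ofReal (t5 ω) = {ω | K < X ω}.indicator (fun ω => ENNReal.ofReal (x ^ α) *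
        ENNReal.ofReal (Q ((X ω + √(X ω)) / x) - Q ((X ω - √(X ω)) / x))) ω := by
      intro ω
      by_cases h : K < X ω
      · rw [indicator_of_mem (by exact h), ← ENNReal.ofReal_mul (by positivity), ht5]
        simp only [if_pos h]
      · rw [indicator_of_notMem (by exact h), ht5]
        simp only [if_neg h, ENNReal.ofReal_zero]
    simp_rw [this]
    rw [lintegral_indicator hs, lintegral_const_mul _ (by fun_prop)]
    refine (mul_le_mul_right (hosc K hK0 x hx) _).trans ?_
    rw [← ENNReal.ofReal_mul (by positivity)]
    refine ENNReal.ofReal_le_ofReal (le_trans (le_of_eq ?_) hK2)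
    rw [Real.rpow_neg hx.le]
    field_simp
  have hpt : ∀ ω, ‖tailRemainder Q α c x (X ω + Y ω) - tailRemainder Q α c x (X ω)‖ₑ ≤
      ENNReal.ofReal (t1 ω) + (ENNReal.ofReal t2 + (ENNReal.ofReal (t4 ω) +
        (ENNReal.ofReal (t3 ω) + ENNReal.ofReal (t5 ω)))) := by
    intro ω
    rw [← ofReal_norm, Real.norm_eq_abs]
    refine (ENNReal.ofReal_le_ofReal (abs_tailRemainder_add_sub_le hα hr hC hc hθ0 hθ1 hθα hx hK4
      hmono hQ0 hQ (X ω) (Y ω))).trans ?_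
    refine (ENNReal.ofReal_le_ofReal (le_of_eq ?_)).trans (ENNReal.ofReal_add_le.trans
      (add_le_add_right (ENNReal.ofReal_add_le.trans (add_le_add_right
        (ENNReal.ofReal_add_le.trans (add_le_add_right ENNReal.ofReal_add_le _)) _)) _))
    simp only [ht1, ht2, ht3, ht4, ht5]
    ring
  have m3 : Measurable fun ω => ENNReal.ofReal (t3 ω) := by
    refine Measurable.ennreal_ofReal (Measurable.const_mul (Measurable.ite
      (measurableSet_lt (by fun_prop) (by fun_prop))
      ((measurable_tailEnvelope α r x).comp (by fun_prop)) measurable_const) _)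
  have hfinal : ENNReal.ofReal |∫ ω, (tailRemainder Q α c x (X ω + Y ω) -
      tailRemainder Q α c x (X ω)) ∂μ| ≤
      ENNReal.ofReal (2 * C * C₁ * (x ^ α * μ.real {ω | x < Y ω}) + ε) := by
    rw [← Real.norm_eq_abs, ofReal_norm]
    refine (enorm_integral_le_lintegral_enorm _).trans ((lintegral_mono hpt).trans ?_)
    rw [lintegral_add_left m1.ennreal_ofReal, lintegral_add_left measurable_const,
      lintegral_add_left m4.ennreal_ofReal, lintegral_add_left m3, lintegral_const,
      measure_univ, mul_one]
    refine (add_le_add i1 (add_le_add (ENNReal.ofReal_le_ofReal hx3)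
      (add_le_add i4 (add_le_add i3 i5)))).trans_eq ?_
    rw [← ENNReal.ofReal_add (by positivity) (by positivity),
      ← ENNReal.ofReal_add (by positivity) (by positivity),
      ← ENNReal.ofReal_add (by positivity) (by positivity),
      ← ENNReal.ofReal_add (by positivity) (by positivity)]
    congr 1
    ring
  exact (ENNReal.ofReal_le_ofReal_iff (by positivity)).1 hfinal

/-- Splitting a quantity that is eventually below `D * L + ε`, for every `ε`, as `O(L) + o(1)`. -/
lemma exists_isBigO_add_tendsto_zero {E L : ℝ → ℝ} {D : ℝ} (hD : 0 ≤ D)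
    (hL : ∀ x > 0, 0 ≤ L x) (h : ∀ ε > 0, ∀ᶠ x in atTop, |E x| ≤ D * L x + ε) :
    ∃ e₁ e₂ : ℝ → ℝ, e₁ =O[atTop] L ∧ Tendsto e₂ atTop (nhds 0) ∧ ∀ x, E x = e₁ x + e₂ x := by
  refine ⟨fun x => max (min (E x) (D * L x)) (-(D * L x)),
    fun x => E x - max (min (E x) (D * L x)) (-(D * L x)), ?_, ?_, fun x => by ring⟩
  · refine Asymptotics.IsBigO.of_bound D ?_
    filter_upwards [eventually_gt_atTop 0] with x hx
    have h1 := mul_nonneg hD (hL x hx)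
    rw [Real.norm_eq_abs, Real.norm_eq_abs, abs_of_nonneg (hL x hx), abs_le]
    exact ⟨le_max_right _ _, max_le (min_le_right _ _) (by linarith)⟩
  · rw [Metric.tendsto_atTop']
    intro ε hε
    obtain ⟨N, hN⟩ := eventually_atTop.1 ((h (ε / 2) (by positivity)).and (eventually_gt_atTop 0))
    refine ⟨N, fun x hx => ?_⟩
    obtain ⟨h1, h2⟩ := hN x hx.le
    have h3 := mul_nonneg hD (hL x h2)
    rw [dist_zero_right, Real.norm_eq_abs]
    refine lt_of_le_of_lt (b := ε / 2) ?_ (by linarith)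
    rw [abs_le] at h1 ⊢
    rcases le_total (E x) (D * L x) with h4 | h4
    · rw [min_eq_left h4]
      rcases le_total (E x) (-(D * L x)) with h5 | h5
      · rw [max_eq_right h5]; constructor <;> linarith
      · rw [max_eq_left h5]; constructor <;> linarith
    · rw [min_eq_right h4, max_eq_left (by linarith)]; constructor <;> linarith

/-- Quantitative renewal estimates in the Cramér regime. -/
lemma exists_renewalTail_estimates {ν : Measure ℝ} [IsProbabilityMeasure ν] {α γ δ Y₀ ρ : ℝ}
    (hα : 0 < α) (hαγ : α < γ) (hγ : Integrable (fun x => Real.exp (γ * x)) ν)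
    (h1 : ∫ x, Real.exp (α * x) ∂ν = 1) (hρ : ∫ x, x * Real.exp (α * x) ∂ν = ρ) (hρ0 : 0 < ρ)
    (hlt : ∀ κ ∈ Ioo 0 α, ∫ x, Real.exp (κ * x) ∂ν < 1)
    (hδ : 0 < δ)
    (hsnl : ∀ y : ℝ, Y₀ ≤ |y| → ‖complexMGF id ν (α + y * Complex.I)‖ ≤ 1 - δ) :
    (∀ y, renewalMeasure ν (Ioi y) < ⊤) ∧
    (∃ r > 0, ∃ C ≥ 0, ∀ w > 0, renewalTail ν w ≤ C * w ^ (α / 2) ∧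
      |renewalTail ν w - (α * ρ)⁻¹ * (min w 1) ^ α| ≤ C * min (w ^ (α / 2)) (w ^ (α + r))) ∧
    ∀ s > α, ∃ K, 0 ≤ K ∧ ∀ y, ∫⁻ v in Iic y, ENNReal.ofReal (Real.exp (s * v))
      ∂(renewalMeasure ν) ≤ ENNReal.ofReal (K * Real.exp ((s - α) * y)) := by
  have hα2 : 0 < α / 2 := by positivity
  have hmem : α / 2 ∈ Ioo 0 α := ⟨hα2, by linarith⟩
  have hint := integrable_exp_renewalMeasure ν
    (_root_.integrable_exp_mul_of_mem_Icc hγ ⟨hα2.le, by linarith⟩) (hlt _ hmem)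
  have hmk := measure_Ioi_le_of_integrable_exp hα2 hint
  have hfin : ∀ y, renewalMeasure ν (Ioi y) < ⊤ := fun y => (hmk y).1
  set C₀ := ∫ v, Real.exp (α / 2 * v) ∂(renewalMeasure ν)
  have hC₀ : 0 ≤ C₀ := integral_nonneg fun _ => Real.exp_nonneg _
  obtain ⟨r, hr, -, C₁, hC₁⟩ := exists_abs_renewal_tail_sub_le hα hαγ hγ h1 hρ hρ0 hlt hδ hsnl
  have hc : 0 < (α * ρ)⁻¹ := by positivity
  refine ⟨hfin, ⟨r, hr, exists_renewalTail_bounds hα hc.le (fun y => (hmk y).2) hC₁ hr⟩,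
    fun s hs => exists_setLIntegral_exp_Iic_le (C := (α * ρ)⁻¹ + C₁ + C₀) hs hα hfin fun y => ?_⟩
  have hC10 : 0 ≤ C₁ := by
    have := (abs_nonneg _).trans (hC₁ 0 le_rfl)
    simpa using this
  rcases le_or_gt 0 y with hy | hy
  · have h2 := (abs_le.1 (hC₁ y hy)).2
    have h3 : Real.exp (-r * y) ≤ 1 := Real.exp_le_one_iff.2 (by nlinarith)
    have h4 : Real.exp (α * y) * (renewalMeasure ν).real (Ioi y) ≤ (α * ρ)⁻¹ + C₁ + C₀ := by
      nlinarith
    rw [neg_mul, Real.exp_neg, ← div_eq_mul_inv, le_div_iff₀ (Real.exp_pos _)]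
    linarith
  · refine (hmk y).2.trans ?_
    have h3 : Real.exp (-(α / 2) * y) ≤ Real.exp (-α * y) := Real.exp_le_exp.2 (by nlinarith)
    gcongr
    linarith

lemma integrable_abs_rpow_of_pos_neg {Ω : Type*} [MeasurableSpace Ω] {μ : Measure Ω}
    {B : Ω → ℝ} {κ : ℝ} (hB : Measurable B)
    (hp : Integrable (fun ω => max (B ω) 0 ^ κ) μ)
    (hn : Integrable (fun ω => max (-B ω) 0 ^ κ) μ) : Integrable (fun ω => |B ω| ^ κ) μ := by
  refine (hp.add hn).mono' (Measurable.aestronglyMeasurable (by fun_prop))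
    (Eventually.of_forall fun ω => ?_)
  rw [Real.norm_eq_abs, abs_of_nonneg (by positivity), Pi.add_apply]
  rcases le_total 0 (B ω) with h | h
  · rw [abs_of_nonneg h, max_eq_left h]
    exact le_add_of_nonneg_right (by positivity)
  · rw [abs_of_nonpos h, max_eq_left (a := -B ω) (by linarith)]
    exact le_add_of_nonneg_left (by positivity)

/-- The decomposition of the tail of the perpetuity into a truncated moment, a defect of
additivity, and a remainder. -/
lemma rpow_mul_measureReal_gt_eq {Ω : Type*} [MeasurableSpace Ω] {μ : Measure Ω}
    [IsProbabilityMeasure μ] {A B R : Ω → ℝ} (hA : Measurable A) (hB : Measurable B)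
    (hR : Measurable R) (hAR : IndepFun A R μ) (hA0 : ∀ᵐ ω ∂μ, 0 < A ω)
    (hfix : Measure.map R μ = Measure.map (fun ω => A ω * R ω + B ω) μ)
    (hfin : ∀ y, renewalMeasure (μ.map fun ω => Real.log (A ω)) (Ioi y) < ⊤)
    {α c C x : ℝ} (hα : 0 < α) (hx : 0 < x)
    (hQ : ∀ w > 0, renewalTail (μ.map fun ω => Real.log (A ω)) w ≤ C * w ^ (α / 2))
    (hC : 0 ≤ C) (hRα : Integrable (fun ω => |R ω| ^ (α / 2)) μ) :
    x ^ α * μ.real {ω | x < R ω} = c * (∫ ω, truncPow α x (B ω) ∂μ) +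
      c * (∫ ω, (truncPow α x (A ω * R ω + B ω) - truncPow α x (A ω * R ω) -
        truncPow α x (B ω)) ∂μ) +
      ∫ ω, (tailRemainder (renewalTail (μ.map fun ω => Real.log (A ω))) α c x
        (A ω * R ω + B ω) - tailRemainder (renewalTail (μ.map fun ω => Real.log (A ω))) α c x
        (A ω * R ω)) ∂μ := by
  set Q := renewalTail (μ.map fun ω => Real.log (A ω))
  have hQm : Measurable Q := (monotone_renewalTail hfin).measurable
  have hint : Integrable (fun ω => Q (R ω / x)) μ := by
    refine (hRα.const_mul (C * x ^ (-(α / 2)))).mono'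
      (Measurable.aestronglyMeasurable (by fun_prop)) (Eventually.of_forall fun ω => ?_)
    rw [Real.norm_eq_abs, abs_of_nonneg (renewalTail_nonneg _ _)]
    rcases le_or_gt (R ω) 0 with h | h
    · rw [renewalTail_of_nonpos _ (div_nonpos_of_nonpos_of_nonneg h hx.le)]
      positivity
    · refine (hQ _ (by positivity)).trans_eq ?_
      rw [Real.div_rpow h.le hx.le, abs_of_pos h, Real.rpow_neg hx.le]
      ring
  obtain ⟨i1, i2, heq⟩ := measureReal_gt_eq_integral_renewalTail_sub hA hR
    (S := fun ω => A ω * R ω + B ω) (by fun_prop) hAR hA0 hfix hfin hx hint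
  have f1 := integrable_truncPow_comp (μ := μ) hB hα hx.le
  have f2 := integrable_truncPow_comp (μ := μ) (X := fun ω => A ω * R ω + B ω) (by fun_prop) hα
    hx.le
  have f3 := integrable_truncPow_comp (μ := μ) (X := fun ω => A ω * R ω) (by fun_prop) hα hx.le
  have f4 : Integrable (fun ω => truncPow α x (A ω * R ω + B ω) - truncPow α x (A ω * R ω)) μ :=
    f2.sub f3
  have f5 : Integrable (fun ω => tailRemainder Q α c x (A ω * R ω + B ω)) μ :=
    (i1.const_mul _).sub (f2.const_mul _)
  have f6 : Integrable (fun ω => tailRemainder Q α c x (A ω * R ω)) μ :=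
    (i2.const_mul _).sub (f3.const_mul _)
  rw [heq, integral_sub f4 f1, integral_sub f2 f3, integral_sub f5 f6]
  unfold tailRemainder
  rw [integral_sub (i1.const_mul _) (f2.const_mul _), integral_sub (i2.const_mul _)
    (f3.const_mul _), integral_const_mul, integral_const_mul, integral_const_mul,
    integral_const_mul]
  ring

/-- Second-order tail asymptotics for the perpetuity: under
(A-1)–(A-2), (B-1)–(B-3), the regularity condition on `log A`, `E[A^γ] < ∞` for some
`γ > max{α, α²/β}`, and strong non-latticeness of the law `P(Z ∈ ·) = E[A^α 1{log A ∈ ·}]`,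
one has, as `x → ∞`,
`x^α P(R > x) = L̃(x)/ρ + E[(AR+B)_+^α − (AR)_+^α − B_+^α]/(αρ) + O(L(x)) + o(1)`,
where the expectation is finite. -/
theorem perpetuity_tail_second_order
    {Ω : Type*} [MeasurableSpace Ω] (μ : Measure Ω) [IsProbabilityMeasure μ]
    (A B R : Ω → ℝ)
    (hAmeas : Measurable A) (hBmeas : Measurable B) (hRmeas : Measurable R)
    -- R is independent of (A,B) and solves R =_d A·R + B
    (hindep : IndepFun (fun ω => (A ω, B ω)) R μ)
    (hfix : Measure.map R μ = Measure.map (fun ω => A ω * R ω + B ω) μ)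
    -- (A-1)
    (hApos : ∀ᵐ ω ∂μ, 0 ≤ A ω)
    (hlogAint : Integrable (fun ω => Real.log (A ω)) μ)
    (hlogAneg : (∫ ω, Real.log (A ω) ∂μ) < 0)
    -- (A-2)
    (α : ℝ) (hα : 0 < α)
    (hAα : (∫ ω, A ω ^ α ∂μ) = 1)
    (hρint : Integrable (fun ω => A ω ^ α * Real.log (A ω)) μ)
    -- (B-1)
    (L : ℝ → ℝ) (hLdef : ∀ x, L x = x ^ α * (μ {ω | x < B ω}).toReal)
    (hL : SlowlyVarying L)
    -- (B-2)
    (hBinf : ¬ Integrable (fun ω => max (B ω) 0 ^ α) μ)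
    -- (B-3)
    (hBneg : ∀ η ∈ Set.Ioo (0:ℝ) α, Integrable (fun ω => max (-B ω) 0 ^ (α - η)) μ)
    -- regularity of the law of log A
    (β : ℝ) (hβ : 0 < β)
    (hcond : ∃ C > (0:ℝ), ∃ h₀ > (0:ℝ), ∀ h ∈ Set.Ioc (0:ℝ) h₀, ∀ a : ℝ,
      (μ {ω | a < Real.log (A ω) ∧ Real.log (A ω) ≤ a + h}).toReal ≤ C * h ^ β)
    (γ : ℝ) (hγ : max α (α ^ 2 / β) < γ)
    (hAγ : Integrable (fun ω => A ω ^ γ) μ)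
    -- the law of Z, P(Z ∈ ·) = E[A^α 1{log A ∈ ·}], is strongly non-lattice
    (hsnl : MeasureStronglyNonLattice
      (Measure.map (fun ω => Real.log (A ω))
        (μ.withDensity fun ω => ENNReal.ofReal (A ω ^ α)))) :
    Integrable (fun ω => max (A ω * R ω + B ω) 0 ^ α - max (A ω * R ω) 0 ^ α -
      max (B ω) 0 ^ α) μ ∧
    ∃ e₁ e₂ : ℝ → ℝ, (e₁ =O[atTop] L) ∧ Filter.Tendsto e₂ atTop (nhds 0) ∧
      ∀ x : ℝ, x ^ α * (μ {ω | x < R ω}).toReal =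
        (∫ t in Set.Ioc (0:ℝ) x, L t / t) / (∫ ω, A ω ^ α * Real.log (A ω) ∂μ) +
        (∫ ω, (max (A ω * R ω + B ω) 0 ^ α - max (A ω * R ω) 0 ^ α -
          max (B ω) 0 ^ α) ∂μ) / (α * ∫ ω, A ω ^ α * Real.log (A ω) ∂μ) +
        e₁ x + e₂ x := by
  obtain ⟨hγα, -⟩ := max_lt_iff.1 hγ
  have hγ0 : 0 < γ := hα.trans hγα
  have hlog0 : ∀ᵐ ω ∂μ, Real.log (A ω) ≠ 0 := by
    obtain ⟨C, -, h₀, hh₀, h⟩ := hcond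
    exact ae_ne_of_measure_Ioc_le hβ hh₀ h 0
  have hA0 : ∀ᵐ ω ∂μ, 0 < A ω := by
    filter_upwards [hApos, hlog0] with ω h1 h2
    exact h1.lt_of_ne fun h => h2 (by rw [← h, Real.log_zero])
  have hAR : IndepFun A R μ := hindep.comp measurable_fst measurable_id
  have hlogm : Measurable fun ω => Real.log (A ω) := by fun_prop
  set ν := μ.map fun ω => Real.log (A ω) with hν
  have hνp : IsProbabilityMeasure ν := Measure.isProbabilityMeasure_map hlogm.aemeasurable
  have hexp : ∀ κ : ℝ, (fun ω => Real.exp (κ * Real.log (A ω))) =ᵐ[μ] fun ω => A ω ^ κ := by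
    intro κ
    filter_upwards [hA0] with ω hω
    rw [Real.rpow_def_of_pos hω, mul_comm]
  have habs : ∀ κ : ℝ, (fun ω => A ω ^ κ) =ᵐ[μ] fun ω => |A ω| ^ κ := by
    intro κ
    filter_upwards [hA0] with ω hω
    rw [abs_of_pos hω]
  have hexpint : ∀ κ : ℝ, ∫ y, Real.exp (κ * y) ∂ν = ∫ ω, A ω ^ κ ∂μ := by
    intro κ
    rw [hν, integral_map hlogm.aemeasurable (by fun_prop)]
    exact integral_congr_ae (hexp κ)
  have hνγ : Integrable (fun y => Real.exp (γ * y)) ν := by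
    rw [hν, integrable_map_measure (by fun_prop) hlogm.aemeasurable]
    exact hAγ.congr (hexp γ).symm
  have hνα : Integrable (fun y => Real.exp (α * y)) ν :=
    _root_.integrable_exp_mul_of_mem_Icc hνγ ⟨hα.le, hγα.le⟩
  have hν1 : ∫ y, Real.exp (α * y) ∂ν = 1 := by rw [hexpint, hAα]
  have hν0 : ∀ᵐ y ∂ν, y ≠ 0 :=
    (ae_map_iff hlogm.aemeasurable (measurableSet_singleton (0:ℝ)).compl).2 hlog0
  have hlogexp : (fun ω => Real.log (A ω) * Real.exp (α * Real.log (A ω))) =ᵐ[μ]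
      fun ω => A ω ^ α * Real.log (A ω) := by
    filter_upwards [hexp α] with ω hω
    rw [hω, mul_comm]
  have hνρi : Integrable (fun y => y * Real.exp (α * y)) ν := by
    rw [hν, integrable_map_measure (by fun_prop) hlogm.aemeasurable]
    exact hρint.congr hlogexp.symm
  have hνρ : ∫ y, y * Real.exp (α * y) ∂ν = ∫ ω, A ω ^ α * Real.log (A ω) ∂μ := by
    rw [hν, integral_map hlogm.aemeasurable (by fun_prop)]
    exact integral_congr_ae hlogexp
  have hρ0 : 0 < ∫ ω, A ω ^ α * Real.log (A ω) ∂μ := by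
    rw [← hνρ]
    exact integral_mul_exp_pos hα hν0 hνα hν1 hνρi
  set ρ := ∫ ω, A ω ^ α * Real.log (A ω) ∂μ with hρ
  have hlt : ∀ κ ∈ Ioo 0 α, ∫ y, Real.exp (κ * y) ∂ν < 1 := fun κ hκ =>
    integral_exp_mul_lt_one hν0 hνα hν1 hκ
  obtain ⟨δ, hδ, Y₀, hY₀⟩ := exists_norm_complexMGF_le_of_stronglyNonLattice hAmeas hA0 hAα hsnl
  obtain ⟨hfin, ⟨r, hr, C, hC, hQ⟩, hU⟩ :=
    exists_renewalTail_estimates hα hγα hνγ hν1 hνρ hρ0 hlt hδ hY₀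
  obtain ⟨hpos, hlim⟩ := tendsto_tail_ratio_of_slowlyVarying
    (p := fun x => μ.real {ω | x < B ω}) hLdef hL
  -- moments
  have hBm : ∀ κ ∈ Ioo 0 α, Integrable (fun ω => |B ω| ^ κ) μ := by
    intro κ hκ
    refine integrable_abs_rpow_of_pos_neg hBmeas
      (integrable_pos_part_rpow_of_tail hBmeas hκ.1 hκ.2 hpos hlim) ?_
    have := hBneg (α - κ) ⟨by linarith [hκ.2], by linarith [hκ.1]⟩
    rwa [sub_sub_cancel] at this
  have hAm : ∀ κ ∈ Ioo 0 α, Integrable (fun ω => |A ω| ^ κ) μ := by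
    intro κ hκ
    have h := _root_.integrable_exp_mul_of_mem_Icc hνγ ⟨hκ.1.le, (hκ.2.trans hγα).le⟩
    rw [hν, integrable_map_measure (by fun_prop) hlogm.aemeasurable] at h
    exact h.congr ((hexp κ).trans (habs κ))
  have hRm : ∀ κ ∈ Ioo 0 α, Integrable (fun ω => |R ω| ^ κ) μ := by
    intro κ hκ
    refine integrable_abs_rpow_of_fixed_point hAmeas hBmeas hRmeas hAR hfix hκ.1 (hAm κ hκ) ?_ ?_
      (hBm κ hκ)
    · rw [← integral_congr_ae (habs κ), ← hexpint]
      exact hlt κ hκ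
    · rw [← integral_congr_ae (habs κ), ← hexpint]
      exact integral_exp_pos (_root_.integrable_exp_mul_of_mem_Icc hνγ
        ⟨hκ.1.le, (hκ.2.trans hγα).le⟩)
  have hAγ' : Integrable (fun ω => |A ω| ^ γ) μ := hAγ.congr (habs γ)
  set d := 1 - α / γ with hd
  have hd0 : 0 < d := by rw [hd, sub_pos, div_lt_one hγ0]; exact hγα
  have hd1 : d < 1 := by rw [hd]; have : 0 < α / γ := by positivity
                         linarith
  obtain ⟨θ, hθ0, hθ1, hθα, hθd⟩ : ∃ θ > 0, θ ≤ 1 ∧ θ ≤ α / 2 ∧ θ ≤ d * α / 3 :=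
    ⟨min 1 (min (α / 2) (d * α / 3)), by positivity, min_le_left _ _,
      (min_le_right _ _).trans (min_le_left _ _), (min_le_right _ _).trans (min_le_right _ _)⟩
  have hmixed : ∀ p ∈ Ioo 0 α, ∀ q > 0, q < α * (1 - p / γ) →
      Integrable (fun ω => |A ω * R ω| ^ p * |B ω| ^ q) μ := by
    intro p hp q hq hqp
    have h1 : 0 < 1 - p / γ := by rw [sub_pos, div_lt_one hγ0]; linarith [hp.2]
    exact integrable_mul_rpow_mul_rpow hAmeas hBmeas hindep hp.1.le (hp.2.trans hγα) hAγ'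
      (hBm _ ⟨by positivity, by rwa [div_lt_iff₀ h1]⟩) (hRm p hp)
  have hθγ : (α - θ) / γ < α / γ := by gcongr; linarith
  have hdα : 0 < d * α := by positivity
  have hdlt : d * α < α * (1 - (α - θ) / γ) := by rw [hd]; nlinarith
  have mix1 := hmixed (α - θ) ⟨by linarith, by linarith⟩ θ hθ0 (by linarith)
  have mix2 := hmixed (α - θ) ⟨by linarith, by linarith⟩ (2 * θ) (by positivity) (by linarith)
  have mix3 := hmixed θ ⟨hθ0, by linarith⟩ (α - θ) (by linarith) (by
    have : α * (θ / γ) < θ := by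
      rw [← mul_div_assoc, div_lt_iff₀ hγ0]
      nlinarith
    linarith)
  have hARm : Integrable (fun ω => |A ω * R ω| ^ (α - θ / 4)) μ := by
    have hmem : α - θ / 4 ∈ Ioo 0 α := ⟨by linarith, by linarith⟩
    have h := (hAR.comp (φ := fun a => |a| ^ (α - θ / 4)) (ψ := fun a => |a| ^ (α - θ / 4))
      (by fun_prop) (by fun_prop)).integrable_mul (hAm _ hmem) (hRm _ hmem)
    refine h.congr (Eventually.of_forall fun ω => ?_)
    simp only [Pi.mul_apply, Function.comp_apply, abs_mul]
    rw [Real.mul_rpow (abs_nonneg _) (abs_nonneg _)]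
  -- oscillation of the renewal tail
  have hosc : ∃ C₂ ≥ 0, ∃ K₀ : ℝ, ∃ ε > (0:ℝ), ∀ K ≥ K₀, ∀ x > 0,
      ∫⁻ ω in {ω | K < A ω * R ω}, ENNReal.ofReal (renewalTail ν ((A ω * R ω + √(A ω * R ω)) / x) -
        renewalTail ν ((A ω * R ω - √(A ω * R ω)) / x)) ∂μ ≤
      ENNReal.ofReal (C₂ * K ^ (-ε) * x ^ (-α)) := by
    obtain ⟨t, ht0, htα, htd⟩ : ∃ t > 0, t ≤ α / 2 ∧ t ≤ β / 2 * d :=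
      ⟨min (α / 2) (β / 2 * d), by positivity, min_le_left _ _, min_le_right _ _⟩
    obtain ⟨C₁, hC₁, z₀, -, hP⟩ := exists_measure_abs_mul_sub_le hAmeas hRmeas hAR hA0 hcond hAγ
      (κ := α - t) (by linarith) (by linarith) (hRm _ ⟨by linarith, by linarith⟩)
    have hs : α < α - t + β / 2 * (1 - (α - t) / γ) := by
      have h1 : (α - t) / γ < α / γ := by gcongr; linarith
      have h2 : β / 2 * d < β / 2 * (1 - (α - t) / γ) := by
        rw [hd]; gcongr
      linarith
    obtain ⟨K₁, hK₁, hU⟩ := hU _ hs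
    obtain ⟨C₂, hC₂, h⟩ := exists_setLIntegral_renewalTail_sub_le (ν := ν)
      (hAmeas.mul hRmeas) hC₁ hK₁ hfin hP hU
    exact ⟨C₂, hC₂, max 4 (2 * z₀), _, sub_pos.2 hs, fun K hK x hx =>
      h K ((le_max_left _ _).trans hK) ((le_max_right _ _).trans hK) x hx⟩
  obtain ⟨D, hD, hrem⟩ := exists_eventually_abs_integral_tailRemainder_le (μ := μ)
    (X := fun ω => A ω * R ω) (Y := B) (hAmeas.mul hRmeas) hBmeas (Q := renewalTail ν) hα hr hC
    (by positivity : 0 ≤ (α * ρ)⁻¹) hθ0 hθ1 (by linarith) (monotone_renewalTail hfin)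
    (fun w hw => renewalTail_of_nonpos ν hw) (fun w hw => (hQ w hw).2) hARm mix2
    (exists_lintegral_min_rpow_le hBmeas (by linarith) (by linarith) (by linarith) hpos hlim) hosc
  obtain ⟨hJ, hJlim⟩ := tendsto_integral_truncPow_add_sub_sub (μ := μ)
    (X := fun ω => A ω * R ω) (Y := B) (hAmeas.mul hRmeas) hBmeas hα hθ0.le hθ1 (by linarith)
    mix1 mix3
  refine ⟨hJ, ?_⟩
  set J := ∫ ω, (max (A ω * R ω + B ω) 0 ^ α - max (A ω * R ω) 0 ^ α - max (B ω) 0 ^ α) ∂μ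
  set E : ℝ → ℝ := fun x => x ^ α * (μ {ω | x < R ω}).toReal -
    (∫ t in Ioc (0:ℝ) x, L t / t) / ρ - J / (α * ρ) with hE
  suffices hbound : ∀ ε > 0, ∀ᶠ x in atTop, |E x| ≤ D * L x + ε by
    obtain ⟨e₁, e₂, h₁, h₂, h₁₂⟩ :=
      exists_isBigO_add_tendsto_zero hD (fun x hx => (hL.1 x hx).le) hbound
    refine ⟨e₁, e₂, h₁, h₂, fun x => ?_⟩
    have := h₁₂ x
    simp only [hE] at this
    linarith
  intro ε hε
  have hJ0 := (hJlim.sub_const J).const_mul (α * ρ)⁻¹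
  rw [sub_self, mul_zero] at hJ0
  have hJ1 := hJ0.abs
  rw [abs_zero] at hJ1
  filter_upwards [hrem (ε / 2) (by positivity),
    hJ1.eventually_le_const (u := ε / 2) (by positivity), eventually_gt_atTop 0] with x hx1 hx2 hx
  have hdec := rpow_mul_measureReal_gt_eq hAmeas hBmeas hRmeas hAR hA0 hfix hfin
    (c := (α * ρ)⁻¹) hα hx (fun w hw => (hQ w hw).1) hC (hRm _ ⟨by linarith, by linarith⟩)
  have hLt := integral_truncPow_eq (μ := μ) hBmeas hα hx hLdef
  have hLx : x ^ α * μ.real {ω | x < B ω} = L x := (hLdef x).symm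
  rw [hLx] at hx1
  have hmain : E x = (α * ρ)⁻¹ * (∫ ω, (truncPow α x (A ω * R ω + B ω) -
        truncPow α x (A ω * R ω) - truncPow α x (B ω)) ∂μ - J) +
      ∫ ω, (tailRemainder (renewalTail ν) α (α * ρ)⁻¹ x (A ω * R ω + B ω) -
        tailRemainder (renewalTail ν) α (α * ρ)⁻¹ x (A ω * R ω)) ∂μ := by
    simp only [hE]
    rw [← measureReal_def, hdec, hLt]
    field_simp
    ring
  rw [hmain]
  refine (abs_add_le _ _).trans ?_
  linarith
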